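/- arXiv:1405.2805 — 5 statements merged into one kernel-verified Lean document; each statement's English description precedes it below -/
import Mathlib

section
/- Let p = (p_1,…,p_n) be a sequence of positive integers with k = min_i p_i and k ≠ 2, and let A, B ⊆ S_p be cross-intersecting families. Then |A|·|B| = |S_p|²/k² holds if and only if A = B = {x ∈ S_p : x_i = j} for some coordinate i ∈ [n] with p_i = k and some value j ∈ [k]. -/
open Finset

/-- Families `A`, `B` of vectors in `S_p` (modelled as `∀ i, Fin (p i)`) are
`r`-cross-intersecting: every `x ∈ A` and `y ∈ B` agree in at least `r`
coordinates. -/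
def CrossInt {n : ℕ} {p : Fin n → ℕ} (r : ℕ)
    (A B : Finset (∀ i, Fin (p i))) : Prop :=
  ∀ x ∈ A, ∀ y ∈ B, r ≤ (univ.filter (fun i => x i = y i)).card

namespace CrossAux

noncomputable def E {n : ℕ} (p : Fin n → ℕ) (h : (∀ i, Fin (p i)) → ℝ) : ℝ :=
  ∑ x, (∏ i, (1 / (p i : ℝ))) * h x

noncomputable def K {n : ℕ} (p : Fin n → ℕ) (x y : ∀ i, Fin (p i)) : ℝ :=
  ∏ i, (if x i = y i then 0 else 1 / ((p i : ℝ) * ((p i : ℝ) - 1)))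

noncomputable def Q {n : ℕ} (p : Fin n → ℕ) (f g : (∀ i, Fin (p i)) → ℝ) : ℝ :=
  ∑ x, ∑ y, K p x y * (f x * g y)

lemma sum_cons {n : ℕ} (p : Fin (n+1) → ℕ) (F : (∀ i, Fin (p i)) → ℝ) :
    ∑ z, F z = ∑ a : Fin (p 0), ∑ x : (∀ i : Fin n, Fin (p i.succ)),
      F (Fin.cons (α := fun i => Fin (p i)) a x) := by
  rw [← (Fin.consEquiv (fun i => Fin (p i))).sum_comp F, Fintype.sum_prod_type]
  rfl

lemma E_add {n : ℕ} (p : Fin n → ℕ) (f g : (∀ i, Fin (p i)) → ℝ) :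
    E p (fun x => f x + g x) = E p f + E p g := by
  simp only [E, mul_add, sum_add_distrib]

lemma E_sub {n : ℕ} (p : Fin n → ℕ) (f g : (∀ i, Fin (p i)) → ℝ) :
    E p (fun x => f x - g x) = E p f - E p g := by
  simp only [E, mul_sub, sum_sub_distrib]

lemma E_smul {n : ℕ} (p : Fin n → ℕ) (c : ℝ) (f : (∀ i, Fin (p i)) → ℝ) :
    E p (fun x => c * f x) = c * E p f := by
  simp only [E, mul_sum]
  exact sum_congr rfl fun x _ => by ring

lemma E_sum {n : ℕ} (p : Fin n → ℕ) {ι : Type*} (s : Finset ι)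
    (f : ι → (∀ i, Fin (p i)) → ℝ) :
    E p (fun x => ∑ a ∈ s, f a x) = ∑ a ∈ s, E p (f a) := by
  simp only [E, mul_sum]
  exact sum_comm

lemma E_const {n : ℕ} (p : Fin n → ℕ) (hp : ∀ i, 1 ≤ p i) (c : ℝ) :
    E p (fun _ => c) = c := by
  simp only [E, sum_const, card_univ, Fintype.card_pi, Fintype.card_fin, nsmul_eq_mul]
  push_cast
  rw [← mul_assoc, ← prod_mul_distrib, prod_eq_one, one_mul]
  intro i _
  have : (p i : ℝ) ≠ 0 := by have := hp i; positivity
  field_simp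

lemma E_sq_nonneg {n : ℕ} (p : Fin n → ℕ) (f : (∀ i, Fin (p i)) → ℝ) :
    0 ≤ E p (fun x => f x ^ 2) := by
  unfold E; positivity

lemma E_sq_zero {n : ℕ} (p : Fin n → ℕ) (hp : ∀ i, 1 ≤ p i) (f : (∀ i, Fin (p i)) → ℝ)
    (h : E p (fun x => f x ^ 2) = 0) (x) : f x = 0 := by
  unfold E at h
  rw [sum_eq_zero_iff_of_nonneg (fun x _ => by positivity)] at h
  have := h x (mem_univ _)
  have h2 : (0:ℝ) < ∏ i, (1 / (p i : ℝ)) := prod_pos fun i _ => by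
    have := hp i; positivity
  rcases mul_eq_zero.1 this with h | h
  · exact absurd h h2.ne'
  · exact pow_eq_zero_iff (two_ne_zero) |>.1 h

noncomputable def V {n : ℕ} (p : Fin n → ℕ) (h : (∀ i, Fin (p i)) → ℝ) : ℝ :=
  E p (fun x => h x ^ 2) - E p h ^ 2

lemma V_eq {n : ℕ} (p : Fin n → ℕ) (hp : ∀ i, 1 ≤ p i) (f : (∀ i, Fin (p i)) → ℝ) :
    V p f = E p (fun x => (f x - E p f) ^ 2) := by
  have : (fun x => (f x - E p f) ^ 2)
      = fun x => (f x ^ 2 - (2 * E p f) * f x) + E p f ^ 2 := by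
    funext x; ring
  rw [this, E_add, E_sub, E_smul, E_const p hp, V]; ring

lemma V_nonneg {n : ℕ} (p : Fin n → ℕ) (hp : ∀ i, 1 ≤ p i) (f : (∀ i, Fin (p i)) → ℝ) :
    0 ≤ V p f := by
  rw [V_eq p hp]; exact E_sq_nonneg p _

lemma V_zero {n : ℕ} (p : Fin n → ℕ) (hp : ∀ i, 1 ≤ p i) (f : (∀ i, Fin (p i)) → ℝ)
    (h : V p f = 0) (x) : f x = E p f := by
  rw [V_eq p hp] at h
  exact sub_eq_zero.1 (E_sq_zero p hp _ h x)

/-- slice -/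
def sl {n : ℕ} (p : Fin (n+1) → ℕ) (h : (∀ i, Fin (p i)) → ℝ) (a : Fin (p 0)) :
    (∀ i : Fin n, Fin (p i.succ)) → ℝ :=
  fun x => h (Fin.cons (α := fun i => Fin (p i)) a x)

/-- average of slices -/
noncomputable def av {n : ℕ} (p : Fin (n+1) → ℕ) (h : (∀ i, Fin (p i)) → ℝ) :
    (∀ i : Fin n, Fin (p i.succ)) → ℝ :=
  fun x => (1 / (p 0 : ℝ)) * ∑ a, sl p h a x

noncomputable def rs {n : ℕ} (p : Fin (n+1) → ℕ) (h : (∀ i, Fin (p i)) → ℝ) (a : Fin (p 0)) :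
    (∀ i : Fin n, Fin (p i.succ)) → ℝ :=
  fun x => sl p h a x - av p h x

lemma E_succ {n : ℕ} (p : Fin (n+1) → ℕ) (h : (∀ i, Fin (p i)) → ℝ) :
    E p h = (1 / (p 0 : ℝ)) * ∑ a, E (fun i => p i.succ) (sl p h a) := by
  unfold E
  rw [sum_cons, mul_sum]
  refine sum_congr rfl fun a _ => ?_
  rw [mul_sum]
  refine sum_congr rfl fun x _ => ?_
  rw [Fin.prod_univ_succ, sl]; ring

lemma E_av {n : ℕ} (p : Fin (n+1) → ℕ) (h : (∀ i, Fin (p i)) → ℝ) :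
    E p h = E (fun i => p i.succ) (av p h) := by
  rw [E_succ]; unfold av
  rw [E_smul, E_sum]

lemma sum_rs_mul {n : ℕ} (p : Fin (n+1) → ℕ) (hp : 1 ≤ p 0) (h : (∀ i, Fin (p i)) → ℝ) (x y) :
    ∑ a, rs p h a x * rs p h a y
      = ∑ a, sl p h a x * sl p h a y - (p 0 : ℝ) * (av p h x * av p h y) := by
  have hp' : (p 0 : ℝ) ≠ 0 := by positivity
  have h1 : ∀ x, ∑ a, sl p h a x = (p 0 : ℝ) * av p h x := by
    intro x; unfold av; field_simp
  have : ∀ a, rs p h a x * rs p h a y = sl p h a x * sl p h a y - av p h y * sl p h a x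
      - av p h x * sl p h a y + av p h x * av p h y := by intro a; unfold rs; ring
  simp only [this, sum_add_distrib, sum_sub_distrib, ← mul_sum, h1, sum_const, card_univ,
    Fintype.card_fin, nsmul_eq_mul]
  ring

lemma N_succ {n : ℕ} (p : Fin (n+1) → ℕ) (hp : 1 ≤ p 0) (h : (∀ i, Fin (p i)) → ℝ) :
    E p (fun x => h x ^ 2) = E (fun i => p i.succ) (fun x => av p h x ^ 2)
      + (1 / (p 0 : ℝ)) * ∑ a, E (fun i => p i.succ) (fun x => rs p h a x ^ 2) := by
  have hp' : (p 0 : ℝ) ≠ 0 := by positivity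
  rw [E_av, ← E_sum, ← E_smul, ← E_add]
  congr 1
  funext x
  have := sum_rs_mul p hp h x x
  simp only [← pow_two] at this
  rw [this]
  unfold av
  have h2 : ∀ a, sl p (fun x => h x ^ 2) a x = sl p h a x ^ 2 := fun a => rfl
  simp only [h2]
  field_simp
  ring

lemma Q_succ {n : ℕ} (p : Fin (n+1) → ℕ) (hp : 2 ≤ p 0) (h : (∀ i, Fin (p i)) → ℝ) :
    Q p h h = Q (fun i => p i.succ) (av p h) (av p h)
      - (1 / ((p 0 : ℝ) - 1)) *
        ((1 / (p 0 : ℝ)) * ∑ a, Q (fun i => p i.succ) (rs p h a) (rs p h a)) := by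
  have hp2 : (2:ℝ) ≤ p 0 := by exact_mod_cast hp
  have hp' : (p 0 : ℝ) ≠ 0 := by positivity
  have hp'' : (p 0 : ℝ) - 1 ≠ 0 := by linarith
  have e1 : Q p h h = ∑ x, ∑ y, K (fun i => p i.succ) x y *
      ((1 / ((p 0 : ℝ) * ((p 0 : ℝ) - 1))) *
        ∑ a, ∑ b, if a = b then 0 else sl p h a x * sl p h b y) := by
    have lhs : Q p h h = ∑ a, ∑ x, ∑ b, ∑ y,
        K p (Fin.cons (α := fun i => Fin (p i)) a x) (Fin.cons (α := fun i => Fin (p i)) b y)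
          * (sl p h a x * sl p h b y) := by
      unfold Q
      rw [sum_cons]
      refine sum_congr rfl fun a _ => sum_congr rfl fun x _ => ?_
      rw [sum_cons]
      rfl
    rw [lhs, sum_comm]
    refine sum_congr rfl fun x _ => ?_
    simp only [mul_sum]
    symm
    rw [sum_comm]
    refine sum_congr rfl fun a _ => ?_
    rw [sum_comm]
    refine sum_congr rfl fun b _ => sum_congr rfl fun y _ => ?_
    unfold K
    rw [Fin.prod_univ_succ]
    simp only [Fin.cons_zero, Fin.cons_succ]
    split_ifs
    · simp
    · ring
  have e2 : (1 / (p 0 : ℝ)) * ∑ a, Q (fun i => p i.succ) (rs p h a) (rs p h a)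
      = ∑ x, ∑ y, K (fun i => p i.succ) x y *
      ((1 / (p 0 : ℝ)) * ∑ a, rs p h a x * rs p h a y) := by
    unfold Q
    rw [sum_comm, mul_sum]
    refine sum_congr rfl fun x _ => ?_
    rw [sum_comm, mul_sum]
    refine sum_congr rfl fun y _ => ?_
    simp only [mul_sum]
    exact sum_congr rfl fun a _ => by ring
  rw [e1, e2]
  unfold Q
  rw [mul_sum, ← sum_sub_distrib]
  refine sum_congr rfl fun x _ => ?_
  rw [mul_sum, ← sum_sub_distrib]
  refine sum_congr rfl fun y _ => ?_
  rw [sum_rs_mul p (by omega)]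
  have h1 : ∀ x, ∑ a, sl p h a x = (p 0 : ℝ) * av p h x := by
    intro x; unfold av; field_simp
  have h3 : (∑ a, ∑ b, if a = b then 0 else sl p h a x * sl p h b y)
      = (p 0 * av p h x) * (p 0 * av p h y) - ∑ a, sl p h a x * sl p h a y := by
    rw [← h1, ← h1, sum_mul_sum, ← sum_sub_distrib]
    refine sum_congr rfl fun a _ => ?_
    have : ∀ b, (if a = b then 0 else sl p h a x * sl p h b y)
      = sl p h a x * sl p h b y - if a = b then sl p h a x * sl p h b y else 0 := by
      intro b; split_ifs <;> simp
    simp only [this, sum_sub_distrib]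
    simp
  rw [h3]
  field_simp
  ring

lemma num_step (L L0 S1 S2 T q e v : ℝ) (hLpos : 0 < L) (hL0pos : 0 < L0) (hL0le : L0 ≤ L)
    (hLlt : L ≤ 1/2) (hS1n : 0 ≤ S1) (hS2n : 0 ≤ S2) (hT1 : T ≤ S1 + L ^ 2 * S2)
    (hT2 : S1 - L * S2 ≤ T) (u0 : q ≤ e + L ^ 2 * v) (l0 : e - L * v ≤ q) :
    q - L0 * T ≤ e + L ^ 2 * (v + (S1 + S2)) ∧
    e - L * (v + (S1 + S2)) ≤ q - L0 * T ∧
    (q - L0 * T = e - L * (v + (S1 + S2)) → S2 = 0 ∧ (L - L0) * S1 = 0 ∧ q = e - L * v) := by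
  have hLL1 : 0 ≤ (L - L0) * S1 := mul_nonneg (by linarith) hS1n
  have hLL2 : L0 * (L ^ 2 * S2) ≤ L * (L ^ 2 * S2) :=
    mul_le_mul_of_nonneg_right hL0le (by positivity)
  have hLL3 : L0 * (L * S2) ≤ L * (L * S2) := mul_le_mul_of_nonneg_right hL0le (by positivity)
  have hLT1 := mul_le_mul_of_nonneg_left hT1 hL0pos.le
  have hLT2 := mul_le_mul_of_nonneg_left hT2 hL0pos.le
  have hL2 : L * L ≤ 1/4 := by nlinarith
  have hLS3 : L * L * (L * S2) ≤ 1/4 * (L * S2) :=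
    mul_le_mul_of_nonneg_right hL2 (by positivity)
  have p1 : 0 ≤ L0 * S1 := by positivity
  have p2 : 0 ≤ L ^ 2 * S1 := by positivity
  have p3 : 0 ≤ L * S2 := by positivity
  refine ⟨by linarith, by linarith, fun heq => ?_⟩
  have z2 : L * S2 = 0 := by linarith
  have z2' : S2 = 0 := (mul_eq_zero.1 z2).resolve_left hLpos.ne'
  subst z2'
  exact ⟨rfl, by linarith, by linarith⟩

theorem main_ineq (k : ℕ) (hk : 3 ≤ k) : ∀ {n : ℕ} (p : Fin n → ℕ) (_ : ∀ i, k ≤ p i)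
    (h : (∀ i, Fin (p i)) → ℝ),
    Q p h h ≤ E p h ^ 2 + (1 / ((k:ℝ) - 1)) ^ 2 * V p h ∧
    E p h ^ 2 - (1 / ((k:ℝ) - 1)) * V p h ≤ Q p h h ∧
    (Q p h h = E p h ^ 2 - (1 / ((k:ℝ) - 1)) * V p h →
      ∃ (c : ℝ) (f : ∀ i, Fin (p i) → ℝ), (∀ i, p i ≠ k → ∀ a, f i a = 0) ∧
        ∀ x, h x = c + ∑ i, f i (x i)) := by
  have hkR : (3:ℝ) ≤ k := by exact_mod_cast hk
  intro n
  induction n with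
  | zero =>
    intro p hp h
    have hV : V p h = 0 := by
      simp [V, E]
    have hQ : Q p h h = E p h ^ 2 := by
      simp [Q, E, K]; ring
    refine ⟨by rw [hV, hQ]; simp, by rw [hV, hQ]; simp, fun _ => ⟨E p h, fun i => i.elim0, fun i => i.elim0, fun x => ?_⟩⟩
    simpa using V_zero p (fun i => i.elim0) h hV x
  | succ n ih =>
    intro p hp h
    set q : Fin n → ℕ := fun i => p i.succ with hq
    have hpq : ∀ i, k ≤ q i := fun i => hp _
    have hq1 : ∀ i, 1 ≤ q i := fun i => by have := hpq i; omega
    have hp0 := hp 0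
    have hp0R : (k:ℝ) ≤ p 0 := by exact_mod_cast hp0
    obtain ⟨u0, l0, s0⟩ := ih q hpq (av p h)
    set L : ℝ := 1 / ((k:ℝ) - 1) with hL
    set L0 : ℝ := 1 / ((p 0:ℝ) - 1) with hL0
    have hLpos : 0 < L := by rw [hL]; apply one_div_pos.2; linarith
    have hL0pos : 0 < L0 := by rw [hL0]; apply one_div_pos.2; linarith
    have hL0le : L0 ≤ L := by
      rw [hL, hL0]; apply one_div_le_one_div_of_le <;> linarith
    have hLlt : L ≤ 1/2 := by
      rw [hL]; apply one_div_le_one_div_of_le <;> linarith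
    have hpp : (0:ℝ) < 1 / (p 0 : ℝ) := by apply one_div_pos.2; linarith
    set S1 : ℝ := (1 / (p 0 : ℝ)) * ∑ a, E q (rs p h a) ^ 2 with hS1
    set S2 : ℝ := (1 / (p 0 : ℝ)) * ∑ a, V q (rs p h a) with hS2
    set T : ℝ := (1 / (p 0 : ℝ)) * ∑ a, Q q (rs p h a) (rs p h a) with hT
    have hS1n : 0 ≤ S1 := by rw [hS1]; positivity
    have hS2n : 0 ≤ S2 := by
      rw [hS2]; exact mul_nonneg hpp.le (sum_nonneg fun a _ => V_nonneg q hq1 _)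
    have hT1 : T ≤ S1 + L ^ 2 * S2 := by
      have : S1 + L ^ 2 * S2 = (1 / (p 0 : ℝ)) * ∑ a, (E q (rs p h a) ^ 2 + L ^ 2 * V q (rs p h a)) := by
        rw [sum_add_distrib, ← mul_sum, hS1, hS2]; ring
      rw [this, hT]
      exact mul_le_mul_of_nonneg_left (sum_le_sum fun a _ => (ih q hpq _).1) hpp.le
    have hT2 : S1 - L * S2 ≤ T := by
      have : S1 - L * S2 = (1 / (p 0 : ℝ)) * ∑ a, (E q (rs p h a) ^ 2 - L * V q (rs p h a)) := by
        rw [sum_sub_distrib, ← mul_sum, hS1, hS2]; ring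
      rw [this, hT]
      exact mul_le_mul_of_nonneg_left (sum_le_sum fun a _ => (ih q hpq _).2.1) hpp.le
    have hQ : Q p h h = Q q (av p h) (av p h) - L0 * T := Q_succ p (by omega) h
    have hE : E p h = E q (av p h) := E_av p h
    have hVs : V p h = V q (av p h) + (S1 + S2) := by
      unfold V
      rw [N_succ p (by omega), ← hE, hS1, hS2]
      simp only [V, sum_sub_distrib]
      ring
    have hv0 := V_nonneg q hq1 (av p h)
    rw [hQ, hE, hVs]
    obtain ⟨n1, n2, n3⟩ := num_step L L0 S1 S2 T (Q q (av p h) (av p h)) (E q (av p h) ^ 2)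
      (V q (av p h)) hLpos hL0pos hL0le hLlt hS1n hS2n hT1 hT2 u0 l0
    refine ⟨n1, n2, ?_⟩
    · intro heq
      obtain ⟨z2', z1, z0⟩ := n3 heq
      obtain ⟨c, f, hf, hx⟩ := s0 z0
      have hVz : ∀ a, V q (rs p h a) = 0 := by
        have : ∑ a, V q (rs p h a) = 0 := by
          rcases mul_eq_zero.1 (hS2.symm.trans z2') with h | h
          · exact absurd h hpp.ne'
          · exact h
        intro a
        exact (sum_eq_zero_iff_of_nonneg (fun a _ => V_nonneg q hq1 _)).1 this a (mem_univ _)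
      refine ⟨c, Fin.cons (α := fun i => Fin (p i) → ℝ) (fun a => E q (rs p h a)) f, ?_, ?_⟩
      · intro i
        refine Fin.cases ?_ (fun i => ?_) i
        · intro hne a
          have hlt : (k:ℝ) < p 0 := by
            have : k < p 0 := by omega
            exact_mod_cast this
          have hLlt : L0 < L := by
            rw [hL, hL0]; apply one_div_lt_one_div_of_lt <;> linarith
          have hS1z : S1 = 0 := by
            rcases mul_eq_zero.1 z1 with h | h
            · linarith
            · exact h
          have : ∑ a, E q (rs p h a) ^ 2 = 0 := by
            rcases mul_eq_zero.1 (hS1.symm.trans hS1z) with h | h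
            · exact absurd h hpp.ne'
            · exact h
          have := (sum_eq_zero_iff_of_nonneg (fun a _ => sq_nonneg _)).1 this a (mem_univ _)
          simpa using this
        · intro hne a
          simpa using hf i hne a
      · intro z
        have h1 := V_zero q hq1 _ (hVz (z 0)) (Fin.tail z)
        have h2 := hx (Fin.tail z)
        rw [Fin.sum_univ_succ]
        simp only [Fin.cons_zero, Fin.cons_succ]
        rw [← h1]
        have h3 : sl p h (z 0) (Fin.tail z) = h z := by
          unfold sl; rw [Fin.cons_self_tail]
        have h4 : ∑ i : Fin n, f i (z i.succ) = ∑ i : Fin n, f i (Fin.tail z i) := rfl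
        rw [h4]
        unfold rs
        rw [h3]; linarith


/-- indicator -/
noncomputable def ind {n : ℕ} {p : Fin n → ℕ} (A : Finset (∀ i, Fin (p i))) :
    (∀ i, Fin (p i)) → ℝ := fun x => if x ∈ A then 1 else 0

lemma E_ind {n : ℕ} {p : Fin n → ℕ} (hp : ∀ i, 1 ≤ p i) (A : Finset (∀ i, Fin (p i))) :
    E p (ind A) = A.card / ((∏ i, p i : ℕ) : ℝ) := by
  simp [E, ind, ← mul_sum, div_eq_mul_inv, mul_comm]

lemma Q_add {n : ℕ} (p : Fin n → ℕ) (f g : (∀ i, Fin (p i)) → ℝ) :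
    Q p (fun x => f x + g x) (fun x => f x + g x) - Q p (fun x => f x - g x) (fun x => f x - g x)
      = 2 * (Q p f g + Q p g f) := by
  unfold Q
  rw [← sum_sub_distrib, ← sum_add_distrib, mul_sum]
  refine sum_congr rfl fun x _ => ?_
  rw [← sum_sub_distrib, ← sum_add_distrib, mul_sum]
  exact sum_congr rfl fun y _ => by ring

lemma Q_ind {n : ℕ} {p : Fin n → ℕ} (A B : Finset (∀ i, Fin (p i)))
    (h : ∀ x ∈ A, ∀ y ∈ B, ∃ i, x i = y i) (s t : ℝ) :
    Q p (fun x => s * ind A x) (fun x => t * ind B x) = 0 := by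
  unfold Q
  refine sum_eq_zero fun x _ => sum_eq_zero fun y _ => ?_
  by_cases hx : x ∈ A
  · by_cases hy : y ∈ B
    · obtain ⟨i, hi⟩ := h x hx y hy
      have : K p x y = 0 := prod_eq_zero (mem_univ i) (by simp [hi])
      rw [this, zero_mul]
    · simp [ind, hy]
  · simp [ind, hx]

lemma num_final (k a b s t vh vd : ℝ) (hk : 3 ≤ k) (ha : 0 < a) (hb : 0 < b)
    (hs : 0 < s) (ht : 0 < t) (hs2 : s ^ 2 = b) (ht2 : t ^ 2 = a) (hab : k * (s * t) = 1)
    (hsum : vh + vd = 2 * (s ^ 2 * a - (s * a) ^ 2) + 2 * (t ^ 2 * b - (t * b) ^ 2))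
    (hvd : 0 ≤ vd) (qh qd : ℝ) (hq : qh = qd)
    (l : (s * a + t * b) ^ 2 - (1 / (k - 1)) * vh ≤ qh)
    (u : qd ≤ (s * a - t * b) ^ 2 + (1 / (k - 1)) ^ 2 * vd) :
    s = t ∧ vd = 0 ∧ qh = (s * a + t * b) ^ 2 - (1 / (k - 1)) * vh := by
  have hkpos : 0 < k - 1 := by linarith
  obtain ⟨L, hL⟩ : ∃ L, L = 1 / (k - 1) := ⟨_, rfl⟩
  have hLk : L * (k - 1) = 1 := by rw [hL]; field_simp
  have hLpos : 0 < L := by rw [hL]; positivity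
  rw [← hL] at l u ⊢
  have hLle : L ≤ 1/2 := by
    rw [hL]; apply one_div_le_one_div_of_le <;> linarith
  subst hs2 ht2
  obtain ⟨m, hm⟩ : ∃ m, m = s * t := ⟨_, rfl⟩
  have hmpos : 0 < m := by rw [hm]; positivity
  have hLm : L * (1 - m) = m := by
    have : k * m = 1 := by rw [hm]; exact hab
    have h2 : (k - 1) * m = 1 - m := by linarith
    rw [← h2, ← mul_assoc, hLk, one_mul]
  have e1 : vh + vd = 4 * m ^ 2 * (1 - m) - 2 * m ^ 2 * (s - t) ^ 2 := by
    rw [hsum, hm]; ring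
  have e2 : (s * t ^ 2 + t * s ^ 2) ^ 2 = (s * t ^ 2 - t * s ^ 2) ^ 2 + 4 * m ^ 2 * m := by
    rw [hm]; ring
  have e3 : L * (vh + vd) = 4 * m ^ 2 * m - L * (2 * m ^ 2 * (s - t) ^ 2) := by
    rw [e1]
    linear_combination (4 * m ^ 2) * hLm
  have p1 : 0 ≤ L * (2 * m ^ 2 * (s - t) ^ 2) := by positivity
  have p2 : L * L * vd ≤ L * (1/2) * vd := by
    apply mul_le_mul_of_nonneg_right _ hvd
    exact mul_le_mul_of_nonneg_left hLle hLpos.le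
  have p3 : 0 ≤ L * vd := by positivity
  have z1 : L * vd = 0 := by nlinarith
  have z2 : L * (2 * m ^ 2 * (s - t) ^ 2) = 0 := by nlinarith
  have z3 : vd = 0 := (mul_eq_zero.1 z1).resolve_left hLpos.ne'
  have z4 : (s - t) ^ 2 = 0 :=
    (mul_eq_zero.1 ((mul_eq_zero.1 z2).resolve_left hLpos.ne')).resolve_left (by positivity)
  subst z3
  have z5 : s = t := sub_eq_zero.1 (pow_eq_zero_iff two_ne_zero |>.1 z4)
  refine ⟨z5, rfl, ?_⟩
  apply le_antisymm _ l
  nlinarith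

lemma card_dict {n : ℕ} (p : Fin n → ℕ) (i : Fin n) (j : Fin (p i)) :
    p i * (univ.filter (fun x : (∀ i, Fin (p i)) => x i = j)).card = ∏ i, p i := by
  classical
  have : (univ.filter (fun x : (∀ i, Fin (p i)) => x i = j))
      = Fintype.piFinset (Function.update (fun i => (univ : Finset (Fin (p i)))) i {j}) := by
    ext x
    simp only [mem_filter, mem_univ, true_and, Fintype.mem_piFinset]
    constructor
    · intro h l
      by_cases hl : l = i
      · subst hl; simp [h]
      · simp [hl]
    · intro h
      simpa using h i
  rw [this, Fintype.card_piFinset, ← mul_prod_erase univ _ (mem_univ i),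
    ← mul_prod_erase univ p (mem_univ i)]
  simp only [Function.update_self, card_singleton, one_mul]
  congr 1
  refine prod_congr rfl fun l hl => ?_
  rw [Function.update_of_ne (ne_of_mem_erase hl)]
  simp

/-- an affine Boolean function is a dictator -/
lemma dict {n : ℕ} (p : Fin n → ℕ) (k : ℕ) (A : Finset (∀ i, Fin (p i))) (c : ℝ)
    (f : ∀ i, Fin (p i) → ℝ) (hf : ∀ i, p i ≠ k → ∀ a, f i a = 0)
    (h : ∀ x, ind A x = c + ∑ i, f i (x i)) (x y : ∀ i, Fin (p i)) (hx : x ∈ A) (hy : y ∉ A) :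
    ∃ i, p i = k ∧ ∃ j, ∀ z, z i = j → z ∈ A := by
  classical
  have hne : ∃ i, f i (x i) ≠ f i (y i) := by
    by_contra! hcon
    have h1 := h x
    have h2 := h y
    rw [sum_congr rfl fun i _ => hcon i, ← h2] at h1
    simp [ind, hx, hy] at h1
  obtain ⟨i, hi⟩ := hne
  have upd : ∀ (z : ∀ i, Fin (p i)) (l : Fin n) (a : Fin (p l)),
      ind A (Function.update z l a) = ind A z + (f l a - f l (z l)) := by
    intro z l a
    rw [h, h, ← add_sum_erase univ _ (mem_univ l),
      ← add_sum_erase univ (fun i => f i (z i)) (mem_univ l)]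
    have : ∑ m ∈ univ.erase l, f m (Function.update z l a m) = ∑ m ∈ univ.erase l, f m (z m) := by
      refine sum_congr rfl fun m hm => ?_
      rw [Function.update_of_ne (ne_of_mem_erase hm)]
    rw [this, Function.update_self]; ring
  have hcst : ∀ l, l ≠ i → ∀ b b', f l b = f l b' := by
    intro l hl b b'
    by_contra hb
    have b01 : ∀ z, ind A z = 0 ∨ ind A z = 1 := by
      intro z; unfold ind; split_ifs <;> simp
    have u0 := b01 (Function.update x l b)
    have u1 := b01 (Function.update x l b')
    have u2 := b01 (Function.update (Function.update x l b) i (y i))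
    have u3 := b01 (Function.update (Function.update x l b') i (y i))
    rw [upd] at u0 u1
    rw [upd, upd, Function.update_of_ne hl.symm] at u2 u3
    have d1 : f i (y i) - f i (x i) ≠ 0 := fun h => hi (by linarith)
    have d2 : f l b - f l b' ≠ 0 := fun h => hb (by linarith)
    rcases u0 with u0 | u0 <;> rcases u1 with u1 | u1 <;> rcases u2 with u2 | u2 <;>
      rcases u3 with u3 | u3 <;>
      first
      | (exact d1 (by linarith))
      | (exact d2 (by linarith))
  refine ⟨i, ?_, x i, ?_⟩
  · by_contra hpk
    exact hi (by rw [hf i hpk, hf i hpk])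
  · intro z hz
    have h1 : ind A z = ind A x := by
      rw [h, h]
      congr 1
      refine sum_congr rfl fun l _ => ?_
      by_cases hl : l = i
      · subst hl; rw [hz]
      · exact hcst l hl _ _
    by_contra hzA
    simp [ind, hx, hzA] at h1

end CrossAux

/-- Let `k = min_i p_i` with `k ≠ 2` and let `A, B ⊆ S_p` be cross-intersecting.
Then `|A|·|B| = |S_p|²/k²` (equivalently `k²·|A|·|B| = |S_p|²`) holds iff
`A = B = {x ∈ S_p : x_i = j}` for some coordinate `i` with `p i = k` and some
value `j ∈ [p i]`. -/
theorem crossIntersecting_eq_iff {n : ℕ} (p : Fin n → ℕ)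
    (hp : ∀ i, 1 ≤ p i) (k : ℕ) (hk : ∃ i, p i = k) (hk' : ∀ i, k ≤ p i)
    (hk2 : k ≠ 2)
    (A B : Finset (∀ i, Fin (p i))) (hAB : CrossInt 1 A B) :
    k ^ 2 * (A.card * B.card) = (∏ i, p i) ^ 2 ↔
      ∃ i : Fin n, p i = k ∧ ∃ j : Fin (p i),
        A = univ.filter (fun x => x i = j) ∧ B = A := by
  classical
  open CrossAux in
  constructor
  swap
  · rintro ⟨i, rfl, j, hA, rfl⟩
    have := card_dict p i j
    rw [← hA] at this
    rw [← this]; ring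
  intro heq
  obtain ⟨i0, hi0⟩ := hk
  have hk1 : 1 ≤ k := hi0 ▸ hp i0
  have hN : 0 < ∏ i, p i := prod_pos fun i _ => hp i
  have hcard : Fintype.card (∀ i, Fin (p i)) = ∏ i, p i := by simp
  have hAle : A.card ≤ ∏ i, p i := hcard ▸ card_le_univ A
  have hBle : B.card ≤ ∏ i, p i := hcard ▸ card_le_univ B
  by_cases hk3 : k = 1
  · subst hk3
    have hA : A.card = ∏ i, p i := by nlinarith
    have hB : B.card = ∏ i, p i := by nlinarith
    have hA' : A = univ := (card_eq_iff_eq_univ A).1 (hA.trans hcard.symm)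
    have hB' : B = univ := (card_eq_iff_eq_univ B).1 (hB.trans hcard.symm)
    refine ⟨i0, hi0, ⟨0, hp i0⟩, ?_, by rw [hA', hB']⟩
    rw [hA']
    ext x
    simp only [mem_univ, mem_filter, true_and, true_iff]
    ext
    have := (x i0).2
    simp only
    omega
  have hk3 : 3 ≤ k := by omega
  have hkR : (3:ℝ) ≤ k := by exact_mod_cast hk3
  have hInter : ∀ x ∈ A, ∀ y ∈ B, ∃ i, x i = y i := by
    intro x hx y hy
    obtain ⟨i, hi⟩ := card_pos.1 (hAB x hx y hy)
    exact ⟨i, by simpa using hi⟩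
  have hABpos : 0 < A.card * B.card := by
    rcases Nat.eq_zero_or_pos (A.card * B.card) with h | h
    · rw [h] at heq; have : 0 < (∏ i, p i) ^ 2 := by positivity
      omega
    · exact h
  have hApos : 0 < A.card := Nat.pos_of_mul_pos_right hABpos
  have hBpos : 0 < B.card := Nat.pos_of_mul_pos_left hABpos
  obtain ⟨N, hNN⟩ : ∃ N : ℝ, N = ((∏ i, p i : ℕ) : ℝ) := ⟨_, rfl⟩
  have hNpos : 0 < N := by rw [hNN]; exact_mod_cast hN
  have heqR : (k:ℝ) ^ 2 * (A.card * B.card) = N ^ 2 := by rw [hNN]; exact_mod_cast heq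
  obtain ⟨a, ha⟩ : ∃ a : ℝ, a = A.card / N := ⟨_, rfl⟩
  obtain ⟨b, hb⟩ : ∃ b : ℝ, b = B.card / N := ⟨_, rfl⟩
  have hapos : 0 < a := by rw [ha]; positivity
  have hbpos : 0 < b := by rw [hb]; positivity
  have hEA : E p (ind A) = a := by rw [E_ind hp, ha, hNN]
  have hEB : E p (ind B) = b := by rw [E_ind hp, hb, hNN]
  have hab : (k:ℝ) ^ 2 * (a * b) = 1 := by
    rw [ha, hb]; field_simp; linarith
  obtain ⟨s, hs⟩ : ∃ s : ℝ, s = √b := ⟨_, rfl⟩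
  obtain ⟨t, ht⟩ : ∃ t : ℝ, t = √a := ⟨_, rfl⟩
  have hspos : 0 < s := by rw [hs]; positivity
  have htpos : 0 < t := by rw [ht]; positivity
  have hs2 : s ^ 2 = b := by rw [hs]; exact Real.sq_sqrt hbpos.le
  have ht2 : t ^ 2 = a := by rw [ht]; exact Real.sq_sqrt hapos.le
  have hst : (k:ℝ) * (s * t) = 1 := by
    have h1 : ((k:ℝ) * (s * t)) ^ 2 = 1 := by rw [← hab, ← hs2, ← ht2]; ring
    have h2 : 0 ≤ (k:ℝ) * (s * t) := by positivity
    exact (pow_eq_one_iff_of_nonneg h2 two_ne_zero).1 h1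
  set F : (∀ i, Fin (p i)) → ℝ := fun x => s * ind A x with hF
  set G : (∀ i, Fin (p i)) → ℝ := fun x => t * ind B x with hG
  have hEF : E p F = s * a := by rw [hF, E_smul, hEA]
  have hEG : E p G = t * b := by rw [hG, E_smul, hEB]
  have hsqi : ∀ (C : Finset (∀ i, Fin (p i))) x, ind C x ^ 2 = ind C x := by
    intro C x; unfold ind; split_ifs <;> simp
  have hNF : E p (fun x => F x ^ 2) = s ^ 2 * a := by
    simp only [hF, mul_pow, hsqi]; rw [E_smul, hEA]
  have hNG : E p (fun x => G x ^ 2) = t ^ 2 * b := by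
    simp only [hG, mul_pow, hsqi]; rw [E_smul, hEB]
  have hpar : E p (fun x => (F x + G x) ^ 2) + E p (fun x => (F x - G x) ^ 2)
      = 2 * (s ^ 2 * a) + 2 * (t ^ 2 * b) := by
    rw [← hNF, ← hNG, ← E_smul, ← E_smul, ← E_add, ← E_add]
    congr 1; funext x; ring
  have hEh : E p (fun x => F x + G x) = s * a + t * b := by rw [E_add, hEF, hEG]
  have hEd : E p (fun x => F x - G x) = s * a - t * b := by rw [E_sub, hEF, hEG]
  have hQ := Q_add p F G
  rw [Q_ind A B hInter, Q_ind B A (fun x hx y hy => by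
    obtain ⟨i, hi⟩ := hInter y hy x hx; exact ⟨i, hi.symm⟩)] at hQ
  obtain ⟨-, l, st⟩ := main_ineq k hk3 p hk' (fun x => F x + G x)
  obtain ⟨u, -, -⟩ := main_ineq k hk3 p hk' (fun x => F x - G x)
  rw [hEh] at l st
  rw [hEd] at u
  obtain ⟨hseq, hvd, hqe⟩ := num_final k a b s t (V p (fun x => F x + G x))
    (V p (fun x => F x - G x)) hkR hapos hbpos hspos htpos hs2 ht2 hst
    (by unfold V; rw [hEh, hEd]; linear_combination hpar) (V_nonneg p hp _) _ _
    (by linarith) l u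
  have hab' : a = b := by rw [← hs2, ← ht2, hseq]
  have hFG : ∀ x, F x = G x := by
    intro x
    have := V_zero p hp _ hvd x
    rw [hEd, hseq, hab'] at this
    linarith
  have hBA : B = A := by
    ext x
    have := hFG x
    simp only [hF, hG, hseq] at this
    have := mul_left_cancel₀ htpos.ne' this
    unfold ind at this
    by_cases h1 : x ∈ A <;> by_cases h2 : x ∈ B <;> simp [h1, h2] at this ⊢
  obtain ⟨c, f, hf, hx⟩ := st hqe
  have hcA : k * A.card = ∏ i, p i := by
    rw [hBA] at heq
    have : (k * A.card) ^ 2 = (∏ i, p i) ^ 2 := by rw [← heq]; ring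
    exact Nat.pow_left_injective (by norm_num : 2 ≠ 0) this
  obtain ⟨x, hxA⟩ := card_pos.1 hApos
  have hlt : A.card < (univ : Finset (∀ i, Fin (p i))).card := by
    rw [card_univ, hcard, ← hcA]; nlinarith
  obtain ⟨y, -, hyA⟩ := exists_mem_notMem_of_card_lt_card hlt
  obtain ⟨i, hik, j, hj⟩ := dict p k A (c / (2 * s)) (fun i a => f i a / (2 * s))
    (fun i hi a => by rw [hf i hi a, zero_div]) (fun z => by
      have h1 := hx z
      rw [← hFG z] at h1
      rw [← sum_div, ← add_div, ← h1, hF]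
      field_simp; ring) x y hxA hyA
  refine ⟨i, hik, j, ?_, hBA⟩
  symm
  apply eq_of_subset_of_card_le
  · intro z hz
    exact hj z (by simpa using hz)
  · have := card_dict p i j
    rw [← hcA, ← hik] at this
    exact (Nat.eq_of_mul_eq_mul_left (hp i) this).ge
end

section
/- Let 1 ≤ r < n, let p = (p_1,…,p_n) be a size vector with 3 ≤ p_1 ≤ p_2 ≤ … ≤ p_n satisfying 2/p_{r+1} + Σ_{i=1}^{r} 1/p_i ≤ 1, and let A, B ⊆ S_p be r-cross-intersecting families. Then |A|·|B| ≤ Π_{i=r+1}^{n} p_i². Moreover, if equality holds, then A = B and there exist a set T ⊆ [n] with |T| = r and a vector x_0 ∈ S_p such that A = {x ∈ S_p : x_i = (x_0)_i for all i ∈ T}. -/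
open Finset

lemma aux_unif {q : ℕ} (hq : 3 ≤ q) (K : ℝ) (a b : Fin q → ℝ)
    (h1 : ∀ l m, l ≠ m → a l * b m ≤ K ^ 2)
    (hS : (q : ℝ) ^ 2 * K ^ 2 ≤ (∑ l, a l) * (∑ l, b l))
    (ha : ∀ l, q * a l ≤ ∑ l, a l) (hb : ∀ l, q * b l ≤ ∑ l, b l) :
    ∀ l m, l ≠ m → a l * b m = K ^ 2 := by
  have key : ∀ f : Fin q → ℝ, (∀ l, q * f l ≤ ∑ l, f l) → ∀ l, q * f l = ∑ l, f l := by
    intro f hf l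
    have h : ∑ l, q * f l = ∑ _l : Fin q, ∑ l, f l := by
      rw [← Finset.mul_sum]; simp
    exact (Finset.sum_eq_sum_iff_of_le (fun i _ => hf i)).1 h l (mem_univ _)
  intro l m hlm
  apply le_antisymm (h1 l m hlm)
  have e1 := key a ha l
  have e2 := key b hb m
  have hq' : (0:ℝ) < q := by positivity
  rw [← e1, ← e2] at hS
  have : (q:ℝ)^2 * K^2 ≤ q^2 * (a l * b m) := by linarith
  exact le_of_mul_le_mul_left this (by positivity)

set_option maxHeartbeats 1000000 in
lemma aux_half {q : ℕ} (hq : 3 ≤ q) (K : ℝ) (hK : 0 < K) (a b : Fin q → ℝ)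
    (ha0 : ∀ l, 0 ≤ a l) (hb0 : ∀ l, 0 ≤ b l)
    (h1 : ∀ l m, l ≠ m → a l * b m ≤ K ^ 2)
    (h2 : ∀ l m, l ≠ m → a l * b m = K ^ 2 → a l = b m)
    (hS : (q : ℝ) ^ 2 * K ^ 2 ≤ (∑ l, a l) * (∑ l, b l))
    (l : Fin q) (hmax : ∀ m, b m ≤ b l)
    (hab : b l * (∑ l, a l) ≤ a l * (∑ l, b l)) :
    (∀ l m, l ≠ m → a l * b m = K ^ 2) ∨
      (q * ((∑ l, a l) - a l) < ∑ l, a l ∧ q * ((∑ l, b l) - b l) < ∑ l, b l) := by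
  have hq3 : (3:ℝ) ≤ q := by exact_mod_cast hq
  set α := ∑ l, a l with hα
  set β := ∑ l, b l with hβ
  have hpos : 0 < α * β := lt_of_lt_of_le (by positivity) hS
  have hα0 : 0 ≤ α := Finset.sum_nonneg (fun i _ => ha0 i)
  have hβ0 : 0 ≤ β := Finset.sum_nonneg (fun i _ => hb0 i)
  have hαp : 0 < α := by
    rcases hα0.eq_or_lt with h | h
    · rw [← h] at hpos; simp at hpos
    · exact h
  have hβp : 0 < β := by
    rcases hβ0.eq_or_lt with h | h
    · rw [← h] at hpos; simp at hpos
    · exact h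
  have havg : β ≤ q * b l := by
    have := Finset.sum_le_card_nsmul univ b (b l) (fun m _ => hmax m)
    simpa using this
  have hcard : ((univ.erase l).card : ℝ) = q - 1 := by
    rw [Finset.card_erase_of_mem (mem_univ _)]
    simp
    rw [Nat.cast_sub (by omega)]; simp
  have herA : ∑ m ∈ univ.erase l, a m = α - a l := by
    rw [hα, ← Finset.add_sum_erase univ a (mem_univ l)]; ring
  have herB : ∑ m ∈ univ.erase l, b m = β - b l := by
    rw [hβ, ← Finset.add_sum_erase univ b (mem_univ l)]; ring
  rcases havg.eq_or_lt with hE | hL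
  · left
    have hb : ∀ m, q * b m ≤ β := fun m => by
      rw [hE]; exact mul_le_mul_of_nonneg_left (hmax m) (by positivity)
    have hbe : ∀ m, q * b m = β := by
      intro m
      have h : ∑ l, q * b l = ∑ _l : Fin q, β := by
        rw [← Finset.mul_sum]; simp [hβ]
      exact (Finset.sum_eq_sum_iff_of_le (fun i _ => hb i)).1 h m (mem_univ _)
    refine aux_unif hq K a b h1 hS ?_ hb
    intro m
    have : Nontrivial (Fin q) := Fin.nontrivial_iff_two_le.2 (by omega)
    obtain ⟨m', hm'⟩ := exists_ne m
    have h3 := h1 m m' hm'.symm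
    have h4 := hbe m'
    have h5 : (q * a m) * β ≤ α * β := by
      rw [← h4]
      rw [← h4] at hS
      nlinarith [sq_nonneg (q:ℝ)]
    exact le_of_mul_le_mul_right h5 hβp
  · right
    have hs : a l * (β - b l) ≤ (q - 1) * K ^ 2 := by
      rw [← herB, Finset.mul_sum, ← hcard, ← nsmul_eq_mul]
      exact Finset.sum_le_card_nsmul _ _ _ (fun m hm => h1 l m (Finset.ne_of_mem_erase hm).symm)
    have hbl : b l ≤ β := Finset.single_le_sum (fun i _ => hb0 i) (mem_univ l)
    -- b(β-b) q² ≤ (q-1) β²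
    have hs2 : q ^ 2 * (b l * (β - b l)) ≤ (q - 1) * β ^ 2 := by
      have e1 : b l * α * (β - b l) ≤ a l * β * (β - b l) :=
        mul_le_mul_of_nonneg_right hab (by linarith)
      have e2 : q ^ 2 * (a l * (β - b l)) ≤ (q - 1) * (α * β) := by
        calc q ^ 2 * (a l * (β - b l)) ≤ q ^ 2 * ((q - 1) * K ^ 2) :=
              mul_le_mul_of_nonneg_left hs (by positivity)
          _ = (q - 1) * (q ^ 2 * K ^ 2) := by ring
          _ ≤ _ := mul_le_mul_of_nonneg_left hS (by linarith)
      have e3 : α * (q ^ 2 * (b l * (β - b l))) ≤ α * ((q - 1) * β ^ 2) := by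
        calc α * (q ^ 2 * (b l * (β - b l))) = q ^ 2 * (b l * α * (β - b l)) := by ring
          _ ≤ q ^ 2 * (a l * β * (β - b l)) := mul_le_mul_of_nonneg_left e1 (by positivity)
          _ = β * (q ^ 2 * (a l * (β - b l))) := by ring
          _ ≤ β * ((q - 1) * (α * β)) := mul_le_mul_of_nonneg_left e2 hβ0
          _ = _ := by ring
      exact le_of_mul_le_mul_left e3 hαp
    have hprod : 0 ≤ (q * b l - β) * (q * b l - (q - 1) * β) := by nlinarith
    have hge : 0 ≤ q * b l - (q - 1) * β := nonneg_of_mul_nonneg_right hprod (by linarith)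
    have hstr : (q - 1) * β < q * b l := by
      rcases hge.eq_or_lt with h | h
      swap
      · linarith
      exfalso
      have hage : (q - 1) * α ≤ q * a l := by
        have : β * ((q - 1) * α) ≤ β * (q * a l) := by
          calc β * ((q - 1) * α) = α * ((q-1) * β) := by ring
            _ = q * (b l * α) := by rw [show (q-1) * β = q * b l by linarith]; ring
            _ ≤ q * (a l * β) := mul_le_mul_of_nonneg_left hab (by positivity)
            _ = _ := by ring
        exact le_of_mul_le_mul_left this hβp
      have hβb : q * (β - b l) = β := by linarith
      have heq : a l * (β - b l) = (q - 1) * K ^ 2 := by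
        apply le_antisymm hs
        have : (q:ℝ)^2 * ((q - 1) * K ^ 2) ≤ q^2 * (a l * (β - b l)) := by
          calc (q:ℝ)^2 * ((q - 1) * K ^ 2) = (q - 1) * (q ^ 2 * K ^ 2) := by ring
            _ ≤ (q - 1) * (α * β) := mul_le_mul_of_nonneg_left hS (by linarith)
            _ = ((q - 1) * α) * β := by ring
            _ ≤ (q * a l) * β := mul_le_mul_of_nonneg_right hage hβ0
            _ = (q * a l) * (q * (β - b l)) := by rw [hβb]
            _ = _ := by ring
        exact le_of_mul_le_mul_left this (by positivity)
      have hall : ∀ m ∈ univ.erase l, a l * b m = K ^ 2 := by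
        refine (Finset.sum_eq_sum_iff_of_le
          (fun m hm => h1 l m (Finset.ne_of_mem_erase hm).symm)).1 ?_
        rw [← Finset.mul_sum, herB, heq, Finset.sum_const, nsmul_eq_mul, hcard]
      have halK : ∀ m ∈ univ.erase l, a l = K ∧ b m = K := by
        intro m hm
        have e := h2 l m (Finset.ne_of_mem_erase hm).symm (hall m hm)
        have e' := hall m hm
        rw [← e] at e'
        have : a l = K := by nlinarith [ha0 l]
        exact ⟨this, by rw [← e, this]⟩
      have hne : (univ.erase l).Nonempty := by
        rw [← Finset.card_pos]
        have : (0:ℝ) < ((univ.erase l).card : ℝ) := by rw [hcard]; linarith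
        exact_mod_cast this
      obtain ⟨m0, hm0⟩ := hne
      have haK := (halK m0 hm0).1
      have hβK : β - b l = (q - 1) * K := by
        rw [← herB, Finset.sum_congr rfl (fun m hm => (halK m hm).2), Finset.sum_const,
          nsmul_eq_mul, hcard]
      have hb2 : b l = (q - 1) ^ 2 * K := by nlinarith
      have hbK : K < b l := by rw [hb2]; nlinarith
      have hlt : ∀ m ∈ univ.erase l, a m * b l < K ^ 2 := by
        intro m hm
        have hml := Finset.ne_of_mem_erase hm
        refine lt_of_le_of_ne (h1 m l hml) (fun h => ?_)
        have e := h2 m l hml h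
        rw [e] at h
        nlinarith
      have hlt2 : (α - a l) * b l < (q - 1) * K ^ 2 := by
        rw [← herA, Finset.sum_mul, ← hcard, ← nsmul_eq_mul, ← Finset.sum_const]
        exact Finset.sum_lt_sum_of_nonempty ⟨m0, hm0⟩ hlt
      rw [haK, hb2] at hlt2
      have h6 : (α - K) * (q - 1) < K := by
        have : ((q - 1) * K) * ((α - K) * (q - 1)) < ((q-1) * K) * K := by
          calc _ = (α - K) * ((q - 1) ^ 2 * K) := by ring
            _ < _ := hlt2
            _ = _ := by ring
        exact lt_of_mul_lt_mul_left this (mul_nonneg (by linarith) hK.le)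
      have hβ2 : β = q * (q - 1) * K := by rw [← hβb, hβK]; ring
      rw [hβ2] at hS
      have h7 : (q * K) * (q * K) ≤ (q * K) * (α * (q - 1)) := by
        calc (q * K) * (q * K) = q ^ 2 * K ^ 2 := by ring
          _ ≤ _ := hS
          _ = _ := by ring
      have h8 := le_of_mul_le_mul_left h7 (by positivity)
      linarith
    refine ⟨?_, by linarith⟩
    have : β * ((q - 1) * α) < β * (q * a l) := by
      calc β * ((q - 1) * α) = α * ((q-1) * β) := by ring
        _ < α * (q * b l) := mul_lt_mul_of_pos_left hstr hαp
        _ = q * (b l * α) := by ring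
        _ ≤ q * (a l * β) := mul_le_mul_of_nonneg_left hab (by positivity)
        _ = _ := by ring
    have := lt_of_mul_lt_mul_left this hβ0
    linarith

lemma aux_count {q : ℕ} (hq : 3 ≤ q) (K : ℝ) (hK : 0 < K) (a b : Fin q → ℝ)
    (ha0 : ∀ l, 0 ≤ a l) (hb0 : ∀ l, 0 ≤ b l)
    (h1 : ∀ l m, l ≠ m → a l * b m ≤ K ^ 2)
    (h2 : ∀ l m, l ≠ m → a l * b m = K ^ 2 → a l = b m)
    (hS : (q : ℝ) ^ 2 * K ^ 2 ≤ (∑ l, a l) * (∑ l, b l)) :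
    (∀ l m, l ≠ m → a l * b m = K ^ 2) ∨
      ∃ l, (q * ((∑ l, a l) - a l) < ∑ l, a l ∧ q * ((∑ l, b l) - b l) < ∑ l, b l) := by
  have : Nonempty (Fin q) := ⟨⟨0, by omega⟩⟩
  have hq3 : (3:ℝ) ≤ q := by exact_mod_cast hq
  obtain ⟨l, -, hl⟩ := Finset.exists_max_image univ a univ_nonempty
  obtain ⟨m, -, hm⟩ := Finset.exists_max_image univ b univ_nonempty
  have hl' : ∀ j, a j ≤ a l := fun j => hl j (mem_univ _)
  have hm' : ∀ j, b j ≤ b m := fun j => hm j (mem_univ _)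
  by_cases hlm : l = m
  · subst hlm
    rcases le_total (b l * (∑ l, a l)) (a l * (∑ l, b l)) with h | h
    · rcases aux_half hq K hK a b ha0 hb0 h1 h2 hS l hm' h with h | h
      · exact Or.inl h
      · exact Or.inr ⟨l, h⟩
    · rcases aux_half hq K hK b a hb0 ha0 (fun i j hij => by rw [mul_comm]; exact h1 j i hij.symm)
        (fun i j hij e => (h2 j i hij.symm (by rw [mul_comm]; exact e)).symm)
        (by rw [mul_comm (∑ l, b l)]; exact hS) l hl' h with h | h
      · exact Or.inl (fun i j hij => by rw [mul_comm]; exact h j i hij.symm)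
      · exact Or.inr ⟨l, h.2, h.1⟩
  · left
    have ha : ∑ l, a l ≤ q * a l := by
      have := Finset.sum_le_card_nsmul univ a (a l) (fun m _ => hl' m)
      simpa using this
    have hb : ∑ l, b l ≤ q * b m := by
      have := Finset.sum_le_card_nsmul univ b (b m) (fun i _ => hm' i)
      simpa using this
    have h3 := h1 l m hlm
    have hα0 : 0 ≤ ∑ l, a l := Finset.sum_nonneg (fun i _ => ha0 i)
    have hβ0 : 0 ≤ ∑ l, b l := Finset.sum_nonneg (fun i _ => hb0 i)
    have hpos : 0 < (∑ l, a l) * (∑ l, b l) := lt_of_lt_of_le (by positivity) hS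
    have hαp : 0 < ∑ l, a l := by
      rcases hα0.eq_or_lt with h | h
      · rw [← h] at hpos; simp at hpos
      · exact h
    have hβp : 0 < ∑ l, b l := by
      rcases hβ0.eq_or_lt with h | h
      · rw [← h] at hpos; simp at hpos
      · exact h
    have h4 : (q * a l) * (q * b m) ≤ (∑ l, a l) * (∑ l, b l) := by
      calc (q * a l) * (q * b m) = q ^ 2 * (a l * b m) := by ring
        _ ≤ q ^ 2 * K ^ 2 := mul_le_mul_of_nonneg_left h3 (by positivity)
        _ ≤ _ := hS
    have h5 : q * a l ≤ ∑ l, a l := by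
      refine le_of_mul_le_mul_right (le_trans ?_ h4) hβp
      exact mul_le_mul_of_nonneg_left hb (mul_nonneg (by positivity) (ha0 l))
    have h6 : q * b m ≤ ∑ l, b l := by
      refine le_of_mul_le_mul_left (le_trans ?_ h4) hαp
      exact mul_le_mul_of_nonneg_right ha (mul_nonneg (by positivity) (hb0 m))
    refine aux_unif hq K a b h1 hS (fun j => ?_) (fun j => ?_)
    · exact (mul_le_mul_of_nonneg_left (hl' j) (by positivity)).trans h5
    · exact (mul_le_mul_of_nonneg_left (hm' j) (by positivity)).trans h6

/-- The conclusion of the theorem for a given size vector. -/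
def GoodVec {n : ℕ} (r : ℕ) (p : Fin n → ℕ) : Prop :=
  ∀ A B : Finset (∀ i, Fin (p i)), CrossInt r A B →
    A.card * B.card ≤ (∏ i ∈ univ.filter (fun i : Fin n => r ≤ (i : ℕ)), p i) ^ 2 ∧
    (A.card * B.card = (∏ i ∈ univ.filter (fun i : Fin n => r ≤ (i : ℕ)), p i) ^ 2 →
      A = B ∧ ∃ (T : Finset (Fin n)) (x₀ : ∀ i, Fin (p i)),
        T.card = r ∧ A = univ.filter (fun x => ∀ i ∈ T, x i = x₀ i))

/-- Section of a family at a coordinate. -/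
def sect {n : ℕ} {p : Fin (n + 1) → ℕ} (A : Finset (∀ i, Fin (p i))) (i : Fin (n + 1))
    (l : Fin (p i)) : Finset (∀ j, Fin (p (i.succAbove j))) :=
  univ.filter (fun z => i.insertNth (α := fun i => Fin (p i)) l z ∈ A)

lemma card_sect {n : ℕ} {p : Fin (n + 1) → ℕ} (A : Finset (∀ i, Fin (p i))) (i : Fin (n + 1))
    (l : Fin (p i)) : (sect A i l).card = (A.filter (fun x => x i = l)).card := by
  apply Finset.card_bij (fun z _ => i.insertNth (α := fun i => Fin (p i)) l z)
  · intro z hz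
    simp only [sect, mem_filter, mem_univ, true_and] at hz
    simp [hz]
  · intro z _ z' _ h
    exact (Fin.insertNth_right_injective (α := fun i => Fin (p i)) l) h
  · intro x hx
    rw [mem_filter] at hx
    refine ⟨i.removeNth x, ?_, ?_⟩
    · simp only [sect, mem_filter, mem_univ, true_and]
      rw [← hx.2, Fin.insertNth_self_removeNth]; exact hx.1
    · rw [← hx.2, Fin.insertNth_self_removeNth]

lemma sum_card_sect {n : ℕ} {p : Fin (n + 1) → ℕ} (A : Finset (∀ i, Fin (p i)))
    (i : Fin (n + 1)) : ∑ l, (sect A i l).card = A.card := by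
  simp_rw [card_sect]
  exact (Finset.card_eq_sum_card_fiberwise (s := A) (f := fun x : (∀ i, Fin (p i)) => x i) (t := univ) (by simp)).symm

lemma cross_sect {n : ℕ} {p : Fin (n + 1) → ℕ} {r : ℕ} {A B : Finset (∀ i, Fin (p i))}
    (h : CrossInt r A B) (i : Fin (n + 1)) (l m : Fin (p i)) (hlm : l ≠ m) :
    CrossInt r (sect A i l) (sect B i m) := by
  intro x hx y hy
  simp only [sect, mem_filter, mem_univ, true_and] at hx hy
  refine (h _ hx _ hy).trans ?_
  rw [← Finset.card_map i.succAboveEmb]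
  apply Finset.card_le_card
  intro j hj
  rw [mem_filter] at hj
  rcases Fin.eq_self_or_eq_succAbove i j with rfl | ⟨k, rfl⟩
  · simp [hlm] at hj
  · simp only [Finset.mem_map, mem_filter, mem_univ, true_and]
    refine ⟨k, by simpa using hj.2, rfl⟩

lemma good_base {r : ℕ} (p : Fin r → ℕ) : GoodVec r p := by
  intro A B h
  have hpr : ∏ i ∈ univ.filter (fun i : Fin r => r ≤ (i : ℕ)), p i = 1 := by
    rw [Finset.filter_false_of_mem, Finset.prod_empty]
    intro i _; have := i.2; omega
  have heq : ∀ x ∈ A, ∀ y ∈ B, x = y := by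
    intro x hx y hy
    have h1 := h x hx y hy
    have h2 : univ.filter (fun i => x i = y i) = univ := by
      apply Finset.eq_univ_of_card
      apply le_antisymm (Finset.card_le_univ _)
      simpa using h1
    funext i
    have : i ∈ univ.filter (fun i => x i = y i) := by rw [h2]; exact mem_univ _
    simpa using this
  rw [hpr]
  rcases A.eq_empty_or_nonempty with rfl | ⟨x, hx⟩
  · simp
  rcases B.eq_empty_or_nonempty with rfl | ⟨y, hy⟩
  · simp
  have hA : A = {x} := by
    ext z; rw [mem_singleton]
    exact ⟨fun hz => (heq z hz y hy).trans (heq x hx y hy).symm, fun hz => hz ▸ hx⟩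
  have hB : B = {x} := by
    ext z; rw [mem_singleton]
    exact ⟨fun hz => (heq x hx z hz).symm, fun hz => by rw [hz, heq x hx y hy]; exact hy⟩
  refine ⟨by rw [hA, hB]; simp, fun _ => ⟨by rw [hA, hB], univ, x, by simp, ?_⟩⟩
  rw [hA]; ext z; simp [funext_iff]

lemma prod_sect {n r : ℕ} (hr : r < n + 1) (p : Fin (n + 1) → ℕ) (i : Fin (n + 1))
    (hi : (i : ℕ) ≤ r) :
    ∏ j ∈ univ.filter (fun j : Fin n => r ≤ (j : ℕ)), p (i.succAbove j) =
      ∏ j ∈ univ.filter (fun j : Fin (n + 1) => r < (j : ℕ)), p j := by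
  apply Finset.prod_bij (fun j _ => i.succAbove j)
  · intro j hj
    simp only [mem_filter, mem_univ, true_and] at hj ⊢
    rw [Fin.succAbove_of_le_castSucc _ _ (by rw [Fin.le_def]; simp; omega)]
    simp; omega
  · intro a _ b _ h
    exact Fin.succAbove_right_injective h
  · intro j hj
    simp only [mem_filter, mem_univ, true_and] at hj
    rcases Fin.eq_self_or_eq_succAbove i j with rfl | ⟨k, rfl⟩
    · omega
    · refine ⟨k, ?_, rfl⟩
      simp only [mem_filter, mem_univ, true_and]
      simp only [Fin.succAbove] at hj
      split_ifs at hj with hlt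
      · rw [Fin.lt_def] at hlt
        simp at hlt hj
        omega
      · simp at hj
        omega
  · intros; rfl

lemma prod_split {n r : ℕ} (hr : r < n + 1) (p : Fin (n + 1) → ℕ) :
    ∏ j ∈ univ.filter (fun j : Fin (n + 1) => r ≤ (j : ℕ)), p j =
      p ⟨r, hr⟩ * ∏ j ∈ univ.filter (fun j : Fin (n + 1) => r < (j : ℕ)), p j := by
  rw [← Finset.prod_insert (by simp)]
  congr 1
  ext j
  simp only [mem_filter, mem_univ, true_and, mem_insert, Fin.ext_iff]
  omega

/-- The coordinate dichotomy. -/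
lemma good_dich {n r : ℕ} (hr : r < n + 1) (p : Fin (n + 1) → ℕ) (hp3 : ∀ i, 3 ≤ p i)
    (hmono : ∀ i j : Fin (n + 1), i ≤ j → p i ≤ p j)
    (A B : Finset (∀ i, Fin (p i))) (h : CrossInt r A B)
    (hbig : (∏ i ∈ univ.filter (fun i : Fin (n + 1) => r ≤ (i : ℕ)), p i) ^ 2 ≤
      A.card * B.card)
    (i : Fin (n + 1)) (hi : (i : ℕ) ≤ r) (ih : GoodVec r (fun j => p (i.succAbove j))) :
    ((∏ i ∈ univ.filter (fun i : Fin (n + 1) => r ≤ (i : ℕ)), p i) ^ 2 = A.card * B.card ∧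
      A = B ∧ ∃ (T : Finset (Fin (n + 1))) (x₀ : ∀ i, Fin (p i)),
        T.card = r ∧ A = univ.filter (fun x => ∀ i ∈ T, x i = x₀ i)) ∨
    ∃ l, (p i : ℝ) * ((A.filter (fun x => x i ≠ l)).card : ℝ) < A.card ∧
      (p i : ℝ) * ((B.filter (fun x => x i ≠ l)).card : ℝ) < B.card := by
  set K := ∏ j ∈ univ.filter (fun j : Fin (n + 1) => r < (j : ℕ)), p j with hKdef
  have hN := prod_split hr p
  rw [← hKdef] at hN
  have hKi := prod_sect hr p i hi
  rw [← hKdef] at hKi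
  have hK : 0 < K := Finset.prod_pos (fun j _ => by have := hp3 j; omega)
  have hQ : p i ≤ p ⟨r, hr⟩ := hmono _ _ (by rw [Fin.le_def]; exact hi)
  have hG : ∀ l m, l ≠ m → _ := fun l m hlm => ih _ _ (cross_sect h i l m hlm)
  simp only [hKi] at hG
  have hSA := sum_card_sect A i
  have hSB := sum_card_sect B i
  have hSA' : ∑ l, ((sect A i l).card : ℝ) = A.card := by exact_mod_cast hSA
  have hSB' : ∑ l, ((sect B i l).card : ℝ) = B.card := by exact_mod_cast hSB
  have hcnt := aux_count (hp3 i) (K : ℝ) (by exact_mod_cast hK)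
    (fun l => ((sect A i l).card : ℝ)) (fun l => ((sect B i l).card : ℝ))
    (fun _ => by positivity) (fun _ => by positivity)
    (fun l m hlm => by exact_mod_cast (hG l m hlm).1)
    (fun l m hlm e => by
      have e' : (sect A i l).card * (sect B i m).card = K ^ 2 := by exact_mod_cast e
      rw [((hG l m hlm).2 e').1])
    (by
      rw [hSA', hSB']
      have : (p i) ^ 2 * K ^ 2 ≤ A.card * B.card := by
        refine le_trans ?_ hbig
        rw [hN, mul_pow]
        gcongr
      exact_mod_cast this)
  rcases hcnt with hU | ⟨l, hl⟩
  · left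
    have hU' : ∀ l m, l ≠ m → (sect A i l).card * (sect B i m).card = K ^ 2 :=
      fun l m hlm => by exact_mod_cast hU l m hlm
    have hE : ∀ l m, l ≠ m → sect A i l = sect B i m := fun l m hlm =>
      ((hG l m hlm).2 (hU' l m hlm)).1
    have h3 := hp3 i
    have hthird : ∀ l m : Fin (p i), ∃ k, k ≠ l ∧ k ≠ m := by
      intro l m
      have : ∃ k, k ∉ ({l, m} : Finset (Fin (p i))) := by
        by_contra hc
        push Not at hc
        have h1 : (univ : Finset (Fin (p i))) ⊆ {l, m} := fun k _ => hc k
        have h2 := (Finset.card_le_card h1).trans Finset.card_le_two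
        simp at h2; omega
      obtain ⟨k, hk⟩ := this
      simp at hk
      exact ⟨k, hk⟩
    have hAA : ∀ l m, sect A i l = sect A i m := by
      intro l m
      obtain ⟨k, hk1, hk2⟩ := hthird l m
      rw [hE l k hk1.symm, hE m k hk2.symm]
    have hABs : ∀ l m, sect A i l = sect B i m := by
      intro l m
      obtain ⟨k, hk1, hk2⟩ := hthird l m
      rw [hAA l k, hE k m hk2]
    have hmemA : ∀ x, x ∈ A ↔ i.removeNth x ∈ sect A i (x i) := by
      intro x
      simp only [sect, mem_filter, mem_univ, true_and]
      rw [Fin.insertNth_self_removeNth]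
    have hmemB : ∀ x, x ∈ B ↔ i.removeNth x ∈ sect B i (x i) := by
      intro x
      simp only [sect, mem_filter, mem_univ, true_and]
      rw [Fin.insertNth_self_removeNth]
    have hABe : A = B := by
      ext x
      rw [hmemA, hmemB, hABs (x i) (x i)]
    obtain ⟨l0, m0, hlm0⟩ : ∃ l0 m0 : Fin (p i), l0 ≠ m0 :=
      ⟨⟨0, by omega⟩, ⟨1, by omega⟩, by simp⟩
    have hcK : ∀ l, (sect A i l).card = K := by
      intro l
      have e := hU' l0 m0 hlm0
      rw [← hABs l m0, hAA l0 l, ← pow_two] at e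
      exact Nat.pow_left_injective (n := 2) (by norm_num) e
    have hcA : A.card = p i * K := by
      rw [← hSA]; simp [hcK]
    refine ⟨?_, hABe, ?_⟩
    · apply le_antisymm hbig
      rw [← hABe, hcA, hN, ← pow_two]
      gcongr
    · obtain ⟨T, z, hT, hz⟩ := ((hG l0 m0 hlm0).2 (hU' l0 m0 hlm0)).2
      refine ⟨T.map i.succAboveEmb, i.insertNth (α := fun i => Fin (p i)) l0 z, by simp [hT], ?_⟩
      ext x
      rw [hmemA, hAA (x i) l0, hz]
      simp [Fin.removeNth]
  · right
    refine ⟨l, ?_⟩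
    have key : ∀ C : Finset (∀ i, Fin (p i)),
        ((C.filter (fun x => x i ≠ l)).card : ℝ) = C.card - (sect C i l).card := by
      intro C
      rw [card_sect, ← Finset.card_filter_add_card_filter_not (s := C) (fun x => x i = l)]
      push_cast; ring
    rw [key A, key B]
    rw [hSA', hSB'] at hl
    exact hl

lemma union_bound {n r : ℕ} (hr : r < n + 1) (p : Fin (n + 1) → ℕ) (hp3 : ∀ i, 3 ≤ p i)
    (hcond : 2 / (p ⟨r, hr⟩ : ℝ) +
        ∑ i ∈ univ.filter (fun i : Fin (n + 1) => (i : ℕ) < r), 1 / (p i : ℝ) ≤ 1)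
    (A : Finset (∀ i, Fin (p i))) (l : ∀ i, Fin (p i))
    (hl : ∀ i : Fin (n + 1), (i : ℕ) ≤ r →
      (p i : ℝ) * ((A.filter (fun x => x i ≠ l i)).card : ℝ) < A.card) :
    A.card < ∏ i ∈ univ.filter (fun i : Fin (n + 1) => r ≤ (i : ℕ)), p i := by
  classical
  rw [prod_split hr p]
  set K := ∏ j ∈ univ.filter (fun j : Fin (n + 1) => r < (j : ℕ)), p j with hKdef
  have hQ : (0:ℝ) < p ⟨r, hr⟩ := by have := hp3 ⟨r, hr⟩; exact_mod_cast (by omega)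
  have hstar : (A.filter (fun x => ∀ i : Fin (n + 1), (i : ℕ) ≤ r → x i = l i)).card ≤ K := by
    have hsub : A.filter (fun x => ∀ i : Fin (n + 1), (i : ℕ) ≤ r → x i = l i) ⊆
        Fintype.piFinset (fun i : Fin (n + 1) => if (i : ℕ) ≤ r then {l i} else univ) := by
      intro x hx
      rw [mem_filter] at hx
      rw [Fintype.mem_piFinset]
      intro i
      split_ifs with hi
      · simpa using hx.2 i hi
      · simp
    refine (Finset.card_le_card hsub).trans (le_of_eq ?_)
    rw [Fintype.card_piFinset, hKdef, Finset.prod_filter]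
    apply Finset.prod_congr rfl
    intro i _
    by_cases hi : (i : ℕ) ≤ r
    · simp [hi]
    · simp [hi, not_le.1 hi]
  have hcov : A.card ≤ (A.filter (fun x => ∀ i : Fin (n + 1), (i : ℕ) ≤ r → x i = l i)).card +
      ∑ i ∈ univ.filter (fun i : Fin (n + 1) => (i : ℕ) ≤ r),
        (A.filter (fun x => x i ≠ l i)).card := by
    rw [← Finset.card_filter_add_card_filter_not (s := A)
      (fun x => ∀ i : Fin (n + 1), (i : ℕ) ≤ r → x i = l i)]
    gcongr
    refine le_trans (Finset.card_le_card ?_) Finset.card_biUnion_le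
    intro x hx
    rw [mem_filter] at hx
    obtain ⟨hxA, hx⟩ := hx
    push Not at hx
    obtain ⟨i, hi, hne⟩ := hx
    simp only [mem_biUnion, mem_filter, mem_univ, true_and]
    exact ⟨i, hi, hxA, hne⟩
  have hcov' : (A.card : ℝ) ≤ K + ∑ i ∈ univ.filter (fun i : Fin (n + 1) => (i : ℕ) ≤ r),
        ((A.filter (fun x => x i ≠ l i)).card : ℝ) := by
    exact_mod_cast hcov.trans (by gcongr)
  have hsum : ∑ i ∈ univ.filter (fun i : Fin (n + 1) => (i : ℕ) ≤ r),
        ((A.filter (fun x => x i ≠ l i)).card : ℝ) <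
      ∑ i ∈ univ.filter (fun i : Fin (n + 1) => (i : ℕ) ≤ r), (A.card : ℝ) * (1 / (p i : ℝ)) := by
    apply Finset.sum_lt_sum_of_nonempty
    · exact ⟨⟨r, hr⟩, by simp⟩
    · intro i hi
      rw [mem_filter] at hi
      have hpi : (0:ℝ) < p i := by have := hp3 i; exact_mod_cast (by omega)
      rw [mul_one_div, lt_div_iff₀ hpi, mul_comm]
      exact hl i hi.2
  rw [← Finset.mul_sum] at hsum
  have hsplit : ∑ i ∈ univ.filter (fun i : Fin (n + 1) => (i : ℕ) ≤ r), (1 / (p i : ℝ)) =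
      1 / (p ⟨r, hr⟩ : ℝ) +
        ∑ i ∈ univ.filter (fun i : Fin (n + 1) => (i : ℕ) < r), 1 / (p i : ℝ) := by
    rw [← Finset.sum_insert (f := fun i => 1 / (p i : ℝ)) (by simp)]
    congr 1
    ext j
    simp only [mem_filter, mem_univ, true_and, mem_insert, Fin.ext_iff]
    omega
  have hle : ∑ i ∈ univ.filter (fun i : Fin (n + 1) => (i : ℕ) ≤ r), (1 / (p i : ℝ)) ≤
      1 - 1 / (p ⟨r, hr⟩ : ℝ) := by
    rw [hsplit]
    have : 2 / (p ⟨r, hr⟩ : ℝ) = 1 / (p ⟨r, hr⟩ : ℝ) + 1 / (p ⟨r, hr⟩ : ℝ) := by ring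
    linarith
  have h1 := mul_le_mul_of_nonneg_left hle (Nat.cast_nonneg (α := ℝ) A.card)
  have h2 : (A.card : ℝ) * (1 / (p ⟨r, hr⟩ : ℝ)) < K := by
    have : (A.card : ℝ) * (1 - 1 / (p ⟨r, hr⟩ : ℝ)) =
      A.card - (A.card : ℝ) * (1 / (p ⟨r, hr⟩ : ℝ)) := by ring
    linarith
  rw [mul_one_div, div_lt_iff₀ hQ] at h2
  rw [mul_comm]
  exact_mod_cast h2

lemma good_step {n r : ℕ} (hr : r < n + 1) (p : Fin (n + 1) → ℕ) (hp3 : ∀ i, 3 ≤ p i)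
    (hmono : ∀ i j : Fin (n + 1), i ≤ j → p i ≤ p j)
    (hcond : 2 / (p ⟨r, hr⟩ : ℝ) +
        ∑ i ∈ univ.filter (fun i : Fin (n + 1) => (i : ℕ) < r), 1 / (p i : ℝ) ≤ 1)
    (ih : ∀ i : Fin (n + 1), (i : ℕ) ≤ r → GoodVec r (fun j => p (i.succAbove j))) :
    GoodVec r p := by
  intro A B h
  by_cases hbig : (∏ i ∈ univ.filter (fun i : Fin (n + 1) => r ≤ (i : ℕ)), p i) ^ 2 ≤
      A.card * B.card
  swap
  · push Not at hbig
    exact ⟨hbig.le, fun e => absurd e hbig.ne⟩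
  by_cases hex : ((∏ i ∈ univ.filter (fun i : Fin (n + 1) => r ≤ (i : ℕ)), p i) ^ 2 =
        A.card * B.card ∧
      A = B ∧ ∃ (T : Finset (Fin (n + 1))) (x₀ : ∀ i, Fin (p i)),
        T.card = r ∧ A = univ.filter (fun x => ∀ i ∈ T, x i = x₀ i))
  · exact ⟨hex.1.ge, fun _ => hex.2⟩
  exfalso
  have hpop : ∀ i : Fin (n + 1), ∃ l : Fin (p i), (i : ℕ) ≤ r →
      ((p i : ℝ) * ((A.filter (fun x => x i ≠ l)).card : ℝ) < A.card ∧
      (p i : ℝ) * ((B.filter (fun x => x i ≠ l)).card : ℝ) < B.card) := by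
    intro i
    by_cases hi : (i : ℕ) ≤ r
    · obtain ⟨l, hl⟩ := (good_dich hr p hp3 hmono A B h hbig i hi (ih i hi)).resolve_left hex
      exact ⟨l, fun _ => hl⟩
    · exact ⟨⟨0, by have := hp3 i; omega⟩, fun h => absurd h hi⟩
  choose l hl using hpop
  have hA := union_bound hr p hp3 hcond A l (fun i hi => (hl i hi).1)
  have hB := union_bound hr p hp3 hcond B l (fun i hi => (hl i hi).2)
  have := Nat.mul_lt_mul'' hA hB
  rw [pow_two] at hbig
  omega

lemma good_all (r n : ℕ) : ∀ (p : Fin n → ℕ), r ≤ n → (∀ i, 3 ≤ p i) →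
    (∀ i j : Fin n, i ≤ j → p i ≤ p j) →
    (∀ hrn : r < n, 2 / (p ⟨r, hrn⟩ : ℝ) +
        ∑ i ∈ univ.filter (fun i : Fin n => (i : ℕ) < r), 1 / (p i : ℝ) ≤ 1) →
    GoodVec r p := by
  induction n with
  | zero =>
    intro p hr _ _ _
    obtain rfl : r = 0 := by omega
    exact good_base p
  | succ n ihn =>
    intro p hr hp3 hmono hcond
    rcases hr.eq_or_lt with rfl | hr
    · exact good_base p
    refine good_step hr p hp3 hmono (hcond hr) (fun i hi => ?_)
    have hge : ∀ j : Fin n, p j.castSucc ≤ p (i.succAbove j) := by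
      intro j
      apply hmono
      simp only [Fin.succAbove]
      split_ifs
      · exact le_rfl
      · exact (Fin.castSucc_lt_succ).le
    refine ihn _ (by omega) (fun j => hp3 _) (fun j k hjk => hmono _ _ ?_) (fun hrn => ?_)
    · exact (Fin.strictMono_succAbove i).monotone hjk
    · refine le_trans (add_le_add ?_ ?_) (hcond hr)
      · have h1 := hge ⟨r, hrn⟩
        have h0 := hp3 ⟨r, hr⟩
        have h0' : (0:ℝ) < p ⟨r, hr⟩ := by exact_mod_cast (by omega)
        apply div_le_div_of_nonneg_left (by norm_num) h0'
        exact_mod_cast h1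
      · have e : ∑ j ∈ univ.filter (fun j : Fin (n + 1) => (j : ℕ) < r), 1 / (p j : ℝ) =
            ∑ j ∈ univ.filter (fun j : Fin n => (j : ℕ) < r), 1 / (p j.castSucc : ℝ) := by
          rw [Finset.sum_filter, Finset.sum_filter, Fin.sum_univ_castSucc]
          have : ¬ n < r := by omega
          simp [this]
        rw [e]
        apply Finset.sum_le_sum
        intro j _
        have h0 := hp3 j.castSucc
        have h0' : (0:ℝ) < p j.castSucc := by exact_mod_cast (by omega)
        apply div_le_div_of_nonneg_left (by norm_num) h0'
        exact_mod_cast hge j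

/-- Lemma 2: Let `1 ≤ r < n`, `p` a size vector with `3 ≤ p_1 ≤ ⋯ ≤ p_n` and
`2/p_{r+1} + ∑_{i=1}^r 1/p_i ≤ 1` (in 0-based indexing, `p_{r+1}` is `p r` and
the sum runs over indices `< r`). If `A, B ⊆ S_p` are `r`-cross-intersecting,
then `|A|·|B| ≤ ∏_{i=r+1}^n p_i²`, and in case of equality `A = B` and this
family is obtained by fixing `r` coordinates. -/
theorem lemma2 {n : ℕ} (r : ℕ) (hr : 1 ≤ r) (hrn : r < n)
    (p : Fin n → ℕ) (hp3 : ∀ i, 3 ≤ p i)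
    (hmono : ∀ i j : Fin n, i ≤ j → p i ≤ p j)
    (hcond : 2 / (p ⟨r, hrn⟩ : ℝ) +
        ∑ i ∈ univ.filter (fun i : Fin n => (i : ℕ) < r), 1 / (p i : ℝ) ≤ 1)
    (A B : Finset (∀ i, Fin (p i))) (hAB : CrossInt r A B) :
    A.card * B.card ≤ (∏ i ∈ univ.filter (fun i : Fin n => r ≤ (i : ℕ)), p i) ^ 2 ∧
    (A.card * B.card = (∏ i ∈ univ.filter (fun i : Fin n => r ≤ (i : ℕ)), p i) ^ 2 →
      A = B ∧ ∃ (T : Finset (Fin n)) (x₀ : ∀ i, Fin (p i)),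
        T.card = r ∧ A = univ.filter (fun x => ∀ i ∈ T, x i = x₀ i)) := by
  exact good_all r n p hrn.le hp3 hmono (fun _ => hcond) A B hAB
end

section
/- Let 1 ≤ r ≤ n, let p = (p_1,…,p_n) be a size vector, let (A, B) be a maximal pair of r-cross-intersecting families in S_p, and let T be the set of coordinates that are relevant for A or for B. Then the number of coordinates i ∈ T with p_i > 2 is strictly less than 5r. -/
open Finset

/-- `(A, B)` is a maximal `r`-cross-intersecting pair. -/
def MaxPair {n : ℕ} {p : Fin n → ℕ} (r : ℕ)
    (A B : Finset (∀ i, Fin (p i))) : Prop :=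
  CrossInt r A B ∧ ∀ A' B' : Finset (∀ i, Fin (p i)),
    CrossInt r A' B' → A'.card * B'.card ≤ A.card * B.card

/-- Coordinate `i` is relevant for `A`: some two vectors differing only in
coordinate `i` are such that one belongs to `A` and the other one does not. -/
def Relevant {n : ℕ} {p : Fin n → ℕ} (A : Finset (∀ i, Fin (p i)))
    (i : Fin n) : Prop :=
  ∃ x y : ∀ j, Fin (p j), (∀ j, j ≠ i → x j = y j) ∧ x ∈ A ∧ y ∉ A



section Helpers
open scoped Classical

/-- All vectors that lie in `A` after coordinate `i` is set to `l`. -/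
noncomputable def liftFam {n : ℕ} {p : Fin n → ℕ} (A : Finset (∀ i, Fin (p i)))
    (i : Fin n) (l : Fin (p i)) : Finset (∀ i, Fin (p i)) :=
  univ.filter (fun x => Function.update x i l ∈ A)

theorem mem_liftFam {n : ℕ} {p : Fin n → ℕ} (A : Finset (∀ i, Fin (p i)))
    (i : Fin n) (l : Fin (p i)) (x : ∀ i, Fin (p i)) :
    x ∈ liftFam A i l ↔ Function.update x i l ∈ A := by
  simp [liftFam]

theorem card_liftFam {n : ℕ} {p : Fin n → ℕ} (A : Finset (∀ i, Fin (p i)))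
    (i : Fin n) (l : Fin (p i)) :
    (liftFam A i l).card = p i * (A.filter (fun x => x i = l)).card := by
  have h : (liftFam A i l).card
      = ((A.filter (fun x => x i = l)) ×ˢ (univ : Finset (Fin (p i)))).card := by
    refine Finset.card_nbij' (fun x => (Function.update x i l, x i))
      (fun q => Function.update q.1 i q.2) ?_ ?_ ?_ ?_
    · intro x hx
      have := (mem_liftFam A i l x).1 hx
      simp [this]
    · intro q hq
      have hq' : q.1 ∈ A ∧ q.1 i = l := by simpa using hq
      refine (mem_liftFam A i l _).2 ?_
      rw [Function.update_idem, ← hq'.2, Function.update_eq_self]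
      exact hq'.1
    · intro x hx
      simp
    · intro q hq
      have hq' : q.1 ∈ A ∧ q.1 i = l := by simpa using hq
      ext1
      · simp [← hq'.2]
      · simp
  rw [h, card_product, card_univ, Fintype.card_fin, mul_comm]

theorem sum_card_liftFam {n : ℕ} {p : Fin n → ℕ} (A : Finset (∀ i, Fin (p i)))
    (i : Fin n) : ∑ l, (liftFam A i l).card = p i * A.card := by
  simp_rw [card_liftFam, ← Finset.mul_sum]
  rw [Finset.card_eq_sum_card_fiberwise (f := fun x => x i) (t := univ) (by simp)]

theorem not_relevant_of {n : ℕ} {p : Fin n → ℕ} (A : Finset (∀ i, Fin (p i)))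
    (i : Fin n) (h : ∀ l m, liftFam A i l ⊆ liftFam A i m) : ¬ Relevant A i := by
  rintro ⟨x, y, hxy, hx, hy⟩
  have h1 : x ∈ liftFam A i (x i) := by rw [mem_liftFam, Function.update_eq_self]; exact hx
  have h2 := (mem_liftFam _ _ _ _).1 (h _ (y i) h1)
  apply hy
  convert h2 using 1
  ext1 j
  by_cases hj : j = i
  · subst hj; simp
  · simp [hj, hxy j hj]

theorem crossInt_symm {n : ℕ} {p : Fin n → ℕ} {r : ℕ} {A B : Finset (∀ i, Fin (p i))}
    (h : CrossInt r A B) : CrossInt r B A := by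
  intro x hx y hy
  have := h y hy x hx
  simpa [eq_comm] using this

theorem maxPair_symm {n : ℕ} {p : Fin n → ℕ} {r : ℕ} {A B : Finset (∀ i, Fin (p i))}
    (h : MaxPair r A B) : MaxPair r B A := by
  refine ⟨crossInt_symm h.1, fun A' B' h' => ?_⟩
  have := h.2 B' A' (crossInt_symm h')
  linarith [mul_comm A'.card B'.card, mul_comm A.card B.card]

theorem lift_union_le {n : ℕ} {p : Fin n → ℕ} {r : ℕ} {A B : Finset (∀ i, Fin (p i))}
    (h : MaxPair r A B) (i : Fin n) (l m m' : Fin (p i)) (hm : m ≠ l) (hm' : m' ≠ l) :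
    (liftFam A i l).card * (liftFam B i m ∪ liftFam B i m').card ≤ A.card * B.card := by
  apply h.2
  have key : ∀ m : Fin (p i), m ≠ l → ∀ x ∈ liftFam A i l, ∀ y ∈ liftFam B i m,
      r ≤ (univ.filter (fun i => x i = y i)).card := by
    intro m hm x hx y hy
    refine (h.1 _ ((mem_liftFam _ _ _ _).1 hx) _ ((mem_liftFam _ _ _ _).1 hy)).trans ?_
    apply card_le_card
    intro j hj
    simp only [mem_filter, mem_univ, true_and] at hj ⊢
    by_cases hji : j = i
    · subst hji
      simp at hj
      exact absurd hj.symm hm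
    · simpa [hji] using hj
  intro x hx y hy
  rcases mem_union.1 hy with hy | hy
  · exact key m hm x hx y hy
  · exact key m' hm' x hx y hy

theorem two_var (P a b : ℝ) (hP : 3 ≤ P) (ha : 1 < a) (hb : b ≤ P) (haP : a ≤ P)
    (h1 : a * (P - b) ≤ P - 1) (h2 : b * (P - a) ≤ P - 1) : P - 1 ≤ a ∧ P - 1 ≤ b := by
  have hb1 : 1 < b := by
    by_contra hc
    push Not at hc
    nlinarith
  rcases le_total a b with hab | hab
  · have hb2 : P - 1 ≤ b := by
      by_contra hc
      push Not at hc
      nlinarith [mul_pos (sub_pos.2 hb1) (sub_pos.2 hc)]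
    refine ⟨?_, hb2⟩
    by_contra hc
    push Not at hc
    nlinarith
  · have hb2 : P - 1 ≤ a := by
      by_contra hc
      push Not at hc
      nlinarith [mul_pos (sub_pos.2 ha) (sub_pos.2 hc)]
    refine ⟨hb2, ?_⟩
    by_contra hc
    push Not at hc
    nlinarith

/-- The bound obtained by summing over `m ≠ l`. -/
theorem lift_sum_le {n : ℕ} {p : Fin n → ℕ} {r : ℕ} {A B : Finset (∀ i, Fin (p i))}
    (h : MaxPair r A B) (hA : 0 < A.card) (hB : 0 < B.card) (i : Fin n) (l : Fin (p i)) :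
    ((liftFam A i l).card / A.card : ℝ) * (p i - (liftFam B i l).card / B.card : ℝ)
      ≤ (p i : ℝ) - 1 := by
  have hA' : (0 : ℝ) < A.card := by exact_mod_cast hA
  have hB' : (0 : ℝ) < B.card := by exact_mod_cast hB
  have h1 : ∑ m ∈ univ.erase l, ((liftFam A i l).card * (liftFam B i m).card : ℝ)
      ≤ ∑ m ∈ univ.erase l, (A.card * B.card : ℝ) := by
    apply sum_le_sum
    intro m hm
    have hm := (mem_erase.1 hm).1
    have := lift_union_le h i l m m hm hm
    rw [union_self] at this
    exact_mod_cast this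
  have h2 : ∑ m ∈ univ.erase l, ((liftFam B i m).card : ℝ)
      = p i * B.card - (liftFam B i l).card := by
    have e1 := sum_card_liftFam B i
    have e2 := Finset.add_sum_erase univ (fun m => (liftFam B i m).card) (mem_univ l)
    have e3 : (liftFam B i l).card + ∑ m ∈ univ.erase l, (liftFam B i m).card
        = p i * B.card := by rw [← e1, ← e2]
    have e4 : ((liftFam B i l).card : ℝ) + ∑ m ∈ univ.erase l, ((liftFam B i m).card : ℝ)
        = p i * B.card := by exact_mod_cast e3
    linarith
  have h3 : (((univ : Finset (Fin (p i))).erase l).card : ℝ) = p i - 1 := by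
    rw [card_erase_of_mem (mem_univ l), card_univ, Fintype.card_fin,
      Nat.cast_sub (by have := l.2; omega)]
    simp
  rw [← mul_sum, h2, sum_const, nsmul_eq_mul, h3] at h1
  have : ((liftFam A i l).card / A.card : ℝ) * (p i - (liftFam B i l).card / B.card : ℝ)
      = ((liftFam A i l).card * (p i * B.card - (liftFam B i l).card)) / (A.card * B.card) := by
    field_simp
  rw [this, div_le_iff₀ (by positivity)]
  exact h1

theorem card_liftFam_le {n : ℕ} {p : Fin n → ℕ} (A : Finset (∀ i, Fin (p i)))
    (i : Fin n) (l : Fin (p i)) : (liftFam A i l).card ≤ p i * A.card := by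
  rw [card_liftFam]
  exact Nat.mul_le_mul_left _ (card_filter_le _ _)

/-- If all lifts of `A` and `B` have size equal to that of the family, `i` is irrelevant for `B`. -/
theorem irrel_of_eq {n : ℕ} {p : Fin n → ℕ} {r : ℕ} {A B : Finset (∀ i, Fin (p i))}
    (h : MaxPair r A B) (hA : 0 < A.card) (i : Fin n) (hp : 3 ≤ p i)
    (h1 : ∀ l, (liftFam A i l).card = A.card) (h2 : ∀ l, (liftFam B i l).card = B.card) :
    ¬ Relevant B i := by
  apply not_relevant_of
  intro m m'
  have : ∃ l : Fin (p i), l ≠ m ∧ l ≠ m' := by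
    have hc : ({m, m'} : Finset (Fin (p i))).card < (univ : Finset (Fin (p i))).card := by
      rw [card_univ, Fintype.card_fin]
      exact lt_of_le_of_lt card_le_two (by omega)
    obtain ⟨l, -, hl⟩ := exists_mem_notMem_of_card_lt_card hc
    simp at hl
    exact ⟨l, hl.1, hl.2⟩
  obtain ⟨l, hl, hl'⟩ := this
  have h3 := lift_union_le h i l m m' hl.symm hl'.symm
  rw [h1] at h3
  have h4 := Nat.le_of_mul_le_mul_left h3 hA
  rw [← h2 m'] at h4
  have h5 := eq_of_subset_of_card_le (subset_union_right (s₁ := liftFam B i m)) h4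
  rw [h5]
  exact subset_union_left

theorem all_eq_of_le {n : ℕ} {p : Fin n → ℕ} (A : Finset (∀ i, Fin (p i))) (i : Fin n)
    (h : ∀ l, (liftFam A i l).card ≤ A.card) : ∀ l, (liftFam A i l).card = A.card := by
  have e : ∑ l, (liftFam A i l).card = ∑ _l : Fin (p i), A.card := by
    rw [sum_card_liftFam]; simp
  have := (Finset.sum_eq_sum_iff_of_le (fun l _ => h l)).1 e
  exact fun l => this l (mem_univ l)

theorem popular {n : ℕ} {p : Fin n → ℕ} {r : ℕ} {A B : Finset (∀ i, Fin (p i))}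
    (h : MaxPair r A B) (hA : 0 < A.card) (hB : 0 < B.card) (i : Fin n) (hp : 3 ≤ p i)
    (hrel : Relevant A i ∨ Relevant B i) :
    ∃ l : Fin (p i), ((p i : ℝ) - 1) * A.card ≤ p i * (A.filter (fun x => x i = l)).card ∧
      ((p i : ℝ) - 1) * B.card ≤ p i * (B.filter (fun x => x i = l)).card := by
  have hA' : (0 : ℝ) < A.card := by exact_mod_cast hA
  have hB' : (0 : ℝ) < B.card := by exact_mod_cast hB
  have hex : ∃ l, A.card < (liftFam A i l).card := by
    by_contra hc
    push Not at hc
    have hAe := all_eq_of_le A i hc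
    have hBe : ∀ m, (liftFam B i m).card = B.card := by
      apply all_eq_of_le
      intro m
      have : ∃ l : Fin (p i), l ≠ m := by
        have hc : ({m} : Finset (Fin (p i))).card < (univ : Finset (Fin (p i))).card := by
          rw [card_univ, Fintype.card_fin, card_singleton]; omega
        obtain ⟨l, -, hl⟩ := exists_mem_notMem_of_card_lt_card hc
        exact ⟨l, by simpa using hl⟩
      obtain ⟨l, hl⟩ := this
      have h3 := lift_union_le h i l m m hl.symm hl.symm
      rw [hAe, union_self] at h3
      exact Nat.le_of_mul_le_mul_left h3 hA
    rcases hrel with hr | hr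
    · exact irrel_of_eq (maxPair_symm h) hB i hp hBe hAe hr
    · exact irrel_of_eq h hA i hp hAe hBe hr
  obtain ⟨l, hl⟩ := hex
  refine ⟨l, ?_⟩
  have hl' : (A.card : ℝ) < (liftFam A i l).card := by exact_mod_cast hl
  have b1 : ((liftFam A i l).card : ℝ) ≤ p i * A.card := by exact_mod_cast card_liftFam_le A i l
  have b2 : ((liftFam B i l).card : ℝ) ≤ p i * B.card := by exact_mod_cast card_liftFam_le B i l
  obtain ⟨c1, c2⟩ := two_var (p i) ((liftFam A i l).card / A.card)
    ((liftFam B i l).card / B.card) (by exact_mod_cast hp)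
    (by rw [lt_div_iff₀ hA']; linarith) (by rwa [div_le_iff₀ hB']) (by rwa [div_le_iff₀ hA'])
    (lift_sum_le h hA hB i l) (lift_sum_le (maxPair_symm h) hB hA i l)
  rw [le_div_iff₀ hA', card_liftFam] at c1
  rw [le_div_iff₀ hB', card_liftFam] at c2
  push_cast at c1 c2
  exact ⟨c1, c2⟩

/-- The entropy-type bound: the Gibbs inequality. -/
theorem gibbs {n : ℕ} {p : Fin n → ℕ} (A : Finset (∀ i, Fin (p i))) (hA : 0 < A.card)
    (q : ∀ i, Fin (p i) → ℝ) (hq : ∀ i l, 0 < q i l) (hs : ∀ i, ∑ l, q i l = 1) :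
    ∑ i, ∑ x ∈ A, Real.log (q i (x i)) ≤ - (A.card * Real.log A.card) := by
  have hA' : (0 : ℝ) < A.card := by exact_mod_cast hA
  have htot : ∑ x : (∀ i, Fin (p i)), ∏ i, q i (x i) = 1 := by
    rw [← Fintype.prod_sum]
    simp [hs]
  have hle : ∑ x ∈ A, ∏ i, q i (x i) ≤ 1 := by
    rw [← htot]
    exact sum_le_sum_of_subset_of_nonneg (subset_univ _)
      (fun x _ _ => prod_nonneg fun i _ => (hq i _).le)
  have hpt : ∀ x ∈ A, Real.log A.card + ∑ i, Real.log (q i (x i))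
      ≤ A.card * (∏ i, q i (x i)) - 1 := by
    intro x _
    have hpos : 0 < ∏ i, q i (x i) := prod_pos fun i _ => hq i _
    rw [← Real.log_prod (fun i _ => (hq i _).ne'), ← Real.log_mul hA'.ne' hpos.ne']
    exact Real.log_le_sub_one_of_pos (mul_pos hA' hpos)
  have := sum_le_sum hpt
  rw [sum_add_distrib, sum_sub_distrib, ← mul_sum, sum_const, sum_const, nsmul_eq_mul,
    nsmul_eq_mul, sum_comm] at this
  nlinarith

/-- The size bound for a family with popular values on the coordinates in `U`. -/
theorem size_bound {n : ℕ} {p : Fin n → ℕ} (hp2 : ∀ i, 2 ≤ p i)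
    (A : Finset (∀ i, Fin (p i))) (hA : 0 < A.card)
    (U : Finset (Fin n)) (hU : ∀ i ∈ U, 3 ≤ p i) (v : ∀ i, Fin (p i))
    (hv : ∀ i ∈ U, ((p i : ℝ) - 1) * A.card ≤ p i * (A.filter (fun x => x i = v i)).card) :
    Real.log A.card ≤ ∑ i, Real.log (p i)
      - ∑ i ∈ U, (1 - 2 / (p i : ℝ)) * Real.log ((p i : ℝ) - 1) := by
  have hA' : (0 : ℝ) < A.card := by exact_mod_cast hA
  have hpR : ∀ i, (2 : ℝ) ≤ p i := fun i => by exact_mod_cast hp2 i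
  let q : ∀ i, Fin (p i) → ℝ := fun i l =>
    if i ∈ U then (if l = v i then ((p i : ℝ) - 1) / p i else 1 / (p i * ((p i : ℝ) - 1)))
    else 1 / p i
  have hq : ∀ i l, 0 < q i l := by
    intro i l
    have := hpR i
    have h1 : (0 : ℝ) < p i - 1 := by linarith
    have h2 : (0 : ℝ) < p i := by linarith
    simp only [q]
    split_ifs <;> positivity
  have hs : ∀ i, ∑ l, q i l = 1 := by
    intro i
    have := hpR i
    have h1 : (p i : ℝ) - 1 ≠ 0 := by intro; linarith
    have h2 : (p i : ℝ) ≠ 0 := by intro; linarith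
    by_cases hi : i ∈ U
    · simp only [q, hi, if_true]
      rw [← Finset.add_sum_erase univ _ (mem_univ (v i))]
      rw [Finset.sum_congr rfl (g := fun _ => 1 / ((p i : ℝ) * ((p i : ℝ) - 1)))
        (fun x hx => by rw [if_neg (mem_erase.1 hx).1])]
      rw [sum_const, card_erase_of_mem (mem_univ _), card_univ, Fintype.card_fin, nsmul_eq_mul,
        Nat.cast_sub (by have := hp2 i; omega)]
      simp only [if_true, Nat.cast_one]
      field_simp
      ring
    · simp only [q, hi, if_false]
      simp [h2]
  have hg := gibbs A hA q hq hs
  have hlow : ∀ i, A.card * ((if i ∈ U then (1 - 2 / (p i : ℝ)) * Real.log ((p i : ℝ) - 1) else 0)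
      - Real.log (p i)) ≤ ∑ x ∈ A, Real.log (q i (x i)) := by
    intro i
    have := hpR i
    have h1 : (0 : ℝ) < p i - 1 := by linarith
    have h2 : (0 : ℝ) < p i := by linarith
    by_cases hi : i ∈ U
    · have hlog : 0 ≤ Real.log ((p i : ℝ) - 1) := Real.log_nonneg (by linarith)
      have e : ∀ x ∈ A, Real.log (q i (x i)) = (- Real.log (p i) - Real.log ((p i : ℝ) - 1)) +
          (if x i = v i then 2 * Real.log ((p i : ℝ) - 1) else 0) := by
        intro x _
        simp only [q, hi, if_true]
        split_ifs
        · rw [Real.log_div h1.ne' h2.ne']; ring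
        · rw [one_div, Real.log_inv, Real.log_mul h2.ne' h1.ne']; ring
      rw [sum_congr rfl e, sum_add_distrib, sum_const, nsmul_eq_mul, ← sum_filter, sum_const,
        nsmul_eq_mul, if_pos hi]
      have hvi := hv i hi
      have h3 : (1 - 1 / (p i : ℝ)) * A.card ≤ (A.filter (fun x => x i = v i)).card := by
        have : (1 - 1 / (p i : ℝ)) * A.card = (((p i : ℝ) - 1) * A.card) / p i := by
          field_simp
        rw [this, div_le_iff₀ h2]
        linarith
      have h4 := mul_le_mul_of_nonneg_right h3 (by positivity : 0 ≤ 2 * Real.log ((p i : ℝ) - 1))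
      have e2 : (2 : ℝ) / p i = 2 * (1 / p i) := by ring
      rw [e2]
      linarith
    · simp only [q, hi, if_false, sum_const, nsmul_eq_mul, one_div, Real.log_inv]
      apply le_of_eq
      ring
  have := (sum_le_sum (fun i (_ : i ∈ univ) => hlow i)).trans hg
  rw [← mul_sum, sum_sub_distrib, ← mul_neg, mul_le_mul_iff_right₀ hA', sum_ite_mem,
    univ_inter] at this
  linarith

theorem num_ineq (P : ℕ) (hP : 3 ≤ P) :
    Real.log P < 5 * ((1 - 2 / (P : ℝ)) * Real.log ((P : ℝ) - 1)) := by
  have hPR : (3 : ℝ) ≤ P := by exact_mod_cast hP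
  rcases eq_or_lt_of_le hP with h | h
  · subst h
    have : 3 * Real.log 3 < 5 * Real.log 2 := by
      rw [← Real.log_rpow (by norm_num), ← Real.log_rpow (by norm_num)]
      apply Real.log_lt_log (by positivity)
      norm_num
    have e : ((3 : ℕ) : ℝ) - 1 = 2 := by norm_num
    rw [e]
    push_cast
    linarith
  · have h4 : (4 : ℝ) ≤ P := by exact_mod_cast h
    have hlog : 0 < Real.log ((P : ℝ) - 1) := Real.log_pos (by linarith)
    have h5 : (2 : ℝ) / P ≤ 1 / 2 := by
      rw [div_le_div_iff₀ (by linarith) (by norm_num)]; linarith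
    have h6 : Real.log P < 2 * Real.log ((P : ℝ) - 1) := by
      have : (2 : ℝ) * Real.log ((P : ℝ) - 1) = Real.log (((P : ℝ) - 1) ^ 2) := by
        rw [Real.log_pow]; norm_num
      rw [this]
      apply Real.log_lt_log (by linarith)
      nlinarith
    nlinarith

/-- Lower bound for the product from fixing the coordinates in `R`. -/
theorem fix_bound {n : ℕ} {p : Fin n → ℕ} (hp2 : ∀ i, 2 ≤ p i) {r : ℕ}
    {A B : Finset (∀ i, Fin (p i))} (h : MaxPair r A B) (v : ∀ i, Fin (p i))
    (R : Finset (Fin n)) (hR : R.card = r) :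
    0 < A.card ∧ 0 < B.card ∧
    2 * (∑ i, Real.log (p i) - ∑ i ∈ R, Real.log (p i)) ≤ Real.log A.card + Real.log B.card := by
  let F : Finset (∀ i, Fin (p i)) :=
    Fintype.piFinset (fun i => if i ∈ R then {v i} else univ)
  have hF : CrossInt r F F := by
    intro x hx y hy
    rw [← hR]
    apply card_le_card
    intro i hi
    have h1 := Fintype.mem_piFinset.1 hx i
    have h2 := Fintype.mem_piFinset.1 hy i
    rw [if_pos hi, mem_singleton] at h1 h2
    simp [h1, h2]
  have hle := h.2 F F hF
  have hFpos : 0 < F.card := by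
    apply Finset.card_pos.2
    refine ⟨v, Fintype.mem_piFinset.2 fun i => ?_⟩
    split_ifs <;> simp
  have hpos : 0 < A.card * B.card := lt_of_lt_of_le (Nat.mul_pos hFpos hFpos) hle
  have hA := Nat.pos_of_mul_pos_right hpos
  have hB := Nat.pos_of_mul_pos_left hpos
  refine ⟨by positivity, by positivity, ?_⟩
  have hA' : (0 : ℝ) < A.card := by exact_mod_cast hA
  have hB' : (0 : ℝ) < B.card := by exact_mod_cast hB
  have hF' : (0 : ℝ) < F.card := by exact_mod_cast hFpos
  have hlogF : Real.log F.card = ∑ i, Real.log (p i) - ∑ i ∈ R, Real.log (p i) := by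
    have : (F.card : ℝ) = ∏ i, (if i ∈ R then (1 : ℝ) else p i) := by
      simp only [F, Fintype.card_piFinset]
      push_cast
      apply prod_congr rfl
      intro i _
      split_ifs <;> simp
    rw [this, Real.log_prod]
    · have e : ∑ i ∈ R, Real.log (p i) = ∑ i, if i ∈ R then Real.log (p i) else 0 := by simp
      rw [e, ← sum_sub_distrib]
      apply sum_congr rfl
      intro i _
      split_ifs <;> simp
    · intro i _
      have := hp2 i
      split_ifs
      · simp
      · exact_mod_cast (by omega : p i ≠ 0)
  rw [← hlogF, ← Real.log_mul hA'.ne' hB'.ne', two_mul, ← Real.log_mul hF'.ne' hF'.ne']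
  apply Real.log_le_log (by positivity)
  exact_mod_cast hle

end Helpers

open scoped Classical in
/-- Theorem 6 (count): for a maximal `r`-cross-intersecting pair `(A, B)` with
`T` the set of coordinates relevant for `A` or `B`, the number of coordinates
`i ∈ T` with `p_i > 2` is strictly less than `5r`. -/
theorem theorem6_count {n : ℕ} (r : ℕ) (hr : 1 ≤ r) (hrn : r ≤ n)
    (p : Fin n → ℕ) (hp : ∀ i, 2 ≤ p i)
    (A B : Finset (∀ i, Fin (p i))) (hAB : MaxPair r A B)
    (T : Finset (Fin n))
    (hT : T = univ.filter (fun i => Relevant A i ∨ Relevant B i)) :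
    (T.filter (fun i => 2 < p i)).card < 5 * r := by
  by_contra hcon
  push Not at hcon
  set U := T.filter (fun i => 2 < p i) with hUdef
  have hU3 : ∀ i ∈ U, 3 ≤ p i := fun i hi => (mem_filter.1 hi).2
  have hUrel : ∀ i ∈ U, Relevant A i ∨ Relevant B i := by
    intro i hi
    have := (mem_filter.1 hi).1
    rw [hT] at this
    exact (mem_filter.1 this).2
  let v0 : ∀ i, Fin (p i) := fun i => ⟨0, by have := hp i; omega⟩
  obtain ⟨R0, hR0U, hR0⟩ := exists_subset_card_eq (show r ≤ U.card by omega)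
  obtain ⟨hA, hB, -⟩ := fix_bound hp hAB v0 R0 hR0
  have hpop : ∀ i, ∃ l : Fin (p i), i ∈ U →
      ((p i : ℝ) - 1) * A.card ≤ p i * (A.filter (fun x => x i = l)).card ∧
      ((p i : ℝ) - 1) * B.card ≤ p i * (B.filter (fun x => x i = l)).card := by
    intro i
    by_cases hi : i ∈ U
    · obtain ⟨l, hl⟩ := popular hAB hA hB i (hU3 i hi) (hUrel i hi)
      exact ⟨l, fun _ => hl⟩
    · exact ⟨v0 i, fun h => absurd h hi⟩
  choose v hv using hpop
  have sA := size_bound hp A hA U hU3 v (fun i hi => (hv i hi).1)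
  have sB := size_bound hp B hB U hU3 v (fun i hi => (hv i hi).2)
  set G := ∑ i ∈ U, (1 - 2 / (p i : ℝ)) * Real.log ((p i : ℝ) - 1) with hG
  have hR : ∀ R : Finset (Fin n), R.card = r → G ≤ ∑ i ∈ R, Real.log (p i) := by
    intro R hR
    have := (fix_bound hp hAB v0 R hR).2.2
    linarith
  have hcard : Fintype.card (Fin 5 × Fin r) ≤ Fintype.card U := by simpa using hcon
  obtain ⟨e⟩ := Function.Embedding.nonempty_of_card_le hcard
  let f : Fin 5 × Fin r ↪ Fin n := e.trans (Function.Embedding.subtype _)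
  have hfU : ∀ z, f z ∈ U := fun z => (e z).2
  have hj : ∀ j : Fin 5, G ≤ ∑ k : Fin r, Real.log (p (f (j, k))) := by
    intro j
    let g : Fin r ↪ Fin n := ⟨fun k => f (j, k), fun a b hab => by
      have := f.injective hab
      simpa using this⟩
    have := hR (univ.map g) (by simp)
    rw [sum_map] at this
    exact this
  have hsum : 5 * G ≤ ∑ z, Real.log (p (f z)) := by
    have := sum_le_sum (fun j (_ : j ∈ univ) => hj j)
    rw [Fintype.sum_prod_type]
    simpa using this
  have hle : ∑ z, Real.log (p (f z)) ≤ ∑ i ∈ U, Real.log (p i) := by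
    have e1 : ∑ z, Real.log (p (f z)) = ∑ i ∈ univ.map f, Real.log (p i) := by rw [sum_map]
    rw [e1]
    apply sum_le_sum_of_subset_of_nonneg
    · intro i hi
      obtain ⟨z, -, rfl⟩ := mem_map.1 hi
      exact hfU z
    · intro i _ _
      exact Real.log_natCast_nonneg _
  have hlt : ∑ i ∈ U, Real.log (p i) < 5 * G := by
    rw [hG, mul_sum]
    apply sum_lt_sum_of_nonempty
    · exact card_pos.1 (by omega)
    · intro i hi
      exact num_ineq (p i) (hU3 i hi)
  linarith
end

section
/- Let 1 ≤ r ≤ n, let p = (p_1,…,p_n) be a size vector with p_1 ≤ p_2 ≤ … ≤ p_n and p_1 > r + 1, and let A, B ⊆ S_p be r-cross-intersecting families. Then |A|·|B| ≤ Π_{i=r+1}^{n} p_i². Moreover, if equality holds, then A = B and there exist a set T ⊆ [n] with |T| = r and a vector x_0 ∈ S_p such that A = {x ∈ S_p : x_i = (x_0)_i for all i ∈ T}. -/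
open Finset

namespace CI

variable {n : ℕ} {p : Fin n → ℕ}

/-- Vectors which land in `A` after setting coordinate `i` to `l`. -/
def Up (A : Finset (∀ i, Fin (p i))) (i : Fin n) (l : Fin (p i)) : Finset (∀ i, Fin (p i)) :=
  univ.filter (fun x => Function.update x i l ∈ A)

/-- Vectors which land in `B` after setting coordinate `i` to some value other than `l`. -/
def Ext (B : Finset (∀ i, Fin (p i))) (i : Fin n) (l : Fin (p i)) : Finset (∀ i, Fin (p i)) :=
  univ.filter (fun x => ∃ v, v ≠ l ∧ Function.update x i v ∈ B)

/-- The part of `A` with coordinate `i` equal to `l`. -/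
def At (A : Finset (∀ i, Fin (p i))) (i : Fin n) (l : Fin (p i)) : Finset (∀ i, Fin (p i)) :=
  A.filter (fun x => x i = l)

/-- The part of `A` with coordinate `i` different from `l`. -/
def Ne (A : Finset (∀ i, Fin (p i))) (i : Fin n) (l : Fin (p i)) : Finset (∀ i, Fin (p i)) :=
  A.filter (fun x => ¬ x i = l)

/-- Coordinate `i` is irrelevant for `A`. -/
def Closed (A : Finset (∀ i, Fin (p i))) (i : Fin n) : Prop :=
  ∀ x ∈ A, ∀ v, Function.update x i v ∈ A

/-- The pair has maximal product among cross-intersecting pairs. -/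
def MaxPair (r : ℕ) (A B : Finset (∀ i, Fin (p i))) : Prop :=
  CrossInt r A B ∧ ∀ A' B' : Finset (∀ i, Fin (p i)), CrossInt r A' B' →
    A'.card * B'.card ≤ A.card * B.card

lemma CrossInt.symm {r : ℕ} {A B : Finset (∀ i, Fin (p i))} (h : CrossInt r A B) :
    CrossInt r B A := by
  intro x hx y hy
  have := h y hy x hx
  simpa only [eq_comm] using this

lemma MaxPair.symm {r : ℕ} {A B : Finset (∀ i, Fin (p i))} (h : MaxPair r A B) :
    MaxPair r B A := by
  refine ⟨CrossInt.symm h.1, fun A' B' h' => ?_⟩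
  have := h.2 B' A' (CrossInt.symm h')
  rw [mul_comm A'.card, mul_comm B.card]; exact this

lemma card_up (A : Finset (∀ i, Fin (p i))) (i : Fin n) (l : Fin (p i)) :
    (Up A i l).card = p i * (At A i l).card := by
  have : (Up A i l).card = ((univ : Finset (Fin (p i))) ×ˢ (At A i l)).card := by
    refine Finset.card_nbij' (fun x => (x i, Function.update x i l))
      (fun z => Function.update z.2 i z.1) ?_ ?_ ?_ ?_
    · intro x hx
      simpa [Up, At] using hx
    · rintro ⟨v, x⟩ hx
      simp only [At, coe_product, coe_univ, Set.mem_prod, Set.mem_univ, true_and, coe_filter,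
        Set.mem_setOf_eq] at hx
      simp only [Up, coe_filter, Set.mem_setOf_eq, mem_univ, true_and, Function.update_idem]
      rw [← hx.2, Function.update_eq_self]; exact hx.1
    · intro x hx
      simp
    · rintro ⟨v, x⟩ hx
      simp only [At, coe_product, coe_univ, Set.mem_prod, Set.mem_univ, true_and, coe_filter,
        Set.mem_setOf_eq] at hx
      simp [← hx.2]
  rw [this, card_product]; simp

lemma card_at_add_ne (A : Finset (∀ i, Fin (p i))) (i : Fin n) (l : Fin (p i)) :
    (At A i l).card + (Ne A i l).card = A.card :=
  Finset.card_filter_add_card_filter_not _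

lemma up_ext (B : Finset (∀ i, Fin (p i))) (i : Fin n) (l v : Fin (p i)) :
    Up (Ext B i l) i v = Ext B i l := by
  ext x; simp [Up, Ext]

lemma ne_sub (B : Finset (∀ i, Fin (p i))) (i : Fin n) (l : Fin (p i)) :
    Ne B i l ⊆ Ne (Ext B i l) i l := by
  intro x hx
  simp only [Ne, Ext, mem_filter, mem_univ, true_and] at hx ⊢
  exact ⟨⟨x i, hx.2, by simpa using hx.1⟩, hx.2⟩

lemma card_ne_ext (B : Finset (∀ i, Fin (p i))) (i : Fin n) (l : Fin (p i)) :
    (p i : ℝ) * (Ne (Ext B i l) i l).card = (p i - 1) * (Ext B i l).card := by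
  have h1 := card_up (Ext B i l) i l
  rw [up_ext] at h1
  have h2 := card_at_add_ne (Ext B i l) i l
  have h1' : ((Ext B i l).card : ℝ) = p i * (At (Ext B i l) i l).card := by exact_mod_cast h1
  have h2' : ((At (Ext B i l) i l).card : ℝ) + (Ne (Ext B i l) i l).card = (Ext B i l).card := by
    exact_mod_cast h2
  rw [← eq_sub_iff_add_eq'] at h2'
  rw [h2']; linarith

lemma cross_up_ext {r : ℕ} {A B : Finset (∀ i, Fin (p i))} (h : CrossInt r A B)
    (i : Fin n) (l : Fin (p i)) : CrossInt r (Up A i l) (Ext B i l) := by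
  intro x hx y hy
  simp only [Up, Ext, mem_filter, mem_univ, true_and] at hx hy
  obtain ⟨v, hv, hy⟩ := hy
  refine (h _ hx _ hy).trans (card_le_card ?_)
  intro j hj
  simp only [mem_filter, mem_univ, true_and] at hj ⊢
  by_cases hji : j = i
  · subst hji
    simp at hj
    exact absurd hj.symm hv
  · simpa [Function.update_of_ne hji] using hj

lemma basic_facts {r : ℕ} {A B : Finset (∀ i, Fin (p i))} (h : MaxPair r A B)
    (i : Fin n) (l : Fin (p i)) :
    ((Up A i l).card : ℝ) = p i * (At A i l).card ∧
    (p i : ℝ) * (B.card - (At B i l).card) ≤ (p i - 1) * (Ext B i l).card ∧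
    ((Up A i l).card : ℝ) * (Ext B i l).card ≤ A.card * B.card := by
  refine ⟨by exact_mod_cast card_up A i l, ?_, by exact_mod_cast h.2 _ _ (cross_up_ext h.1 i l)⟩
  rw [← card_ne_ext]
  have h2 : ((At B i l).card : ℝ) + (Ne B i l).card = B.card := by
    exact_mod_cast card_at_add_ne B i l
  have h3 : ((Ne B i l).card : ℝ) ≤ (Ne (Ext B i l) i l).card := by
    exact_mod_cast card_le_card (ne_sub B i l)
  have : (B.card : ℝ) - (At B i l).card = (Ne B i l).card := by linarith
  rw [this]
  gcongr

lemma main_ineq {r : ℕ} {A B : Finset (∀ i, Fin (p i))} (h : MaxPair r A B)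
    (i : Fin n) (l : Fin (p i)) (h3 : 3 ≤ p i) :
    (p i : ℝ) * (At A i l).card * (p i * (B.card - (At B i l).card)) ≤
      (p i - 1) * (A.card * B.card) := by
  obtain ⟨h1, h2, h4⟩ := basic_facts h i l
  have hP : (3 : ℝ) ≤ p i := by exact_mod_cast h3
  rw [h1] at h4
  calc _ ≤ (p i : ℝ) * (At A i l).card * ((p i - 1) * (Ext B i l).card) := by gcongr
    _ = (p i - 1) * ((p i : ℝ) * (At A i l).card * (Ext B i l).card) := by ring
    _ ≤ _ := by
      apply mul_le_mul_of_nonneg_left h4; linarith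

lemma main_eq {r : ℕ} {A B : Finset (∀ i, Fin (p i))} (h : MaxPair r A B)
    (i : Fin n) (l : Fin (p i)) (h3 : 3 ≤ p i) (hpos : 0 < (At A i l).card)
    (he : (p i : ℝ) * (At A i l).card * (p i * (B.card - (At B i l).card)) =
      (p i - 1) * (A.card * B.card)) :
    MaxPair r (Up A i l) (Ext B i l) ∧ Ne B i l = Ne (Ext B i l) i l := by
  obtain ⟨h1, h2, h4⟩ := basic_facts h i l
  have hP : (3 : ℝ) ≤ p i := by exact_mod_cast h3
  have hpos' : (0 : ℝ) < (At A i l).card := by exact_mod_cast hpos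
  have h5 : ((Up A i l).card : ℝ) * (Ext B i l).card = A.card * B.card := by
    refine le_antisymm h4 ?_
    have : ((p i : ℝ) - 1) * (A.card * B.card) ≤ (p i - 1) *
        (((Up A i l).card : ℝ) * (Ext B i l).card) := by
      rw [← he, h1]
      calc _ ≤ (p i : ℝ) * (At A i l).card * ((p i - 1) * (Ext B i l).card) := by gcongr
        _ = _ := by ring
    exact le_of_mul_le_mul_left this (by linarith)
  constructor
  · refine ⟨cross_up_ext h.1 i l, fun A' B' h' => ?_⟩
    have h5' : (Up A i l).card * (Ext B i l).card = A.card * B.card := by exact_mod_cast h5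
    rw [h5']; exact h.2 A' B' h'
  · apply Finset.eq_of_subset_of_card_le (ne_sub B i l)
    have h6 : (p i : ℝ) * (B.card - (At B i l).card) = (p i - 1) * (Ext B i l).card := by
      have : (p i : ℝ) * (At A i l).card * (p i * (B.card - (At B i l).card)) =
        (p i : ℝ) * (At A i l).card * ((p i - 1) * (Ext B i l).card) := by
        rw [he, ← h5, h1]; ring
      exact mul_left_cancel₀ (by positivity) this
    rw [← card_ne_ext] at h6
    have h7 := mul_left_cancel₀ (by linarith) h6
    have h2 : ((At B i l).card : ℝ) + (Ne B i l).card = B.card := by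
      exact_mod_cast card_at_add_ne B i l
    have : ((Ne (Ext B i l) i l).card : ℝ) ≤ (Ne B i l).card := by linarith
    exact_mod_cast this

lemma closed_of_eq {B : Finset (∀ i, Fin (p i))} {i : Fin n} (h3 : 3 ≤ p i)
    (h : ∀ l, Ne B i l = Ne (Ext B i l) i l) : Closed B i := by
  intro x hx v
  obtain ⟨l, hl⟩ : ∃ l : Fin (p i), l ∉ ({x i, v} : Finset (Fin (p i))) := by
    by_contra! hc
    have h1 : (univ : Finset (Fin (p i))).card ≤ ({x i, v} : Finset (Fin (p i))).card :=
      card_le_card fun l _ => hc l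
    have h2 := Finset.card_le_two (a := x i) (b := v)
    simp only [card_univ, Fintype.card_fin] at h1
    omega
  simp only [mem_insert, mem_singleton, not_or] at hl
  have : Function.update x i v ∈ Ne (Ext B i l) i l := by
    simp only [Ne, Ext, mem_filter, mem_univ, true_and, Function.update_idem, Function.update_self]
    exact ⟨⟨x i, fun e => hl.1 e.symm, by simpa using hx⟩, fun e => hl.2 e.symm⟩
  rw [← h] at this
  exact (mem_filter.mp this).1

lemma dich {P a b u v : ℝ} (hP : 3 ≤ P) (ha : 0 < a) (hb : 0 < b)
    (hu1 : u ≤ a) (hu0 : 0 ≤ u) (hv0 : 0 ≤ v) (hv1 : v ≤ b)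
    (h1 : P * u * (P * (b - v)) ≤ (P - 1) * (a * b))
    (h2 : P * v * (P * (a - u)) ≤ (P - 1) * (b * a)) :
    (P * u ≤ a ∧ P * v ≤ b) ∨ ((P - 1) * a ≤ P * u ∧ (P - 1) * b ≤ P * v) := by
  obtain ⟨s, rfl⟩ : ∃ s, u = s * a := ⟨u / a, by field_simp⟩
  obtain ⟨t, rfl⟩ : ∃ t, v = t * b := ⟨v / b, by field_simp⟩
  have hab : 0 < a * b := by positivity
  have h1' : P * s * (P * (1 - t)) ≤ P - 1 := by
    refine le_of_mul_le_mul_right ?_ hab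
    linarith
  have h2' : P * t * (P * (1 - s)) ≤ P - 1 := by
    refine le_of_mul_le_mul_right ?_ hab
    linarith
  have hs0 : 0 ≤ s := by by_contra! hc; nlinarith
  have ht0 : 0 ≤ t := by by_contra! hc; nlinarith
  have hs1 : s ≤ 1 := by by_contra! hc; nlinarith
  have ht1 : t ≤ 1 := by by_contra! hc; nlinarith
  suffices H : (P * s ≤ 1 ∧ P * t ≤ 1) ∨ (P - 1 ≤ P * s ∧ P - 1 ≤ P * t) by
    rcases H with ⟨H1, H2⟩ | ⟨H1, H2⟩
    · left; constructor <;> nlinarith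
    · right; constructor <;> nlinarith
  clear h1 h2 hu1 hu0 hv0 hv1
  have key : ∀ s t : ℝ, 0 ≤ s → 0 ≤ t → s ≤ 1 → t ≤ 1 → s ≤ t →
      P * t * (P * (1 - s)) ≤ P - 1 → 
      (P * s ≤ 1 ∧ P * t ≤ 1) ∨ (P - 1 ≤ P * s ∧ P - 1 ≤ P * t) := by
    intro s t hs0 ht0 hs1 ht1 hst h
    have e1 : (P * s - 1) * (P * s - (P - 1)) ≥ 0 := by
      have : P * s * (P * (1 - s)) ≤ P * t * (P * (1 - s)) := by
        have : 0 ≤ 1 - s := by linarith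
        gcongr
      nlinarith
    have e2 : (P * t - 1) * (P * t - (P - 1)) ≥ 0 := by
      have : P * t * (P * (1 - t)) ≤ P * t * (P * (1 - s)) := by
        gcongr
      nlinarith
    have hle : P * s ≤ P * t := by gcongr
    rcases le_or_gt (P * t) 1 with c | c
    · left; exact ⟨hle.trans c, c⟩
    have c2 : P - 1 ≤ P * t := by
      by_contra! hc; nlinarith
    rcases le_or_gt (P * s) 1 with d | d
    · exfalso
      have : (P - 1) * (P - 1) ≤ P * t * (P * (1 - s)) := by
        apply mul_le_mul c2 (by linarith) (by linarith) (by linarith)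
      nlinarith
    · right
      refine ⟨?_, c2⟩
      by_contra! hc; nlinarith
  rcases le_total s t with hst | hst
  · exact key s t hs0 ht0 hs1 ht1 hst h2'
  · have := key t s ht0 hs0 ht1 hs1 hst h1'
    tauto

lemma sum_at (A : Finset (∀ i, Fin (p i))) (i : Fin n) :
    ∑ l, ((At A i l).card : ℝ) = A.card := by
  have := Finset.card_eq_sum_card_fiberwise (f := fun x : (∀ i, Fin (p i)) => x i) (s := A)
    (t := univ) (by intro x _; simp)
  rw [this]; push_cast; rfl

lemma all_eq {P : ℕ} {a : ℝ} (hP : 0 < P) (f : Fin P → ℝ) (hs : ∑ l, f l = a)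
    (hf : ∀ l, P * f l ≤ a) : ∀ l, P * f l = a := by
  have : ∑ l, (P * f l) = ∑ l : Fin P, a := by
    rw [← Finset.mul_sum, hs]; simp
  have := (Finset.sum_eq_sum_iff_of_le (fun l _ => hf l)).1 this
  intro l; exact this l (mem_univ l)

lemma key_lemma {r : ℕ} {A B : Finset (∀ i, Fin (p i))} (h : MaxPair r A B)
    (i : Fin n) (h3 : 3 ≤ p i) (hA : 0 < A.card) (hB : 0 < B.card) :
    (Closed A i ∧ Closed B i) ∨ ∃ l, ((p i : ℝ) - 1) * A.card ≤ p i * (At A i l).card ∧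
      ((p i : ℝ) - 1) * B.card ≤ p i * (At B i l).card := by
  by_cases hex : ∃ l, ((p i : ℝ) - 1) * A.card ≤ p i * (At A i l).card ∧
      ((p i : ℝ) - 1) * B.card ≤ p i * (At B i l).card
  · exact Or.inr hex
  left
  have hP : (3 : ℝ) ≤ p i := by exact_mod_cast h3
  have hA' : (0 : ℝ) < A.card := by exact_mod_cast hA
  have hB' : (0 : ℝ) < B.card := by exact_mod_cast hB
  have hsm : ∀ l, (p i : ℝ) * (At A i l).card ≤ A.card ∧ (p i : ℝ) * (At B i l).card ≤ B.card := by
    intro l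
    have := dich hP hA' hB' (u := (At A i l).card) (v := (At B i l).card)
      (by exact_mod_cast card_le_card (filter_subset _ _)) (by positivity) (by positivity)
      (by exact_mod_cast card_le_card (filter_subset _ _))
      (main_ineq h i l h3) (main_ineq h.symm i l h3)
    rcases this with c | c
    · exact c
    · exact absurd ⟨l, c⟩ hex
  have eA := all_eq (by omega) _ (sum_at A i) (fun l => (hsm l).1)
  have eB := all_eq (by omega) _ (sum_at B i) (fun l => (hsm l).2)
  have pA : ∀ l, 0 < (At A i l).card := by
    intro l
    have := eA l
    rcases Nat.eq_zero_or_pos (At A i l).card with c | c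
    · rw [c] at this; simp at this; linarith
    · exact c
  have pB : ∀ l, 0 < (At B i l).card := by
    intro l
    have := eB l
    rcases Nat.eq_zero_or_pos (At B i l).card with c | c
    · rw [c] at this; simp at this; linarith
    · exact c
  constructor
  · refine closed_of_eq h3 fun l => (main_eq h.symm i l h3 (pB l) ?_).2
    rw [mul_sub, eA, eB]; ring
  · refine closed_of_eq h3 fun l => (main_eq h i l h3 (pA l) ?_).2
    rw [mul_sub, eA, eB]; ring

lemma eq_lemma {r : ℕ} {A B : Finset (∀ i, Fin (p i))} (h : MaxPair r A B)
    (i : Fin n) (l : Fin (p i)) (h3 : 3 ≤ p i) (hA : 0 < A.card)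
    (e1 : ((p i : ℝ) - 1) * A.card = p i * (At A i l).card)
    (e2 : ((p i : ℝ) - 1) * B.card = p i * (At B i l).card) :
    ∃ A' B' : Finset (∀ i, Fin (p i)), MaxPair r A' B' ∧ A.card < A'.card := by
  have hP : (3 : ℝ) ≤ p i := by exact_mod_cast h3
  have hA' : (0 : ℝ) < A.card := by exact_mod_cast hA
  refine ⟨_, _, (main_eq h i l h3 ?_ ?_).1, ?_⟩
  · rcases Nat.eq_zero_or_pos (At A i l).card with c | c
    · rw [c] at e1; simp at e1; rcases e1 with e1 | e1
      · linarith
      · subst e1; simp at hA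
    · exact c
  · rw [mul_sub, ← e1, ← e2]; ring
  · have : (A.card : ℝ) < (Up A i l).card := by
      rw [(basic_facts h i l).1, ← e1]; nlinarith
    exact_mod_cast this

/-- The subcube of vectors agreeing with `x₀` on `T`. -/
def Cube (T : Finset (Fin n)) (x₀ : ∀ i, Fin (p i)) : Finset (∀ i, Fin (p i)) :=
  univ.filter (fun x => ∀ i ∈ T, x i = x₀ i)

lemma card_cube (T : Finset (Fin n)) (x₀ : ∀ i, Fin (p i)) :
    (Cube T x₀).card = ∏ i ∈ Tᶜ, p i := by
  have : Cube T x₀ = Fintype.piFinset (fun i => if i ∈ T then {x₀ i} else univ) := by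
    ext x
    simp only [Cube, mem_filter, mem_univ, true_and, Fintype.mem_piFinset]
    refine forall_congr' fun i => ?_
    by_cases hi : i ∈ T <;> simp [hi]
  rw [this, Fintype.card_piFinset, ← Finset.prod_mul_prod_compl T]
  rw [Finset.prod_eq_one (s := T) (by intro i hi; simp [hi]), one_mul]
  refine Finset.prod_congr rfl fun i hi => ?_
  rw [mem_compl] at hi
  simp [hi]

lemma prod_compare (r : ℕ) (hrn : r ≤ n) (hmono : ∀ i j : Fin n, i ≤ j → p i ≤ p j)
    (R : Finset (Fin n)) (hR : R.card = r) :
    ∏ i ∈ Rᶜ, p i ≤ ∏ i ∈ univ.filter (fun i : Fin n => r ≤ (i : ℕ)), p i := by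
  set L := univ.filter (fun i : Fin n => r ≤ (i : ℕ)) with hL
  have hLc : L.card = n - r := by
    have h1 : (univ.filter (fun i : Fin n => (i : ℕ) < r)).card = r := by
      rw [Fin.card_filter_val_lt]; omega
    have h2 := Finset.card_filter_add_card_filter_not (s := (univ : Finset (Fin n)))
      (fun i : Fin n => (i : ℕ) < r)
    simp only [not_lt, card_univ, Fintype.card_fin] at h2
    rw [h1] at h2
    rw [hL]; omega
  have hRc : Rᶜ.card = n - r := by rw [card_compl, hR]; simp
  have hc : (Rᶜ \ L).card = (L \ Rᶜ).card := Finset.card_sdiff_comm (hRc.trans hLc.symm)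
  rw [← Finset.prod_inter_mul_prod_diff Rᶜ L p, ← Finset.prod_inter_mul_prod_diff L Rᶜ p,
    inter_comm L]
  refine Nat.mul_le_mul_left _ ?_
  set c := (Rᶜ \ L).sup p with hcdef
  calc ∏ i ∈ Rᶜ \ L, p i ≤ ∏ i ∈ Rᶜ \ L, c :=
        Finset.prod_le_prod' fun i hi => Finset.le_sup (f := p) hi
    _ = ∏ i ∈ L \ Rᶜ, c := by rw [prod_const, prod_const, hc]
    _ ≤ _ := by
      refine Finset.prod_le_prod' fun j hj => Finset.sup_le fun i hi => hmono i j ?_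
      simp only [hL, mem_sdiff, mem_filter, mem_univ, true_and, not_le] at hi hj
      exact Fin.le_def.2 (by omega)

lemma change_closed {A : Finset (∀ i, Fin (p i))} (U : Finset (Fin n))
    (hU : ∀ i ∈ U, Closed A i) (x : ∀ i, Fin (p i)) (hx : x ∈ A) (z : ∀ i, Fin (p i)) :
    (fun i => if i ∈ U then z i else x i) ∈ A := by
  induction U using Finset.induction_on with
  | empty => simpa using hx
  | insert a U ha ih =>
    have h1 := ih fun i hi => hU i (mem_insert_of_mem hi)
    have h2 := hU a (mem_insert_self _ _) _ h1 (z a)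
    convert h2 using 1
    funext i
    by_cases hi : i = a
    · subst hi; simp
    · simp [Function.update_of_ne hi, hi]

lemma agree_on {r : ℕ} {A B : Finset (∀ i, Fin (p i))} (h : CrossInt r A B)
    (hp : ∀ i, 2 ≤ p i) (T : Finset (Fin n)) (hT : ∀ i, i ∉ T → Closed A i)
    (hTr : T.card ≤ r) (x y : ∀ i, Fin (p i)) (hx : x ∈ A) (hy : y ∈ B) :
    T.card = r ∧ ∀ i ∈ T, x i = y i := by
  have hz : ∀ i, ∃ z : Fin (p i), z ≠ y i := fun i => by
    haveI : Nontrivial (Fin (p i)) := Fin.nontrivial_iff_two_le.2 (hp i)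
    exact exists_ne _
  choose z hz using hz
  have h1 := change_closed Tᶜ (fun i hi => hT i (mem_compl.1 hi)) x hx z
  have h2 := h _ h1 y hy
  have hsub : univ.filter (fun i => (if i ∈ Tᶜ then z i else x i) = y i) ⊆ T := by
    intro i hi
    by_contra hc
    simp [hc, hz] at hi
  have heq := Finset.eq_of_subset_of_card_le hsub (by omega)
  refine ⟨le_antisymm hTr (h2.trans (card_le_card hsub)), fun i hi => ?_⟩
  have h4 : i ∈ univ.filter (fun i => (if i ∈ Tᶜ then z i else x i) = y i) := by rw [heq]; exact hi
  simpa [hi] using h4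

lemma at_card_real (A : Finset (∀ i, Fin (p i))) (i : Fin n) (l : Fin (p i)) :
    ((At A i l).card : ℝ) + (Ne A i l).card = A.card := by
  exact_mod_cast card_at_add_ne A i l

/-- Union bound over `r+1` coordinates. -/
lemma union_bound {r : ℕ} (A : Finset (∀ i, Fin (p i))) (R : Finset (Fin n))
    (hR : R.card = r + 1) (l : ∀ i, Fin (p i)) (hpr : ∀ i, r + 2 ≤ p i)
    (hl : ∀ i ∈ R, ((p i : ℝ) - 1) * A.card ≤ p i * (At A i (l i)).card) (m : Fin n) (hm : m ∈ R) :
    A.card ≤ ∏ i ∈ (R.erase m)ᶜ, p i ∧ (A.card = ∏ i ∈ (R.erase m)ᶜ, p i →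
      ((p m : ℝ) - 1) * A.card = p m * (At A m (l m)).card) := by
  have hsub : A ⊆ Cube R l ∪ R.biUnion (fun i => Ne A i (l i)) := by
    intro x hx
    simp only [Cube, Ne, mem_union, mem_filter, mem_univ, true_and, mem_biUnion]
    by_cases h : ∀ i ∈ R, x i = l i
    · exact Or.inl h
    · push Not at h
      obtain ⟨i, hi, hne⟩ := h
      exact Or.inr ⟨i, hi, hx, hne⟩
  have h1 : A.card ≤ (Cube R l).card + ∑ i ∈ R, (Ne A i (l i)).card :=
    (card_le_card hsub).trans ((card_union_le _ _).trans (by gcongr; exact card_biUnion_le))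
  have hZ : ∏ i ∈ (R.erase m)ᶜ, p i = p m * (Cube R l).card := by
    rw [card_cube, Finset.compl_erase, Finset.prod_insert (by simpa using hm)]
  have hne : ∀ i ∈ R, (p i : ℝ) * (Ne A i (l i)).card ≤ A.card := by
    intro i hi
    have := hl i hi
    have h2 := at_card_real A i (l i)
    rw [← h2] at this ⊢
    linarith
  have hne2 : ∀ i ∈ R, (r + 2 : ℝ) * (Ne A i (l i)).card ≤ A.card := by
    intro i hi
    refine le_trans ?_ (hne i hi)
    gcongr
    exact_mod_cast hpr i
  have h1' : (A.card : ℝ) ≤ (Cube R l).card + ∑ i ∈ R, ((Ne A i (l i)).card : ℝ) := by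
    exact_mod_cast h1
  have hpm : (r + 2 : ℝ) ≤ p m := by exact_mod_cast hpr m
  have hsplit := Finset.add_sum_erase R (fun i => ((Ne A i (l i)).card : ℝ)) hm
  have hrest : (r + 2 : ℝ) * ∑ i ∈ R.erase m, ((Ne A i (l i)).card : ℝ) ≤ r * A.card := by
    rw [Finset.mul_sum]
    refine (Finset.sum_le_card_nsmul _ _ (A.card : ℝ)
      (fun i hi => hne2 i (mem_of_mem_erase hi))).trans ?_
    rw [card_erase_of_mem hm, hR]; simp
  have hrpos : (0 : ℝ) < r + 2 := by positivity
  have hmain : (A.card : ℝ) ≤ (r + 2) * (Cube R l).card +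
      ((r + 2) * (Ne A m (l m)).card - A.card) := by
    have := mul_le_mul_of_nonneg_left h1' hrpos.le
    simp only [← hsplit] at this
    linarith
  have hmm := hne m hm
  have hmm2 := hne2 m hm
  have hcube : (r + 2 : ℝ) * (Cube R l).card ≤ p m * (Cube R l).card := by gcongr
  rw [hZ]
  constructor
  · have : (A.card : ℝ) ≤ p m * (Cube R l).card := by linarith
    exact_mod_cast this
  · intro he
    have he' : (A.card : ℝ) = p m * (Cube R l).card := by exact_mod_cast he
    have h6 : (r + 2 : ℝ) * (Ne A m (l m)).card = A.card := by linarith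
    have h7 : (p m : ℝ) * (Ne A m (l m)).card = A.card := by
      refine le_antisymm hmm ?_
      rw [← h6]; gcongr
    have h2 := at_card_real A m (l m)
    have h8 : ((At A m (l m)).card : ℝ) = A.card - (Ne A m (l m)).card := by linarith
    rw [h8, mul_sub, h7]; ring

lemma big {r : ℕ} (hrn : r ≤ n) (hpr : ∀ i, r + 2 ≤ p i) (hr : 1 ≤ r)
    (hmono : ∀ i j : Fin n, i ≤ j → p i ≤ p j) (M : ℕ)
    (hM : M = ∏ i ∈ univ.filter (fun i : Fin n => r ≤ (i : ℕ)), p i)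
    {A B : Finset (∀ i, Fin (p i))} (h : MaxPair r A B) (hA : 0 < A.card) (hB : 0 < B.card) :
    A.card ≤ M ∧ B.card ≤ M ∧ (A.card = M → B.card = M →
      (A = B ∧ ∃ (T : Finset (Fin n)) (x₀ : ∀ i, Fin (p i)), T.card = r ∧ A = Cube T x₀) ∨
      ∃ A' B' : Finset (∀ i, Fin (p i)), MaxPair r A' B' ∧ A.card < A'.card) := by
  classical
  set T : Finset (Fin n) := univ.filter (fun i => ¬ (Closed A i ∧ Closed B i)) with hT
  have hTA : ∀ i, i ∉ T → Closed A i ∧ Closed B i := by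
    intro i hi
    by_contra hc
    exact hi (by simp only [hT, mem_filter, mem_univ, true_and]; exact hc)
  have hp2 : ∀ i, 2 ≤ p i := fun i => by have := hpr i; omega
  rcases le_or_gt T.card r with hc | hc
  · obtain ⟨x₀, hx₀⟩ := card_pos.1 hA
    obtain ⟨y₀, hy₀⟩ := card_pos.1 hB
    have hag := agree_on h.1 hp2 T (fun i hi => (hTA i hi).1) hc
    have hTr := (hag x₀ y₀ hx₀ hy₀).1
    have hBs : B ⊆ Cube T x₀ := by
      intro y hy
      simp only [Cube, mem_filter, mem_univ, true_and]
      intro i hi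
      exact ((hag x₀ y hx₀ hy).2 i hi).symm
    have hAs : A ⊆ Cube T x₀ := by
      intro x hx
      simp only [Cube, mem_filter, mem_univ, true_and]
      intro i hi
      rw [(hag x y₀ hx hy₀).2 i hi, (hag x₀ y₀ hx₀ hy₀).2 i hi]
    have hcub : (Cube T x₀).card ≤ M := by
      rw [card_cube, hM]; exact prod_compare r hrn hmono T hTr
    refine ⟨(card_le_card hAs).trans hcub, (card_le_card hBs).trans hcub, fun eA eB => Or.inl ?_⟩
    have e1 := Finset.eq_of_subset_of_card_le hAs (by omega)
    have e2 := Finset.eq_of_subset_of_card_le hBs (by omega)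
    exact ⟨e1.trans e2.symm, T, x₀, hTr, e1⟩
  · obtain ⟨R, hRT, hR⟩ := Finset.exists_subset_card_eq (show r + 1 ≤ T.card by omega)
    have hex : ∀ i, ∃ l : Fin (p i), i ∈ R →
        ((p i : ℝ) - 1) * A.card ≤ p i * (At A i l).card ∧
        ((p i : ℝ) - 1) * B.card ≤ p i * (At B i l).card := by
      intro i
      by_cases hi : i ∈ R
      · rcases key_lemma h i (by have := hpr i; omega) hA hB with k | ⟨l, hl⟩
        · have := hRT hi
          simp only [hT, mem_filter, mem_univ, true_and] at this
          exact absurd k this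
        · exact ⟨l, fun _ => hl⟩
      · exact ⟨⟨0, by have := hpr i; omega⟩, fun h => absurd h hi⟩
    choose l hl using hex
    obtain ⟨m, hm⟩ : R.Nonempty := card_pos.1 (by omega)
    have uA := union_bound A R hR l hpr (fun i hi => (hl i hi).1) m hm
    have uB := union_bound B R hR l hpr (fun i hi => (hl i hi).2) m hm
    have hcmp : ∏ i ∈ (R.erase m)ᶜ, p i ≤ M := by
      rw [hM]; exact prod_compare r hrn hmono _ (by rw [card_erase_of_mem hm, hR]; rfl)
    refine ⟨uA.1.trans hcmp, uB.1.trans hcmp, fun eA eB => Or.inr ?_⟩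
    exact eq_lemma h m (l m) (by have := hpr m; omega) hA
      (uA.2 (le_antisymm uA.1 (by omega))) (uB.2 (le_antisymm uB.1 (by omega)))

lemma exists_max (r : ℕ) : ∃ A B : Finset (∀ i, Fin (p i)), MaxPair r A B := by
  classical
  obtain ⟨⟨A, B⟩, hm, hmax⟩ := Finset.exists_max_image
    (univ.filter (fun z : Finset (∀ i, Fin (p i)) × Finset (∀ i, Fin (p i)) =>
      CrossInt r z.1 z.2)) (fun z => z.1.card * z.2.card)
      ⟨(∅, ∅), mem_filter.2 ⟨mem_univ _, fun x hx => absurd hx (notMem_empty x)⟩⟩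
  simp only [mem_filter, mem_univ, true_and] at hm hmax
  exact ⟨A, B, hm, fun A' B' h' => hmax (A', B') h'⟩

lemma cross_cube (T : Finset (Fin n)) (x₀ : ∀ i, Fin (p i)) :
    CrossInt T.card (Cube T x₀) (Cube T x₀) := by
  intro x hx y hy
  simp only [Cube, mem_filter, mem_univ, true_and] at hx hy
  refine card_le_card fun i hi => ?_
  simp [hx i hi, hy i hi]

end CI

/-- Theorem 7, part 1: let `1 ≤ r ≤ n`, let `p` be a size vector with
`p_1 ≤ ⋯ ≤ p_n` and `p_1 > r + 1`, and let `A, B ⊆ S_p` be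
`r`-cross-intersecting. Then `|A|·|B| ≤ ∏_{i=r+1}^n p_i²`, and in case of
equality `A = B` and this family is obtained by fixing `r` coordinates. -/
theorem theorem7_part1 {n : ℕ} (r : ℕ) (hr : 1 ≤ r) (hrn : r ≤ n)
    (hn : 0 < n)
    (p : Fin n → ℕ) (hp : ∀ i, 2 ≤ p i)
    (hmono : ∀ i j : Fin n, i ≤ j → p i ≤ p j)
    (hp1 : r + 1 < p ⟨0, hn⟩)
    (A B : Finset (∀ i, Fin (p i))) (hAB : CrossInt r A B) :
    A.card * B.card ≤ (∏ i ∈ univ.filter (fun i : Fin n => r ≤ (i : ℕ)), p i) ^ 2 ∧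
    (A.card * B.card = (∏ i ∈ univ.filter (fun i : Fin n => r ≤ (i : ℕ)), p i) ^ 2 →
      A = B ∧ ∃ (T : Finset (Fin n)) (x₀ : ∀ i, Fin (p i)),
        T.card = r ∧ A = univ.filter (fun x => ∀ i ∈ T, x i = x₀ i)) := by
  classical
  have hpr : ∀ i, r + 2 ≤ p i := fun i => by
    have := hmono ⟨0, hn⟩ i (Fin.le_def.2 (Nat.zero_le _))
    omega
  obtain ⟨M, hM⟩ : ∃ M, M = ∏ i ∈ univ.filter (fun i : Fin n => r ≤ (i : ℕ)), p i := ⟨_, rfl⟩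
  rw [← hM]
  have hMpos : 0 < M := by
    rw [hM]; exact Finset.prod_pos fun i _ => by have := hp i; omega
  have hcubeex : ∃ C : Finset (∀ i, Fin (p i)), CrossInt r C C ∧ C.card = M := by
    have hLc : (univ.filter (fun i : Fin n => (i : ℕ) < r)).card = r := by
      rw [Fin.card_filter_val_lt]; omega
    refine ⟨CI.Cube (univ.filter (fun i : Fin n => (i : ℕ) < r))
      (fun i => ⟨0, by have := hp i; omega⟩), ?_, ?_⟩
    · have := CI.cross_cube (univ.filter (fun i : Fin n => (i : ℕ) < r))
        (fun i => (⟨0, by have := hp i; omega⟩ : Fin (p i)))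
      rwa [hLc] at this
    · rw [CI.card_cube, hM]
      congr 1
      ext i; simp
  obtain ⟨C, hC, hCM⟩ := hcubeex
  have hall : ∀ A B : Finset (∀ i, Fin (p i)), CI.MaxPair r A B → A.card = M ∧ B.card = M ∧
      0 < A.card ∧ 0 < B.card := by
    intro A B h
    have h1 := h.2 C C hC
    rw [hCM] at h1
    have h2 : 0 < A.card * B.card := lt_of_lt_of_le (Nat.mul_pos hMpos hMpos) h1
    have hA : 0 < A.card := Nat.pos_of_mul_pos_right h2
    have hB : 0 < B.card := Nat.pos_of_mul_pos_left h2
    obtain ⟨b1, b2, -⟩ := CI.big hrn hpr hr hmono M hM h hA hB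
    refine ⟨?_, ?_, hA, hB⟩ <;> nlinarith
  obtain ⟨A₀, B₀, h₀⟩ := CI.exists_max (p := p) r
  obtain ⟨eA, eB, -, -⟩ := hall A₀ B₀ h₀
  have hle : ∀ A' B' : Finset (∀ i, Fin (p i)), CrossInt r A' B' → A'.card * B'.card ≤ M ^ 2 := by
    intro A' B' h'
    have := h₀.2 A' B' h'
    rwa [eA, eB, ← sq] at this
  refine ⟨hle A B hAB, fun he => ?_⟩
  have hmax : CI.MaxPair r A B := ⟨hAB, fun A' B' h' => by rw [he]; exact hle A' B' h'⟩
  obtain ⟨cA, cB, hA, hB⟩ := hall A B hmax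
  rcases (CI.big hrn hpr hr hmono M hM hmax hA hB).2.2 cA cB with h | ⟨A', B', h', hlt⟩
  · exact h
  · have := (hall A' B' h').1
    omega
end

section
/- Let 1 ≤ r ≤ n, let p = (p_1,…,p_n) be a size vector with p_1 ≤ p_2 ≤ … ≤ p_n and p_1 = r + 1 > 4, and let A, B ⊆ S_p be r-cross-intersecting families. Then |A|·|B| ≤ Π_{i=r+1}^{n} p_i². Moreover, if equality holds, then A = B, and either A is a Hamming ball of radius 0 in some set of r coordinates, or A is a Hamming ball of radius 1 in some set T of r + 2 coordinates with p_i = r + 1 for every i ∈ T. -/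
open Finset

/-- The Hamming ball of radius `k` around `x₀` in the coordinates `T`. -/
def hBall {n : ℕ} {p : Fin n → ℕ} (T : Finset (Fin n))
    (x₀ : ∀ i, Fin (p i)) (k : ℕ) : Finset (∀ i, Fin (p i)) :=
  univ.filter (fun x => (T.filter (fun i => x i ≠ x₀ i)).card ≤ k)

namespace T7

open Function

variable {n : ℕ} {p : Fin n → ℕ}

def MaxPair (r : ℕ) (A B : Finset (∀ i, Fin (p i))) : Prop :=
  CrossInt r A B ∧ (∀ A' B' : Finset (∀ i, Fin (p i)), CrossInt r A' B' →
    A'.card * B'.card ≤ A.card * B.card) ∧ 0 < A.card ∧ 0 < B.card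

def Irrel (A : Finset (∀ i, Fin (p i))) (i : Fin n) : Prop :=
  ∀ x ∈ A, ∀ v, update x i v ∈ A

def fib (A : Finset (∀ i, Fin (p i))) (i : Fin n) (x : ∀ i, Fin (p i)) :
    Finset (Fin (p i)) := univ.filter (fun v => update x i v ∈ A)

def up (A : Finset (∀ i, Fin (p i))) (i : Fin n) (I : Finset (Fin (p i))) :
    Finset (∀ i, Fin (p i)) := univ.filter (fun x => ∃ v ∈ I, update x i v ∈ A)

theorem CrossInt.symm' {r : ℕ} {A B : Finset (∀ i, Fin (p i))} (h : CrossInt r A B) :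
    CrossInt r B A := by
  intro x hx y hy
  have := h y hy x hx
  simpa [eq_comm] using this

theorem MaxPair.symm {r : ℕ} {A B : Finset (∀ i, Fin (p i))} (h : MaxPair r A B) :
    MaxPair r B A := by
  obtain ⟨h1, h2, h3, h4⟩ := h
  refine ⟨CrossInt.symm' h1, ?_, h4, h3⟩
  intro A' B' h'
  have := h2 B' A' (CrossInt.symm' h')
  rw [mul_comm, mul_comm B.card]
  exact this

theorem MaxPair.closed {r : ℕ} {A B : Finset (∀ i, Fin (p i))} (h : MaxPair r A B)
    (x : ∀ i, Fin (p i))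
    (hx : ∀ y ∈ B, r ≤ (univ.filter (fun i => x i = y i)).card) : x ∈ A := by
  obtain ⟨h1, h2, h3, h4⟩ := h
  by_contra hxA
  have := h2 (insert x A) B (by
    intro z hz y hy
    rcases Finset.mem_insert.1 hz with rfl | hz
    · exact hx y hy
    · exact h1 z hz y hy)
  rw [Finset.card_insert_of_notMem hxA] at this
  nlinarith

theorem exists_ne_fin {m : ℕ} (hm : 2 ≤ m) (a : Fin m) : ∃ b : Fin m, b ≠ a := by
  have : Nontrivial (Fin m) := Fin.nontrivial_iff_two_le.2 hm
  exact exists_ne a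

theorem Irrel.other {r : ℕ} {A B : Finset (∀ i, Fin (p i))} (h : MaxPair r A B)
    (hp : ∀ i, 2 ≤ p i) {i : Fin n} (hi : Irrel A i) : Irrel B i := by
  intro y hy v
  apply h.symm.closed
  intro x hx
  obtain ⟨w, hw⟩ := exists_ne_fin (hp i) (y i)
  refine (h.1 _ (hi x hx w) y hy).trans (Finset.card_le_card ?_)
  intro j
  simp only [Finset.mem_filter, Finset.mem_univ, true_and]
  by_cases hj : j = i
  · subst hj; simp [hw]
  · simp [hj, eq_comm]

theorem fib_cases {r : ℕ} {A B : Finset (∀ i, Fin (p i))} (h : MaxPair r A B)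
    (i : Fin n) (x : ∀ i, Fin (p i)) : fib A i x = univ ∨ (fib A i x).card ≤ 1 := by
  by_cases h1 : (fib A i x).card ≤ 1
  · exact Or.inr h1
  left
  obtain ⟨a, ha, b, hb, hab⟩ := Finset.one_lt_card.1 (not_le.1 h1)
  simp only [fib, Finset.mem_filter, Finset.mem_univ, true_and] at ha hb
  ext v
  simp only [fib, Finset.mem_filter, Finset.mem_univ, true_and, iff_true]
  apply h.closed
  intro y hy
  have key : ∀ a, update x i a ∈ A → a ≠ y i →
      r ≤ (univ.filter (fun j => update x i v j = y j)).card := by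
    intro a ha hne
    refine (h.1 _ ha y hy).trans (Finset.card_le_card ?_)
    intro j
    simp only [Finset.mem_filter, Finset.mem_univ, true_and]
    by_cases hj : j = i
    · subst hj; simp [hne]
    · simp [hj]
  by_cases hay : a = y i
  · exact key b hb (fun h => hab (hay.trans h.symm))
  · exact key a ha hay

theorem sum_update (i : Fin n) (F : (∀ i, Fin (p i)) → ℕ) :
    ∑ x, ∑ v, F (update x i v) = p i * ∑ x, F x := by
  rw [← Fintype.sum_prod_type']
  have : ∑ z : (∀ i, Fin (p i)) × Fin (p i), F (update z.1 i z.2)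
      = ∑ z : (∀ i, Fin (p i)) × Fin (p i), F z.1 := by
    refine Finset.sum_nbij' (fun z => (update z.1 i z.2, z.1 i))
      (fun z => (update z.1 i z.2, z.1 i)) ?_ ?_ ?_ ?_ ?_ <;> simp
  rw [this, Fintype.sum_prod_type]
  simp [Finset.mul_sum]

theorem sum_fib (A : Finset (∀ i, Fin (p i))) (i : Fin n) :
    ∑ x, (fib A i x).card = p i * A.card := by
  have := sum_update i (fun x => if x ∈ A then 1 else 0)
  simp only [fib, Finset.card_filter]
  rw [this]
  simp

theorem card_up (A : Finset (∀ i, Fin (p i))) (i : Fin n) (I : Finset (Fin (p i))) :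
    (up A i I).card = ∑ x, if (fib A i x ∩ I).Nonempty then 1 else 0 := by
  rw [up, Finset.card_filter]
  refine Finset.sum_congr rfl ?_
  intro x _
  congr 1
  simp [Finset.Nonempty, fib, and_comm]

theorem up_cross {r : ℕ} {A B : Finset (∀ i, Fin (p i))} (h : CrossInt r A B)
    (i : Fin n) (I : Finset (Fin (p i))) : CrossInt r (up A i I) (up B i Iᶜ) := by
  intro x hx y hy
  simp only [up, Finset.mem_filter, Finset.mem_univ, true_and, Finset.mem_compl] at hx hy
  obtain ⟨a, ha, hxa⟩ := hx
  obtain ⟨b, hb, hyb⟩ := hy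
  refine (h _ hxa _ hyb).trans (Finset.card_le_card ?_)
  intro j
  simp only [Finset.mem_filter, Finset.mem_univ, true_and]
  by_cases hj : j = i
  · subst hj
    simp only [update_self]
    rintro rfl
    exact absurd ha hb
  · simp [hj]

theorem up_two {r : ℕ} {A B : Finset (∀ i, Fin (p i))} (h : MaxPair r A B)
    (i : Fin n) (hp : 3 ≤ p i) (hi : ¬ Irrel A i) (I : Finset (Fin (p i)))
    (hI2 : I.Nonempty) (hI3 : Iᶜ.Nonempty) :
    2 * A.card < (up A i I).card + (up A i Iᶜ).card := by
  have : p i * (2 * A.card) < p i * ((up A i I).card + (up A i Iᶜ).card) := by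
    rw [mul_left_comm, ← sum_fib, card_up, card_up, ← Finset.sum_add_distrib,
      Finset.mul_sum, Finset.mul_sum]
    have key : ∀ x, (fib A i x).card ≤ 1 → 
      ((fib A i x).card = 0 ∨ 1 ≤ ((if (fib A i x ∩ I).Nonempty then 1 else 0)
        + (if (fib A i x ∩ Iᶜ).Nonempty then 1 else 0))) := by
      intro x hx
      rcases Finset.eq_empty_or_nonempty (fib A i x) with h0 | ⟨v, hv⟩
      · simp [h0]
      · right
        by_cases hvI : v ∈ I
        · have : (fib A i x ∩ I).Nonempty := ⟨v, by simp [hv, hvI]⟩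
          simp [this]
        · have : (fib A i x ∩ Iᶜ).Nonempty := ⟨v, by simp [hv, hvI]⟩
          simp [this]
    apply Finset.sum_lt_sum
    · intro x _
      rcases fib_cases h i x with h1 | h1
      · simp [h1, hI2, hI3, mul_comm]
      · rcases key x h1 with h2 | h2
        · simp [h2]
        · nlinarith
    · simp only [Irrel, not_forall] at hi
      obtain ⟨x, hx, v, hv⟩ := hi
      refine ⟨x, Finset.mem_univ _, ?_⟩
      rcases fib_cases h i x with h1 | h1
      · have : v ∈ fib A i x := by rw [h1]; simp
        simp [fib] at this
        exact absurd this hv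
      · rcases key x h1 with h2 | h2
        · have : x i ∈ fib A i x := by simp [fib, hx]
          simp at h2
          rw [h2] at this
          simp at this
        · nlinarith
  exact lt_of_mul_lt_mul_left this (Nat.zero_le _)

theorem up_three {r : ℕ} {A B : Finset (∀ i, Fin (p i))} (h : MaxPair r A B)
    (i : Fin n) (hp : 3 ≤ p i) (I J K : Finset (Fin (p i)))
    (hU : I ∪ J ∪ K = univ) (hI : I.Nonempty) (hJ : J.Nonempty) (hK : K.Nonempty) :
    3 * A.card ≤ (up A i I).card + (up A i J).card + (up A i K).card := by
  have : p i * (3 * A.card) ≤ p i * ((up A i I).card + (up A i J).card + (up A i K).card) := by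
    rw [mul_left_comm, ← sum_fib, card_up, card_up, card_up, ← Finset.sum_add_distrib,
      ← Finset.sum_add_distrib, Finset.mul_sum, Finset.mul_sum]
    apply Finset.sum_le_sum
    intro x _
    rcases fib_cases h i x with h1 | h1
    · simp [h1, hI, hJ, hK, mul_comm]
    · rcases Finset.eq_empty_or_nonempty (fib A i x) with h0 | ⟨v, hv⟩
      · simp [h0]
      · have hv' : v ∈ I ∪ J ∪ K := by rw [hU]; simp
        simp only [Finset.mem_union] at hv'
        have : 1 ≤ (if (fib A i x ∩ I).Nonempty then 1 else 0)
           + (if (fib A i x ∩ J).Nonempty then 1 else 0)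
           + (if (fib A i x ∩ K).Nonempty then 1 else 0) := by
          rcases hv' with (hv' | hv') | hv'
          · have : (fib A i x ∩ I).Nonempty := ⟨v, by simp [hv, hv']⟩
            simp [this]; omega
          · have : (fib A i x ∩ J).Nonempty := ⟨v, by simp [hv, hv']⟩
            simp [this]; omega
          · have : (fib A i x ∩ K).Nonempty := ⟨v, by simp [hv, hv']⟩
            simp [this]
        nlinarith
  exact le_of_mul_le_mul_left this (by omega)

theorem up_one (A : Finset (∀ i, Fin (p i)))
    (i : Fin n) (l : Fin (p i)) :
    p i * A.card ≤ (up A i {l}).card + (p i - 1) * (up A i {l}ᶜ).card := by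
  rw [← sum_fib, card_up, card_up, Finset.mul_sum, ← Finset.sum_add_distrib]
  apply Finset.sum_le_sum
  intro x _
  have h1 : (fib A i x).card = (fib A i x ∩ {l}).card + (fib A i x ∩ {l}ᶜ).card := by
    rw [← Finset.sdiff_eq_inter_compl, Finset.card_inter_add_card_sdiff]
  have h2 : (fib A i x ∩ {l}).card ≤ if (fib A i x ∩ {l}).Nonempty then 1 else 0 := by
    split_ifs with h
    · exact (Finset.card_le_card Finset.inter_subset_right).trans (by simp)
    · simpa [Finset.not_nonempty_iff_eq_empty] using h
  have h3 : (fib A i x ∩ {l}ᶜ).card ≤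
      (p i - 1) * if (fib A i x ∩ {l}ᶜ).Nonempty then 1 else 0 := by
    split_ifs with h
    · exact (Finset.card_le_card Finset.inter_subset_right).trans (by simp [Finset.card_compl])
    · simpa [Finset.not_nonempty_iff_eq_empty] using h
  omega

theorem off_le (A : Finset (∀ i, Fin (p i)))
    (i : Fin n) (l : Fin (p i)) :
    p i * (A.filter (fun x => x i ≠ l)).card ≤ (p i - 1) * (up A i {l}ᶜ).card := by
  have := sum_update i (fun x => if x ∈ A ∧ x i ≠ l then 1 else 0)
  have e : (A.filter (fun x => x i ≠ l)).card = ∑ x, if x ∈ A ∧ x i ≠ l then 1 else 0 := by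
    rw [← Finset.card_filter]
    congr 1
    ext x; simp
  rw [e, ← this, card_up, Finset.mul_sum]
  apply Finset.sum_le_sum
  intro x _
  rw [← Finset.card_filter]
  have h0 : (univ.filter (fun v => update x i v ∈ A ∧ update x i v i ≠ l))
      = fib A i x ∩ {l}ᶜ := by
    ext v; simp [fib]
  rw [h0]
  split_ifs with h
  · exact (Finset.card_le_card Finset.inter_subset_right).trans (by simp [Finset.card_compl])
  · simpa [Finset.not_nonempty_iff_eq_empty] using h

theorem arith_conc (p N M F G : ℝ) (hp : 3 ≤ p) (hN : 0 < N) (hM : 0 < M) (hF : F < N)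
    (hG : G < M) (hF0 : 0 ≤ F) (hG0 : 0 ≤ G) (h1 : (p * N - (p - 1) * F) * G ≤ N * M)
    (h2 : F * (p * M - (p - 1) * G) ≤ N * M) : (p - 1) * F ≤ N := by
  obtain ⟨a, rfl⟩ : ∃ a, F = a * N := ⟨F / N, by field_simp⟩
  obtain ⟨b, rfl⟩ : ∃ b, G = b * M := ⟨G / M, by field_simp⟩
  have ha : a < 1 := by nlinarith
  have hb : b < 1 := by nlinarith
  have ha0 : 0 ≤ a := by by_contra hh; nlinarith
  have hb0 : 0 ≤ b := by by_contra hh; nlinarith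
  have hNM : 0 < N * M := mul_pos hN hM
  have h1' : (p - (p - 1) * a) * b ≤ 1 := by
    by_contra hh
    have := mul_lt_mul_of_pos_right (not_le.1 hh) hNM
    nlinarith
  have h2' : a * (p - (p - 1) * b) ≤ 1 := by
    by_contra hh
    have := mul_lt_mul_of_pos_right (not_le.1 hh) hNM
    nlinarith
  suffices (p - 1) * a ≤ 1 by nlinarith
  by_contra hh
  push Not at hh
  by_cases hab : b ≤ a
  · have : ((p - 1) * a - 1) * (1 - a) > 0 := mul_pos (by linarith) (by linarith)
    have h3 : (p - 1) * a * b ≤ (p - 1) * a * a := by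
      apply mul_le_mul_of_nonneg_left hab
      nlinarith
    nlinarith
  · push Not at hab
    have hb' : (p - 1) * b > 1 := by nlinarith
    have : ((p - 1) * b - 1) * (1 - b) > 0 := mul_pos (by linarith) (by linarith)
    have h3 : (p - 1) * b * a ≤ (p - 1) * b * b := by
      apply mul_le_mul_of_nonneg_left hab.le
      nlinarith
    nlinarith

theorem up_empty (A : Finset (∀ i, Fin (p i))) (i : Fin n) : up A i ∅ = ∅ := by
  simp [up]

theorem conc {r : ℕ} {A B : Finset (∀ i, Fin (p i))} (h : MaxPair r A B)
    (hp2 : ∀ i, 2 ≤ p i) (i : Fin n) (hp : 3 ≤ p i) (hi : ¬ Irrel A i) :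
    ∃ l : Fin (p i), p i * (A.filter (fun x => x i ≠ l)).card ≤ A.card ∧
      p i * (B.filter (fun x => x i ≠ l)).card ≤ B.card := by
  have hiB : ¬ Irrel B i := fun hh => hi (Irrel.other h.symm hp2 hh)
  have hN := h.2.2.1
  have hM := h.2.2.2
  have hd : ∀ I : Finset (Fin (p i)), (up A i I).card * (up B i Iᶜ).card ≤ A.card * B.card :=
    fun I => h.2.1 _ _ (up_cross h.1 i I)
  -- consequences of being big
  have hbig : ∀ I : Finset (Fin (p i)), I.Nonempty → Iᶜ.Nonempty → A.card < (up A i I).card →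
      (up B i Iᶜ).card < B.card ∧ (up A i Iᶜ).card < A.card := by
    intro I h1 h2 h3
    have h4 : (up B i Iᶜ).card < B.card := by
      by_contra hh
      have := hd I
      nlinarith
    refine ⟨h4, ?_⟩
    have h5 := up_two h.symm i hp hiB I h1 h2
    have h6 := hd Iᶜ
    rw [compl_compl] at h6
    by_contra hh
    nlinarith
  have hU : A.card < (up A i univ).card := by
    have : p i * A.card < p i * (up A i univ).card := by
      rw [← sum_fib, card_up, Finset.mul_sum]
      apply Finset.sum_lt_sum
      · intro x _
        rcases Finset.eq_empty_or_nonempty (fib A i x) with h0 | h0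
        · simp [h0]
        · simp only [Finset.inter_univ, h0, if_true, mul_one]
          exact (Finset.card_le_univ _).trans (by simp)
      · simp only [Irrel, not_forall] at hi
        obtain ⟨x, hx, v, hv⟩ := hi
        refine ⟨x, Finset.mem_univ _, ?_⟩
        have hne : (fib A i x).Nonempty := ⟨x i, by simp [fib, hx]⟩
        simp only [Finset.inter_univ, hne, if_true, mul_one]
        rcases fib_cases h i x with h1 | h1
        · have : v ∈ fib A i x := by rw [h1]; simp
          simp [fib] at this
          exact absurd this hv
        · omega
    exact lt_of_mul_lt_mul_left this (Nat.zero_le _)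
  obtain ⟨I, hI, hmin⟩ := Finset.exists_min_image
    (univ.filter (fun I : Finset (Fin (p i)) => A.card < (up A i I).card))
    Finset.card ⟨univ, by simp [hU]⟩
  simp only [Finset.mem_filter, Finset.mem_univ, true_and] at hI hmin
  have hIne : I.Nonempty := by
    rw [Finset.nonempty_iff_ne_empty]
    rintro rfl
    rw [up_empty] at hI
    simp at hI
  obtain ⟨l, hl⟩ := hIne
  have hsing : I = {l} := by
    by_contra hne
    have hne2 : (I.erase l).Nonempty := by
      rw [Finset.nonempty_iff_ne_empty]
      intro h0
      rw [Finset.erase_eq_empty_iff] at h0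
      rcases h0 with h0 | h0
      · simp [h0] at hl
      · exact hne h0
    have hc2 : 0 < (I.erase l).card := Finset.card_pos.2 hne2
    have hce := Finset.card_erase_of_mem hl
    have s1 : (up A i {l}).card ≤ A.card := by
      by_contra hh
      have := hmin {l} (not_le.1 hh)
      simp at this
      omega
    have s2 : (up A i (I.erase l)).card ≤ A.card := by
      by_contra hh
      have := hmin (I.erase l) (not_le.1 hh)
      omega
    have s3' : Iᶜ.Nonempty := by
      by_contra h0
      rw [Finset.not_nonempty_iff_eq_empty, Finset.compl_eq_empty_iff] at h0
      -- split off two singletons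
      obtain ⟨m, hm⟩ := hne2
      have hml : m ≠ l := Finset.ne_of_mem_erase hm
      have c3 : ((univ : Finset (Fin (p i))).erase l).card = p i - 1 := by simp
      have c4 : (((univ : Finset (Fin (p i))).erase l).erase m).card = p i - 2 := by
        rw [Finset.card_erase_of_mem (by simp [hml])]; simp; omega
      have t1 : (up A i {m}).card ≤ A.card := by
        by_contra hh
        have := hmin {m} (not_le.1 hh)
        rw [h0] at this
        simp at this
        omega
      have t2 : (up A i {l}ᶜ).card ≤ A.card := by
        by_contra hh
        have := hmin {l}ᶜ (not_le.1 hh)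
        rw [h0] at this
        simp [Finset.card_compl] at this
        omega
      have := up_two h i hp hi {l} ⟨l, by simp⟩ ⟨m, by simp [hml]⟩
      omega
    have s3 := (hbig I ⟨l, hl⟩ s3' hI).2
    have := up_three h i hp {l} (I.erase l) Iᶜ (by
      ext v; by_cases v = l <;> by_cases v ∈ I <;> simp_all) (by simp) hne2 s3'
    omega
  subst hsing
  obtain ⟨m, hm⟩ := exists_ne_fin (hp2 i) l
  obtain ⟨hG, hF⟩ := hbig {l} ⟨l, by simp⟩ ⟨m, by simp [hm]⟩ hI
  have d1 := hd {l}
  have d2 := hd {l}ᶜ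
  rw [compl_compl] at d2
  have u1 := up_one A i l
  have u2 := up_one B i l
  have o1 := off_le A i l
  have o2 := off_le B i l
  have hpc : ((p i - 1 : ℕ) : ℝ) = (p i : ℝ) - 1 := by
    rw [Nat.cast_sub (by omega)]; simp
  have hp' : (3 : ℝ) ≤ p i := by exact_mod_cast hp
  have u1' : (p i : ℝ) * A.card ≤ (up A i {l}).card + ((p i : ℝ) - 1) * (up A i {l}ᶜ).card := by
    rw [← hpc]; exact_mod_cast u1
  have u2' : (p i : ℝ) * B.card ≤ (up B i {l}).card + ((p i : ℝ) - 1) * (up B i {l}ᶜ).card := by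
    rw [← hpc]; exact_mod_cast u2
  have d1' : ((up A i {l}).card : ℝ) * (up B i {l}ᶜ).card ≤ A.card * B.card := by
    exact_mod_cast d1
  have d2' : ((up A i {l}ᶜ).card : ℝ) * (up B i {l}).card ≤ A.card * B.card := by
    exact_mod_cast d2
  have hN' : (0 : ℝ) < A.card := by exact_mod_cast hN
  have hM' : (0 : ℝ) < B.card := by exact_mod_cast hM
  have hF' : ((up A i {l}ᶜ).card : ℝ) < A.card := by exact_mod_cast hF
  have hG' : ((up B i {l}ᶜ).card : ℝ) < B.card := by exact_mod_cast hG
  have hF0 : (0 : ℝ) ≤ (up A i {l}ᶜ).card := by positivity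
  have hG0 : (0 : ℝ) ≤ (up B i {l}ᶜ).card := by positivity
  have e1 : ((p i : ℝ) * A.card - (p i - 1) * (up A i {l}ᶜ).card) * (up B i {l}ᶜ).card
      ≤ A.card * B.card :=
    (mul_le_mul_of_nonneg_right (by linarith) hG0).trans d1'
  have e2 : ((up A i {l}ᶜ).card : ℝ) * ((p i : ℝ) * B.card - (p i - 1) * (up B i {l}ᶜ).card)
      ≤ A.card * B.card :=
    (mul_le_mul_of_nonneg_left (by linarith) hF0).trans d2'
  have r1 := arith_conc _ _ _ _ _ hp' hN' hM' hF' hG' hF0 hG0 e1 e2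
  have r2 := arith_conc _ _ _ _ _ hp' hM' hN' hG' hF' hG0 hF0
    (by rw [mul_comm]; linarith) (by rw [mul_comm]; linarith)
  refine ⟨l, ?_, ?_⟩
  · refine o1.trans ?_
    rw [← hpc] at r1
    exact_mod_cast r1
  · refine o2.trans ?_
    rw [← hpc] at r2
    exact_mod_cast r2

theorem card_ball0 (T : Finset (Fin n)) (c : ∀ i, Fin (p i)) :
    (hBall T c 0).card = ∏ i ∈ Tᶜ, p i := by
  have : hBall T c 0 = Fintype.piFinset (fun i => if i ∈ T then {c i} else univ) := by
    ext x
    simp only [hBall, Finset.mem_filter, Finset.mem_univ, true_and, Fintype.mem_piFinset,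
      Nat.le_zero, Finset.card_eq_zero, Finset.filter_eq_empty_iff]
    constructor
    · intro h i
      by_cases hi : i ∈ T
      · simpa [hi] using h hi
      · simp [hi]
    · intro h i hi
      simpa [hi] using h i
  rw [this, Fintype.card_piFinset, ← Finset.prod_mul_prod_compl T]
  rw [Finset.prod_eq_one (s := T), one_mul]
  · apply Finset.prod_congr rfl
    intro i hi
    simp [Finset.mem_compl.1 hi]
  · intro i hi
    simp [hi]

theorem card_ball1 (T : Finset (Fin n)) (c : ∀ i, Fin (p i)) :
    (hBall T c 1).card ≤ (∏ i ∈ Tᶜ, p i) * (1 + ∑ i ∈ T, (p i - 1)) := by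
  classical
  have hsub : hBall T c 1 ⊆ hBall T c 0 ∪ T.biUnion (fun j => Fintype.piFinset
      (fun i => if i = j then {c i}ᶜ else if i ∈ T then {c i} else univ)) := by
    intro x hx
    simp only [hBall, Finset.mem_filter, Finset.mem_univ, true_and, Finset.mem_union,
      Finset.mem_biUnion, Fintype.mem_piFinset] at hx ⊢
    rcases Nat.le_one_iff_eq_zero_or_eq_one.1 hx with h | h
    · left; omega
    · right
      obtain ⟨j, hj⟩ := Finset.card_eq_one.1 h
      have hj' : ∀ i, (i ∈ T ∧ x i ≠ c i) ↔ i = j := by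
        intro i
        have := Finset.ext_iff.1 hj i
        simpa using this
      have hjj := (hj' j).2 rfl
      refine ⟨j, hjj.1, ?_⟩
      intro i
      by_cases hij : i = j
      · subst hij
        simp [hjj.2]
      · by_cases hi : i ∈ T
        · simp only [hij, hi, if_true, if_false, Finset.mem_singleton]
          by_contra hh
          exact hij ((hj' i).1 ⟨hi, hh⟩)
        · simp [hij, hi]
  refine (Finset.card_le_card hsub).trans ((Finset.card_union_le _ _).trans ?_)
  rw [card_ball0, mul_add, mul_one, Finset.mul_sum]
  refine Nat.add_le_add_left (Finset.card_biUnion_le.trans (Finset.sum_le_sum ?_)) _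
  intro j hj
  rw [Fintype.card_piFinset, ← Finset.prod_mul_prod_compl T, mul_comm]
  apply Nat.mul_le_mul
  · apply le_of_eq
    apply Finset.prod_congr rfl
    intro i hi
    have hi' := Finset.mem_compl.1 hi
    have : i ≠ j := by rintro rfl; exact hi' hj
    simp [this, hi']
  · rw [← Finset.mul_prod_erase T _ hj]
    rw [Finset.prod_eq_one (s := T.erase j), mul_one]
    · simp [Finset.card_compl]
    · intro i hi
      simp [Finset.ne_of_mem_erase hi, Finset.mem_of_mem_erase hi]

/-- weight -/
def wt (T : Finset (Fin n)) (c x : ∀ i, Fin (p i)) : ℕ := (T.filter (fun i => x i ≠ c i)).card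

theorem mem_hBall (T : Finset (Fin n)) (c x : ∀ i, Fin (p i)) (k : ℕ) :
    x ∈ hBall T c k ↔ wt T c x ≤ k := by
  simp [hBall, wt]

theorem sum_wt (A : Finset (∀ i, Fin (p i))) (T : Finset (Fin n)) (c : ∀ i, Fin (p i)) :
    ∑ x ∈ A, wt T c x = ∑ i ∈ T, (A.filter (fun x => x i ≠ c i)).card := by
  simp only [wt, Finset.card_filter]
  exact Finset.sum_comm

theorem sum_wt_le {r : ℕ} (hp : ∀ i, r + 1 ≤ p i) (A : Finset (∀ i, Fin (p i)))
    (T : Finset (Fin n)) (c : ∀ i, Fin (p i))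
    (hA : ∀ i ∈ T, p i * (A.filter (fun x => x i ≠ c i)).card ≤ A.card) :
    (r + 1) * ∑ x ∈ A, wt T c x ≤ T.card * A.card := by
  rw [sum_wt, Finset.mul_sum, ← smul_eq_mul T.card]
  apply Finset.sum_le_card_nsmul
  intro i hi
  exact (Nat.mul_le_mul_right _ (hp i)).trans (hA i hi)

theorem markov (A : Finset (∀ i, Fin (p i))) (T : Finset (Fin n)) (c : ∀ i, Fin (p i)) (k : ℕ) :
    (k + 1) * A.card ≤ (k + 1) * (hBall T c k).card + ∑ x ∈ A, wt T c x := by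
  have h1 : (A.filter (fun x => x ∈ hBall T c k)).card ≤ (hBall T c k).card := by
    apply Finset.card_le_card
    intro x hx
    exact (Finset.mem_filter.1 hx).2
  refine le_trans ?_ (Nat.add_le_add_right (Nat.mul_le_mul_left _ h1) _)
  rw [Finset.card_filter, Finset.mul_sum, ← Finset.sum_add_distrib, mul_comm, ← smul_eq_mul]
  apply Finset.card_nsmul_le_sum
  intro x _
  by_cases hx : x ∈ hBall T c k
  · simp [hx]
  · have h2 := mt (mem_hBall T c x k).2 hx
    simp only [hx, if_false]
    omega

theorem far {r s : ℕ} (hp : ∀ i, r + 1 ≤ p i) (A : Finset (∀ i, Fin (p i)))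
    (T : Finset (Fin n)) (c y : ∀ i, Fin (p i))
    (hA : ∀ i ∈ T, p i * (A.filter (fun x => x i ≠ c i)).card ≤ A.card)
    (hy : ∀ x ∈ A, (T.filter (fun i => x i ≠ y i)).card ≤ s) :
    (r + 1) * ∑ x ∈ A, wt T c x + (r + 1) * (wt T c y * A.card)
      ≤ (r + 1) * (s * A.card) + 2 * (wt T c y * A.card) := by
  set K := T.filter (fun i => y i ≠ c i) with hK
  have h1 : (r + 1) * ∑ x ∈ A, wt K c x ≤ K.card * A.card :=
    sum_wt_le hp A K c (fun i hi => hA i (Finset.mem_filter.1 hi).1)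
  have hKc : K.card = wt T c y := rfl
  rw [hKc] at h1
  have h2 : ∀ x ∈ A, wt T c x + wt T c y ≤ s + 2 * wt K c x := by
    intro x hx
    refine le_trans ?_ (Nat.add_le_add_right (hy x hx) _)
    rw [hK]
    simp only [wt, Finset.filter_filter, Finset.card_filter, Finset.mul_sum,
      ← Finset.sum_add_distrib]
    apply Finset.sum_le_sum
    intro i _
    by_cases a1 : x i = c i <;> by_cases a2 : y i = c i <;> by_cases a3 : x i = y i <;>
      simp_all
  have h3 := Finset.sum_le_sum h2
  rw [Finset.sum_add_distrib, Finset.sum_add_distrib, ← Finset.mul_sum] at h3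
  simp only [Finset.sum_const, smul_eq_mul] at h3
  nlinarith

theorem prod_sorted (r : ℕ) (hrn : r ≤ n) (hr : 1 ≤ r)
    (hmono : ∀ i j : Fin n, i ≤ j → p i ≤ p j) (R : Finset (Fin n)) (hR : R.card = r) :
    ∏ i ∈ univ.filter (fun i : Fin n => (i : ℕ) < r), p i ≤ ∏ i ∈ R, p i := by
  set F := univ.filter (fun i : Fin n => (i : ℕ) < r) with hF
  have hFc : F.card = r := by
    rw [hF, Fin.card_filter_val_lt]; omega
  have hc : (F \ R).card = (R \ F).card := by
    have h1 := Finset.card_sdiff_add_card_inter F R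
    have h2 := Finset.card_sdiff_add_card_inter R F
    rw [Finset.inter_comm] at h2
    omega
  rw [← Finset.prod_inter_mul_prod_sdiff F R, ← Finset.prod_inter_mul_prod_sdiff R F,
    Finset.inter_comm R F]
  apply Nat.mul_le_mul_left
  let m : Fin n := ⟨r - 1, by omega⟩
  calc ∏ i ∈ F \ R, p i ≤ (p m) ^ (F \ R).card := by
        apply Finset.prod_le_pow_card
        intro i hi
        apply hmono
        have := (Finset.mem_filter.1 (Finset.mem_sdiff.1 hi).1).2
        rw [Fin.le_def]
        show (i : ℕ) ≤ r - 1
        omega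
    _ = (p m) ^ (R \ F).card := by rw [hc]
    _ ≤ ∏ i ∈ R \ F, p i := by
        apply Finset.pow_card_le_prod
        intro i hi
        apply hmono
        have := (Finset.mem_sdiff.1 hi).2
        simp [hF] at this
        rw [Fin.le_def]
        show r - 1 ≤ (i : ℕ)
        omega

theorem N0_ge (r : ℕ) (hrn : r ≤ n) (hr : 1 ≤ r) (hp : ∀ i, 2 ≤ p i)
    (hmono : ∀ i j : Fin n, i ≤ j → p i ≤ p j) (T R : Finset (Fin n)) (hRT : R ⊆ T)
    (hR : R.card = r) :
    (∏ i ∈ Tᶜ, p i) * ∏ i ∈ T \ R, p i ≤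
      ∏ i ∈ univ.filter (fun i : Fin n => r ≤ (i : ℕ)), p i := by
  have h1 := prod_sorted r hrn hr hmono R hR
  have h2 : (∏ i ∈ univ.filter (fun i : Fin n => (i : ℕ) < r), p i) *
      ∏ i ∈ univ.filter (fun i : Fin n => r ≤ (i : ℕ)), p i = ∏ i, p i := by
    rw [← Finset.prod_filter_mul_prod_filter_not univ (fun i : Fin n => (i : ℕ) < r)]
    simp only [not_lt]
  have h3 : (∏ i ∈ R, p i) * ((∏ i ∈ Tᶜ, p i) * ∏ i ∈ T \ R, p i) = ∏ i, p i := by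
    rw [← Finset.prod_mul_prod_compl T, ← Finset.prod_sdiff hRT]
    ring
  have hpos : 0 < ∏ i ∈ R, p i := Finset.prod_pos (fun i _ => by have := hp i; omega)
  by_contra hh
  push Not at hh
  have h4 := Nat.mul_lt_mul_of_lt_of_le' hh h1 
    (Finset.prod_pos (fun i _ => by have := hp i; omega))
  rw [mul_comm] at h2
  rw [mul_comm] at h3
  omega

theorem invariant_off {B : Finset (∀ i, Fin (p i))} (S : Finset (Fin n)) :
    (∀ i ∈ S, Irrel B i) → ∀ y ∈ B, ∀ z : ∀ i, Fin (p i), (∀ i ∉ S, z i = y i) → z ∈ B := by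
  induction S using Finset.induction_on with
  | empty =>
    intro _ y hy z hz
    have : z = y := funext (fun i => hz i (by simp))
    rwa [this]
  | insert a S ha ih =>
    intro hS y hy z hz
    have h1 : update y a (z a) ∈ B := hS a (by simp) y hy _
    refine ih (fun i hi => hS i (by simp [hi])) _ h1 z ?_
    intro i hi
    by_cases hia : i = a
    · subst hia; simp
    · rw [update_of_ne hia]
      exact hz i (by simp [hia, hi])

theorem cross_T {r : ℕ} {A B : Finset (∀ i, Fin (p i))} (h : CrossInt r A B)
    (hp : ∀ i, 2 ≤ p i) (T : Finset (Fin n)) (hT : ∀ i ∉ T, Irrel B i)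
    (x y : ∀ i, Fin (p i)) (hx : x ∈ A) (hy : y ∈ B) :
    (T.filter (fun i => x i ≠ y i)).card + r ≤ T.card := by
  choose f hf using fun i => exists_ne_fin (hp i) (x i)
  let z : ∀ i, Fin (p i) := fun i => if i ∈ T then y i else f i
  have hz : z ∈ B := invariant_off Tᶜ (fun i hi => hT i (by simpa using hi)) y hy z
    (fun i hi => by simp at hi; simp [z, hi])
  have h1 := h x hx z hz
  have h2 : univ.filter (fun i => x i = z i) ⊆ T.filter (fun i => x i = y i) := by
    intro i
    simp only [Finset.mem_filter, Finset.mem_univ, true_and]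
    by_cases hi : i ∈ T
    · simp [z, hi]
    · simp only [z, hi, if_false]
      intro hh
      exact absurd hh.symm (hf i)
  have h3 := Finset.card_le_card h2
  have h4 := Finset.card_filter_add_card_filter_not (s := T) (fun i => x i = y i)
  simp only [ne_eq]
  omega

noncomputable def hh (q : ℝ) : ℝ := Real.log q - Real.log (q - 1) + 2 / q * Real.log (q - 1)

theorem entropy (A : Finset (∀ i, Fin (p i))) (T : Finset (Fin n)) (c : ∀ i, Fin (p i))
    (hp : ∀ i, 2 ≤ p i) (hA0 : 0 < A.card)
    (hA : ∀ i ∈ T, p i * (A.filter (fun x => x i ≠ c i)).card ≤ A.card) :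
    Real.log A.card ≤ ∑ i ∈ Tᶜ, Real.log (p i) + ∑ i ∈ T, hh (p i) := by
  classical
  let q : ∀ i, Fin (p i) → ℝ := fun i v =>
    if i ∈ T then (if v = c i then 1 - 1 / (p i : ℝ) else 1 / ((p i : ℝ) * (p i - 1)))
    else 1 / (p i : ℝ)
  have hp2 : ∀ i, (2 : ℝ) ≤ p i := fun i => by exact_mod_cast hp i
  have hqpos : ∀ i v, 0 < q i v := by
    intro i v
    have := hp2 i
    simp only [q]
    split_ifs
    · rw [sub_pos, div_lt_one (by linarith)]; linarith
    · apply div_pos one_pos; apply mul_pos <;> linarith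
    · apply div_pos one_pos; linarith
  have hqsum : ∀ i, ∑ v, q i v = 1 := by
    intro i
    have := hp2 i
    by_cases hi : i ∈ T
    · simp only [q, hi, if_true]
      rw [← Finset.add_sum_erase univ _ (Finset.mem_univ (c i))]
      rw [Finset.sum_congr (g := fun _ => 1 / ((p i : ℝ) * (p i - 1))) rfl]
      · have h1 : (p i : ℝ) - 1 ≠ 0 := by linarith
        simp only [if_true, Finset.sum_const, nsmul_eq_mul]
        rw [Finset.card_erase_of_mem (Finset.mem_univ _)]
        simp only [Finset.card_univ, Fintype.card_fin]
        rw [Nat.cast_sub (by have := hp i; omega)]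
        have h0 : (p i : ℝ) ≠ 0 := by linarith
        push_cast
        field_simp
        ring
      · intro v hv
        simp [Finset.ne_of_mem_erase hv]
    · simp only [q, hi, if_false]
      simp
      field_simp
  have htot : ∑ x : (∀ i, Fin (p i)), ∏ i, q i (x i) = 1 := by
    rw [← Fintype.prod_sum]
    exact Finset.prod_eq_one (fun i _ => hqsum i)
  have hA0' : (0 : ℝ) < A.card := by exact_mod_cast hA0
  have hQpos : ∀ x : (∀ i, Fin (p i)), 0 < ∏ i, q i (x i) :=
    fun x => Finset.prod_pos (fun i _ => hqpos i _)
  have h1 : ∑ x ∈ A, Real.log ((∏ i, q i (x i)) * A.card) ≤ 0 := by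
    calc _ ≤ ∑ x ∈ A, ((∏ i, q i (x i)) * A.card - 1) :=
          Finset.sum_le_sum (fun x _ => Real.log_le_sub_one_of_pos (mul_pos (hQpos x) hA0'))
      _ = (∑ x ∈ A, ∏ i, q i (x i)) * A.card - A.card := by
          rw [Finset.sum_sub_distrib, Finset.sum_mul]; simp
      _ ≤ 1 * A.card - A.card := by
          have : ∑ x ∈ A, ∏ i, q i (x i) ≤ 1 := by
            rw [← htot]
            exact Finset.sum_le_sum_of_subset_of_nonneg (Finset.subset_univ _)
              (fun x _ _ => (hQpos x).le)
          nlinarith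
      _ = 0 := by ring
  have h2 : ∑ x ∈ A, Real.log ((∏ i, q i (x i)) * A.card)
      = ∑ i, ∑ x ∈ A, Real.log (q i (x i)) + A.card * Real.log A.card := by
    rw [Finset.sum_comm]
    rw [Finset.sum_congr rfl (fun x _ => by
      rw [Real.log_mul (hQpos x).ne' hA0'.ne', Real.log_prod (fun i _ => (hqpos i _).ne')])]
    rw [Finset.sum_add_distrib]; simp
  have h3 : ∀ i ∈ Tᶜ, ∑ x ∈ A, Real.log (q i (x i)) = A.card * (- Real.log (p i)) := by
    intro i hi
    simp [q, Finset.mem_compl.1 hi]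
  have h4 : ∀ i ∈ T, A.card * (- hh (p i)) ≤ ∑ x ∈ A, Real.log (q i (x i)) := by
    intro i hi
    have hpi := hp2 i
    have hl : 0 ≤ Real.log ((p i : ℝ) - 1) := Real.log_nonneg (by linarith)
    have e : ∀ x ∈ A, Real.log (q i (x i)) = (Real.log (p i - 1) - Real.log (p i))
        - (if x i ≠ c i then 1 else 0) * (2 * Real.log (p i - 1)) := by
      intro x _
      by_cases hx : x i = c i
      · simp only [q, hi, hx, if_true]
        rw [show 1 - 1 / (p i : ℝ) = (p i - 1) / p i by field_simp,
          Real.log_div (by linarith) (by linarith)]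
        simp
      · simp only [q, hi, hx, if_true, if_false]
        rw [one_div, Real.log_inv, Real.log_mul (by linarith) (by linarith)]
        simp [hx]
        ring
    rw [Finset.sum_congr rfl e, Finset.sum_sub_distrib, ← Finset.sum_mul]
    simp only [Finset.sum_const, nsmul_eq_mul, Finset.sum_boole]
    have hAi : (p i : ℝ) * (A.filter (fun x => x i ≠ c i)).card ≤ A.card := by
      exact_mod_cast hA i hi
    have hAi2 : ((A.filter (fun x => x i ≠ c i)).card : ℝ) ≤ A.card / p i := by
      rw [le_div_iff₀ (by linarith)]; linarith
    have := mul_le_mul_of_nonneg_right hAi2 (by positivity : 0 ≤ 2 * Real.log ((p i : ℝ) - 1))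
    have e2 : (A.card : ℝ) * (2 / p i * Real.log ((p i : ℝ) - 1))
       = A.card / p i * (2 * Real.log ((p i : ℝ) - 1)) := by ring
    unfold hh
    nlinarith
  have h5 := Finset.sum_le_sum h4
  have h6 := Finset.sum_congr (rfl : Tᶜ = Tᶜ) h3
  rw [← Finset.mul_sum] at h5 h6
  rw [h2, ← Finset.sum_add_sum_compl T, h6] at h1
  simp only [Finset.sum_neg_distrib] at h1 h5
  have : (A.card : ℝ) * Real.log A.card ≤
    A.card * (∑ i ∈ Tᶜ, Real.log (p i) + ∑ i ∈ T, hh (p i)) := by nlinarith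
  exact le_of_mul_le_mul_left this hA0'

theorem log4 : (1.386 : ℝ) < Real.log 4 := by
  have : (4 : ℝ) = 2 ^ 2 := by norm_num
  rw [this, Real.log_pow]
  have := Real.log_two_gt_d9
  norm_num at this ⊢
  linarith

theorem hh_le (r q : ℝ) (hr : 4 ≤ r) (hq : r + 1 ≤ q) :
    hh q ≤ 1 / r + 2 / (r + 1) * Real.log r := by
  have hl : 1.386 < Real.log r := log4.trans_le (Real.log_le_log (by norm_num) hr)
  unfold hh
  have h1 : Real.log q - Real.log (q - 1) ≤ 1 / r := by
    rw [← Real.log_div (by linarith) (by linarith)]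
    have : q / (q - 1) = 1 / (q - 1) + 1 := by
      have : q - 1 ≠ 0 := by linarith
      field_simp; ring
    refine (Real.log_le_sub_one_of_pos (div_pos (by linarith) (by linarith))).trans ?_
    rw [this, add_sub_cancel_right]
    exact one_div_le_one_div_of_le (by linarith) (by linarith)
  have h2 : 2 / q * Real.log (q - 1) ≤ 2 / (r + 1) * Real.log r := by
    have h3 : Real.log (q - 1) ≤ Real.log r + (q - 1 - r) / r := by
      have := Real.log_le_sub_one_of_pos (x := (q - 1) / r) (div_pos (by linarith) (by linarith))
      rw [Real.log_div (by linarith) (by linarith)] at this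
      have e : (q - 1 - r) / r = (q - 1) / r - 1 := by field_simp
      linarith
    have h4 : (r + 1) * ((q - 1 - r) / r) ≤ (q - 1 - r) * Real.log r := by
      have : (r + 1) / r ≤ Real.log r := by
        rw [div_le_iff₀ (by linarith)]; nlinarith
      calc _ = (q - 1 - r) * ((r + 1) / r) := by ring
        _ ≤ _ := mul_le_mul_of_nonneg_left this (by linarith)
    rw [div_mul_eq_mul_div, div_mul_eq_mul_div, div_le_div_iff₀ (by linarith) (by linarith)]
    nlinarith
  linarith

theorem gg_ge (r q : ℝ) (hr : 4 ≤ r) (hq : r + 1 ≤ q) :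
    (r - 1) / (r + 1) * Real.log r ≤ Real.log q - hh q := by
  unfold hh
  have h1 : Real.log r ≤ Real.log (q - 1) := Real.log_le_log (by linarith) (by linarith)
  have h2 : (r - 1) / (r + 1) ≤ 1 - 2 / q := by
    have : (r - 1) / (r + 1) = 1 - 2 / (r + 1) := by
      have : r + 1 ≠ 0 := by linarith
      field_simp; ring
    rw [this]
    have : 2 / q ≤ 2 / (r + 1) := div_le_div_of_nonneg_left (by norm_num) (by linarith) hq
    linarith
  have h0 : 0 ≤ Real.log r := Real.log_nonneg (by linarith)
  have h3 : 0 ≤ 1 - 2 / q := le_trans (by apply div_nonneg <;> linarith) h2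
  have := mul_le_mul h2 h1 h0 h3
  nlinarith

theorem far_small {r s : ℕ} (hr : 1 ≤ r) (hp : ∀ i, r + 1 ≤ p i) (A : Finset (∀ i, Fin (p i)))
    (T : Finset (Fin n)) (c y : ∀ i, Fin (p i))
    (hA : ∀ i ∈ T, p i * (A.filter (fun x => x i ≠ c i)).card ≤ A.card)
    (hy : ∀ x ∈ A, (T.filter (fun i => x i ≠ y i)).card ≤ s) (hs : s ≤ wt T c y) :
    (r + 1) * A.card ≤ (r + 1) * (∏ i ∈ Tᶜ, p i) + 2 * (s * A.card) := by
  have h1 := far hp A T c y hA hy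
  have h2 := markov A T c 0
  rw [card_ball0] at h2
  have h3 : s * A.card ≤ wt T c y * A.card := Nat.mul_le_mul_right _ hs
  generalize wt T c y * A.card = X at *
  generalize s * A.card = Y at *
  obtain ⟨d, rfl⟩ := Nat.exists_eq_add_of_le h3
  obtain ⟨e, rfl⟩ := Nat.exists_eq_add_of_le hr
  nlinarith [Nat.zero_le (e * d)]

theorem sq_split {X a b : ℕ} (h : X ^ 2 ≤ a * b) : X ≤ a ∨ X ≤ b := by
  by_contra hh
  push Not at hh
  nlinarith [hh.1, hh.2]

theorem sum_sub_le (T : Finset (Fin n)) (u : Fin n) (hu : ∀ i ∈ T, p i ≤ p u) :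
    1 + ∑ i ∈ T, (p i - 1) ≤ 1 + T.card * (p u - 1) := by
  apply Nat.add_le_add_left
  rw [← smul_eq_mul]
  apply Finset.sum_le_card_nsmul
  intro i hi
  have := hu i hi
  omega

theorem case1 {r P Q a b : ℕ} (hr : 4 ≤ r) (hP : r + 1 ≤ P) (hQ : 0 < Q)
    (ha : a ≤ Q) (hb : b ≤ Q * (1 + (r + 1) * (P - 1))) (h : (Q * P) ^ 2 ≤ a * b) : False := by
  have h1 : a * b ≤ Q * (Q * (1 + (r + 1) * (P - 1))) := Nat.mul_le_mul ha hb
  have h2 : Q ^ 2 * P ^ 2 ≤ Q ^ 2 * (1 + (r + 1) * (P - 1)) := by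
    calc _ = (Q * P) ^ 2 := by ring
      _ ≤ _ := h.trans h1
      _ = _ := by ring
  have h3 := le_of_mul_le_mul_left h2 (by positivity)
  obtain ⟨d, rfl⟩ := Nat.exists_eq_add_of_le hP
  have : r + 1 + d - 1 = r + d := by omega
  rw [this] at h3
  nlinarith

theorem case2 {r Z Q a b c : ℕ} (hr : 4 ≤ r) (hZ : 25 ≤ Z) (hQ : 0 < Q)
    (ha : (r + 1) * a ≤ (r + 1) * Q + 2 * (2 * a)) (hb : r * b ≤ 2 * (r + 1) * c)
    (hc : c ≤ Q * Z) (h : (Q * Z) ^ 2 ≤ a * b) : False := by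
  have h1 : a ≤ 5 * Q := by
    by_contra hh
    push Not at hh
    obtain ⟨e, rfl⟩ := Nat.exists_eq_add_of_le hr
    nlinarith
  have h2 : r * (Q * Z) ^ 2 ≤ 5 * Q * (2 * (r + 1) * (Q * Z)) := by
    calc r * (Q * Z) ^ 2 ≤ r * (a * b) := Nat.mul_le_mul_left _ h
      _ = a * (r * b) := by ring
      _ ≤ 5 * Q * (2 * (r + 1) * (Q * Z)) :=
        Nat.mul_le_mul h1 (hb.trans (Nat.mul_le_mul_left _ hc))
  have h3 : Q ^ 2 * Z * (r * Z) ≤ Q ^ 2 * Z * (10 * (r + 1)) := by nlinarith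
  have h4 := le_of_mul_le_mul_left h3 (by positivity)
  nlinarith

theorem case3 {r P Q a c X : ℕ} (hr : 4 ≤ r) (hP : r + 1 ≤ P) (hQ : 0 < Q)
    (ha : 2 * (r + 1) * a ≤ 2 * (r + 1) * c + (r + 3) * a)
    (hc : c ≤ Q * (1 + (r + 3) * (P - 1))) (hX : Q * (P * (r + 1) ^ 2) ≤ X) (h : X ≤ a) :
    False := by
  have h1 : (r - 1) * a ≤ 2 * (r + 1) * c := by
    obtain ⟨e, rfl⟩ := Nat.exists_eq_add_of_le hr
    have : 4 + e - 1 = 3 + e := by omega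
    rw [this]
    nlinarith
  have h2 : (r + 1) * Q * ((r - 1) * (P * (r + 1))) ≤
      (r + 1) * Q * (2 * (1 + (r + 3) * (P - 1))) := by
    calc _ = (r - 1) * (Q * (P * (r + 1) ^ 2)) := by ring
      _ ≤ (r - 1) * a := Nat.mul_le_mul_left _ (hX.trans h)
      _ ≤ 2 * (r + 1) * (Q * (1 + (r + 3) * (P - 1))) := h1.trans (Nat.mul_le_mul_left _ hc)
      _ = _ := by ring
  have h3 := le_of_mul_le_mul_left h2 (by positivity)
  obtain ⟨d, rfl⟩ := Nat.exists_eq_add_of_le hP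
  obtain ⟨e, rfl⟩ := Nat.exists_eq_add_of_le hr
  have e1 : 4 + e + 1 + d - 1 = 4 + e + d := by omega
  have e2 : 4 + e - 1 = 3 + e := by omega
  rw [e1, e2] at h3
  have q1 : (0 : ℤ) ≤ (e : ℤ) * d := by positivity
  have q2 : (0 : ℤ) ≤ (e : ℤ) ^ 2 * d := by positivity
  zify at h3
  nlinarith [sq_nonneg (e : ℤ), pow_nonneg (Int.natCast_nonneg e) 3]

theorem case4 {r : ℕ} (hr : 4 ≤ r) (hp : ∀ i, r + 1 ≤ p i) (T U : Finset (Fin n)) (hU : U ⊆ T)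
    (hc : U.card + r = T.card) (h4 : 4 ≤ U.card) (a : ℕ)
    (ha : Real.log a ≤ ∑ i ∈ Tᶜ, Real.log (p i) + ∑ i ∈ T, hh (p i))
    (hl : (∏ i ∈ Tᶜ, p i) * ∏ i ∈ U, p i ≤ a) : False := by
  have hr' : (4 : ℝ) ≤ r := by exact_mod_cast hr
  have hp' : ∀ i, (r : ℝ) + 1 ≤ p i := fun i => by exact_mod_cast hp i
  have hpos : ∀ i, (p i : ℝ) ≠ 0 := fun i => by have := hp' i; linarith
  have h1 : Real.log (((∏ i ∈ Tᶜ, p i) * ∏ i ∈ U, p i : ℕ) : ℝ) ≤ Real.log a := by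
    apply Real.log_le_log
    · have : 0 < (∏ i ∈ Tᶜ, p i) * ∏ i ∈ U, p i := by
        apply Nat.mul_pos <;> exact Finset.prod_pos (fun i _ => by have := hp i; omega)
      exact_mod_cast this
    · exact_mod_cast hl
  push_cast at h1
  rw [Real.log_mul (Finset.prod_ne_zero_iff.2 fun i _ => hpos i)
    (Finset.prod_ne_zero_iff.2 fun i _ => hpos i), Real.log_prod (fun i _ => hpos i),
    Real.log_prod (fun i _ => hpos i)] at h1
  have h2 : ∑ i ∈ U, Real.log (p i) ≤ ∑ i ∈ T, hh (p i) := by linarith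
  rw [← Finset.sum_sdiff hU] at h2
  have h3 : ∑ i ∈ U, (Real.log (p i) - hh (p i)) ≤ ∑ i ∈ T \ U, hh (p i) := by
    rw [Finset.sum_sub_distrib]; linarith
  have h5 : ∑ i ∈ T \ U, hh (p i) ≤ (T \ U).card • (1 / (r : ℝ) + 2 / (r + 1) * Real.log r) :=
    Finset.sum_le_card_nsmul _ _ _ (fun i _ => hh_le r (p i) hr' (hp' i))
  have h6 : U.card • (((r : ℝ) - 1) / (r + 1) * Real.log r)
      ≤ ∑ i ∈ U, (Real.log (p i) - hh (p i)) :=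
    Finset.card_nsmul_le_sum _ _ _ (fun i _ => gg_ge r (p i) hr' (hp' i))
  have hcard : (T \ U).card = r := by
    rw [Finset.card_sdiff_of_subset hU]; omega
  rw [hcard, nsmul_eq_mul] at h5
  rw [nsmul_eq_mul] at h6
  have hL : 1.386 < Real.log r := log4.trans_le (Real.log_le_log (by norm_num) hr')
  have h4' : (4 : ℝ) ≤ U.card := by exact_mod_cast h4
  have h7 : 4 * (((r : ℝ) - 1) / (r + 1) * Real.log r) ≤
      r * (1 / (r : ℝ) + 2 / (r + 1) * Real.log r) := by
    refine le_trans (mul_le_mul_of_nonneg_right h4' ?_) (h6.trans (h3.trans h5))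
    apply mul_nonneg
    · apply div_nonneg <;> linarith
    · linarith
  generalize Real.log (r : ℝ) = y at *
  have hr1 : (0 : ℝ) < r + 1 := by linarith
  have hr0 : (0 : ℝ) < r := by linarith
  have h8 : 4 * ((r : ℝ) - 1) * y ≤ (r + 1) + 2 * r * y := by
    have := mul_le_mul_of_nonneg_right h7 hr1.le
    have e1 : 4 * (((r : ℝ) - 1) / (r + 1) * y) * (r + 1) = 4 * ((r : ℝ) - 1) * y := by
      field_simp
    have e2 : r * (1 / (r : ℝ) + 2 / (r + 1) * y) * (r + 1) = (r + 1) + 2 * r * y := by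
      field_simp
    linarith
  nlinarith

theorem small1 {r a Q : ℕ} (hr : 4 ≤ r) (h : (r + 1) * a ≤ (r + 1) * Q + 2 * (1 * a)) :
    a ≤ 2 * Q := by
  by_contra hh
  push Not at hh
  obtain ⟨e, rfl⟩ := Nat.exists_eq_add_of_le hr
  nlinarith

theorem full_card {a b Z : ℕ} (hZ : 0 < Z) (hb : b ≤ Z) (h : Z ^ 2 ≤ a * b) : Z ≤ a := by
  by_contra hh
  nlinarith

set_option maxHeartbeats 1000000 in
theorem main_struct (r : ℕ) (hr : 4 ≤ r) (hrn : r ≤ n)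
    (hp : ∀ i, r + 1 ≤ p i) (hmono : ∀ i j : Fin n, i ≤ j → p i ≤ p j)
    (A B : Finset (∀ i, Fin (p i))) (h : MaxPair r A B)
    (hlow : (∏ i ∈ univ.filter (fun i : Fin n => r ≤ (i : ℕ)), p i) ^ 2 ≤ A.card * B.card) :
    A.card * B.card ≤ (∏ i ∈ univ.filter (fun i : Fin n => r ≤ (i : ℕ)), p i) ^ 2 ∧
      A = B ∧
      ((∃ (T : Finset (Fin n)) (x₀ : ∀ i, Fin (p i)),
          T.card = r ∧ A = hBall T x₀ 0) ∨
        (∃ (T : Finset (Fin n)) (x₀ : ∀ i, Fin (p i)),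
          T.card = r + 2 ∧ (∀ i ∈ T, p i = r + 1) ∧ A = hBall T x₀ 1)) := by
  classical
  set N0 := ∏ i ∈ univ.filter (fun i : Fin n => r ≤ (i : ℕ)), p i with hN0
  have hp2 : ∀ i, 2 ≤ p i := fun i => by have := hp i; omega
  set T := univ.filter (fun i => ¬ Irrel A i) with hTdef
  have hTB : ∀ i ∉ T, Irrel B i := by
    intro i hi
    apply Irrel.other h hp2
    simpa [hTdef] using hi
  have hcx : ∀ i, ∃ l : Fin (p i), i ∈ T →
      p i * (A.filter (fun x => x i ≠ l)).card ≤ A.card ∧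
      p i * (B.filter (fun x => x i ≠ l)).card ≤ B.card := by
    intro i
    by_cases hi : i ∈ T
    · obtain ⟨l, hl⟩ := conc h hp2 i (by have := hp i; omega) (by simpa [hTdef] using hi)
      exact ⟨l, fun _ => hl⟩
    · exact ⟨⟨0, by have := hp i; omega⟩, fun hh => absurd hh hi⟩
  choose c hc using hcx
  have hcA : ∀ i ∈ T, p i * (A.filter (fun x => x i ≠ c i)).card ≤ A.card :=
    fun i hi => (hc i hi).1
  have hcB : ∀ i ∈ T, p i * (B.filter (fun x => x i ≠ c i)).card ≤ B.card :=
    fun i hi => (hc i hi).2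
  have hcr : ∀ x ∈ A, ∀ y ∈ B, (T.filter (fun i => x i ≠ y i)).card + r ≤ T.card :=
    fun x hx y hy => cross_T h.1 hp2 T hTB x y hx hy
  have hcr' : ∀ y ∈ B, ∀ x ∈ A, (T.filter (fun i => y i ≠ x i)).card + r ≤ T.card := by
    intro y hy x hx
    have := hcr x hx y hy
    simpa [ne_comm] using this
  set Q := ∏ i ∈ Tᶜ, p i with hQ
  have hQ0 : 0 < Q := Finset.prod_pos (fun i _ => by have := hp i; omega)
  have hA0 := h.2.2.1
  have hB0 := h.2.2.2
  obtain ⟨x0, hx0⟩ := Finset.card_pos.1 hA0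
  obtain ⟨y0, hy0⟩ := Finset.card_pos.1 hB0
  have hTr : r ≤ T.card := by have := hcr x0 hx0 y0 hy0; omega
  have hN : ∀ U ⊆ T, U.card + r = T.card → Q * ∏ i ∈ U, p i ≤ N0 := by
    intro U hU hUc
    have := N0_ge r hrn (by omega) hp2 hmono T (T \ U) Finset.sdiff_subset
      (by rw [Finset.card_sdiff_of_subset hU]; omega)
    rwa [Finset.sdiff_sdiff_eq_self hU] at this
  have hNsq : ∀ U ⊆ T, U.card + r = T.card → (Q * ∏ i ∈ U, p i) ^ 2 ≤ A.card * B.card :=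
    fun U h1 h2 => (Nat.pow_le_pow_left (hN U h1 h2) 2).trans hlow
  have hb1 : (hBall T c 1).card ≤ Q * (1 + ∑ i ∈ T, (p i - 1)) := card_ball1 T c
  have hb0 : (hBall T c 0).card = Q := card_ball0 T c
  have mA := markov A T c 1
  have mB := markov B T c 1
  have sA := sum_wt_le hp A T c hcA
  have sB := sum_wt_le hp B T c hcB
  -- Markov bounds
  have kA : 2 * (r + 1) * A.card ≤ 2 * (r + 1) * (hBall T c 1).card + T.card * A.card := by
    nlinarith
  have kB : 2 * (r + 1) * B.card ≤ 2 * (r + 1) * (hBall T c 1).card + T.card * B.card := by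
    nlinarith
  obtain ⟨s, hs⟩ := Nat.exists_eq_add_of_le hTr
  have hd : ∀ x ∈ A, ∀ y ∈ B, (T.filter (fun i => x i ≠ y i)).card ≤ s :=
    fun x hx y hy => by have := hcr x hx y hy; omega
  have hd' : ∀ y ∈ B, ∀ x ∈ A, (T.filter (fun i => y i ≠ x i)).card ≤ s :=
    fun x hx y hy => by have := hcr' x hx y hy; omega
  have hsT : 1 ≤ s → T.Nonempty := by
    intro _
    rw [← Finset.card_pos]; omega
  rcases (by omega : s = 0 ∨ s = 1 ∨ s = 2 ∨ s = 3 ∨ 4 ≤ s) with hs0 | hs0 | hs0 | hs0 | hs0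
  · -- s = 0
    subst hs0
    have hQN : Q ≤ N0 := by simpa using hN ∅ (by simp) (by simp; omega)
    have hxy : ∀ i ∈ T, x0 i = y0 i := by
      intro i hi
      have := hd x0 hx0 y0 hy0
      simp only [Nat.le_zero, Finset.card_eq_zero, Finset.filter_eq_empty_iff] at this
      simpa using this hi
    have hbe : hBall T x0 0 = hBall T y0 0 := by
      ext x
      simp only [mem_hBall, wt]
      rw [Finset.filter_congr (fun i hi => by rw [hxy i hi])]
    have hAs : A ⊆ hBall T y0 0 := fun x hx => (mem_hBall _ _ _ _).2 (hd x hx y0 hy0)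
    have hBs : B ⊆ hBall T y0 0 := by
      rw [← hbe]
      exact fun y hy => (mem_hBall _ _ _ _).2 (hd' y hy x0 hx0)
    have cA := Finset.card_le_card hAs
    have cB := Finset.card_le_card hBs
    rw [card_ball0, ← hQ] at cA cB
    have hup : A.card * B.card ≤ Q ^ 2 := by
      rw [sq]; exact Nat.mul_le_mul cA cB
    have hlo : Q ^ 2 ≤ A.card * B.card := (Nat.pow_le_pow_left hQN 2).trans hlow
    have eA : A = hBall T y0 0 := Finset.eq_of_subset_of_card_le hAs (by
      rw [card_ball0, ← hQ]; exact full_card hQ0 cB hlo)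
    have eB : B = hBall T y0 0 := Finset.eq_of_subset_of_card_le hBs (by
      rw [card_ball0, ← hQ]; exact full_card hQ0 cA (by rw [mul_comm B.card]; exact hlo))
    refine ⟨hup.trans (Nat.pow_le_pow_left hQN 2), eA.trans eB.symm, Or.inl ⟨T, y0, by omega, eA⟩⟩
  · -- s = 1
    exfalso
    subst hs0
    obtain ⟨u, hu, humax⟩ := Finset.exists_max_image T p (hsT le_rfl)
    have hl := hNsq {u} (by simpa using hu) (by simp; omega)
    rw [Finset.prod_singleton] at hl
    have hb1' := hb1.trans (Nat.mul_le_mul_left Q (sum_sub_le T u humax))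
    rw [hs] at hb1'
    have key : ∀ X Y : Finset (∀ i, Fin (p i)), (∀ x ∈ X, ∀ y ∈ Y,
        (T.filter (fun i => x i ≠ y i)).card ≤ 1) → (∀ y ∈ Y, wt T c y = 0) → Y.Nonempty →
        (Q * p u) ^ 2 ≤ Y.card * X.card → False := by
      intro X Y hXY hY hYne hle
      obtain ⟨y, hy⟩ := hYne
      have hyc : ∀ i ∈ T, y i = c i := by
        intro i hi
        have := hY y hy
        simp only [wt, Finset.card_eq_zero, Finset.filter_eq_empty_iff] at this
        simpa using this hi
      have c1 : Y.card ≤ Q := by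
        rw [← hb0]
        exact Finset.card_le_card (fun z hz => (mem_hBall _ _ _ _).2 (hY z hz).le)
      have c2 : X.card ≤ (hBall T c 1).card := by
        apply Finset.card_le_card
        intro x hx
        rw [mem_hBall]
        have := hXY x hx y hy
        rw [Finset.filter_congr (fun i hi => by rw [hyc i hi])] at this
        exact this
      exact case1 hr (hp u) hQ0 c1 (c2.trans hb1') hle
    by_cases q1 : ∀ y ∈ B, wt T c y = 0
    · exact key A B hd q1 ⟨y0, hy0⟩ (by rw [mul_comm B.card]; exact hl)
    by_cases q2 : ∀ x ∈ A, wt T c x = 0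
    · exact key B A hd' q2 ⟨x0, hx0⟩ hl
    push Not at q1 q2
    obtain ⟨y, hy, hyw⟩ := q1
    obtain ⟨x, hx, hxw⟩ := q2
    have f1 := far_small (by omega) hp A T c y hcA (fun z hz => hd z hz y hy) (by omega)
    have f2 := far_small (by omega) hp B T c x hcB (fun z hz => hd' z hz x hx) (by omega)
    rw [← hQ] at f1 f2
    have g1 : A.card ≤ 2 * Q := small1 hr f1
    have g2 : B.card ≤ 2 * Q := small1 hr f2
    have hpu := hp u
    have g3 : Q * 5 ≤ Q * p u := Nat.mul_le_mul_left _ (by omega)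
    have g4 := Nat.mul_le_mul g1 g2
    have g5 := Nat.pow_le_pow_left g3 2
    have g6 : (Q * 5) ^ 2 ≤ 2 * Q * (2 * Q) := g5.trans (hl.trans g4)
    clear * - g6 hQ0
    nlinarith
  · -- s = 2
    subst hs0
    obtain ⟨u, hu, humax⟩ := Finset.exists_max_image T p (hsT (by norm_num))
    have hTe : (T.erase u).card = r + 1 := by rw [Finset.card_erase_of_mem hu]; omega
    obtain ⟨v, hv, hvmax⟩ := Finset.exists_max_image (T.erase u) p
      (by rw [← Finset.card_pos]; omega)
    have hvu : v ≠ u := Finset.ne_of_mem_erase hv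
    have hvT : v ∈ T := Finset.mem_of_mem_erase hv
    have hUs : ({u, v} : Finset (Fin n)) ⊆ T := by
      intro i hi
      simp only [Finset.mem_insert, Finset.mem_singleton] at hi
      rcases hi with rfl | rfl <;> assumption
    have hUc : ({u, v} : Finset (Fin n)).card + r = T.card := by
      rw [Finset.card_pair hvu.symm]; omega
    have hUp : ∏ i ∈ ({u, v} : Finset (Fin n)), p i = p u * p v := Finset.prod_pair hvu.symm
    have hl := hNsq _ hUs hUc
    have hlN := hN _ hUs hUc
    rw [hUp] at hl hlN
    have hpu := hp u
    have hpv := hp v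
    have hsum : 1 + ∑ i ∈ T, (p i - 1) ≤ 1 + ((p u - 1) + (r + 1) * (p v - 1)) := by
      rw [← Finset.add_sum_erase T _ hu]
      have := sum_sub_le (T.erase u) v hvmax
      rw [hTe] at this
      omega
    obtain ⟨d, hd1⟩ := Nat.exists_eq_add_of_le hpu
    obtain ⟨e, he1⟩ := Nat.exists_eq_add_of_le hpv
    have hsumeq : 1 + ((p u - 1) + (r + 1) * (p v - 1)) + d * (r + e) = p u * p v := by
      have e1 : p u - 1 = r + d := by omega
      have e2 : p v - 1 = r + e := by omega
      rw [e1, e2, hd1, he1]; ring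
    have hsumle : 1 + ∑ i ∈ T, (p i - 1) ≤ p u * p v := by
      have := Nat.zero_le (d * (r + e)); omega
    have hbz : (hBall T c 1).card ≤ Q * (p u * p v) := hb1.trans (Nat.mul_le_mul_left _ hsumle)
    have hZ : 25 ≤ p u * p v :=
      Nat.mul_le_mul (by omega : 5 ≤ p u) (by omega : 5 ≤ p v)
    by_cases q1 : ∃ y ∈ B, 2 ≤ wt T c y
    · exfalso
      obtain ⟨y, hy, hyw⟩ := q1
      have f1 := far_small (by omega) hp A T c y hcA (fun z hz => hd z hz y hy) hyw
      rw [hs] at kB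
      exact case2 hr hZ hQ0 f1 (c := (hBall T c 1).card) (b := B.card) (by nlinarith) hbz hl
    by_cases q2 : ∃ x ∈ A, 2 ≤ wt T c x
    · exfalso
      obtain ⟨x, hx, hxw⟩ := q2
      have f1 := far_small (by omega) hp B T c x hcB (fun z hz => hd' z hz x hx) hxw
      rw [hs] at kA
      exact case2 hr hZ hQ0 f1 (c := (hBall T c 1).card) (b := A.card) (by nlinarith) hbz
        (by rw [mul_comm B.card]; exact hl)
    push Not at q1 q2
    have hAs : A ⊆ hBall T c 1 := fun x hx => (mem_hBall _ _ _ _).2 (by have := q2 x hx; omega)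
    have hBs : B ⊆ hBall T c 1 := fun x hx => (mem_hBall _ _ _ _).2 (by have := q1 x hx; omega)
    have cA := Finset.card_le_card hAs
    have cB := Finset.card_le_card hBs
    have hge : Q * (p u * p v) ≤ (hBall T c 1).card := by
      rcases sq_split hl with hh | hh
      · exact hh.trans cA
      · exact hh.trans cB
    have hbeq : (hBall T c 1).card = Q * (p u * p v) := le_antisymm hbz hge
    rw [hbeq] at cA cB
    have hZQ : 0 < Q * (p u * p v) := by positivity
    have eA : A = hBall T c 1 := Finset.eq_of_subset_of_card_le hAs (by
      rw [hbeq]; exact full_card hZQ cB hl)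
    have eB : B = hBall T c 1 := Finset.eq_of_subset_of_card_le hBs (by
      rw [hbeq]; exact full_card hZQ cA (by rw [mul_comm B.card]; exact hl))
    have hpe : p u ≤ 1 + ∑ i ∈ T, (p i - 1) ∧ p u * p v ≤ 1 + ∑ i ∈ T, (p i - 1) := by
      have h1 : p u * p v ≤ 1 + ∑ i ∈ T, (p i - 1) :=
        le_of_mul_le_mul_left (hge.trans hb1) hQ0
      exact ⟨(Nat.le_mul_of_pos_right _ (by omega)).trans h1, h1⟩
    have hd0 : d = 0 := by
      have : d * (r + e) = 0 := by have := hpe.2; omega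
      rcases Nat.mul_eq_zero.1 this with h1 | h1
      · exact h1
      · omega
    refine ⟨?_, eA.trans eB.symm, Or.inr ⟨T, c, hs, ?_, eA⟩⟩
    · refine le_trans ?_ (Nat.pow_le_pow_left hlN 2)
      rw [sq]
      exact Nat.mul_le_mul cA cB
    · intro i hi
      have h1 := humax i hi
      have h2 := hp i
      omega
  · -- s = 3
    exfalso
    subst hs0
    obtain ⟨u, hu, humax⟩ := Finset.exists_max_image T p (hsT (by norm_num))
    obtain ⟨U, hU1, hU2, hU3⟩ := Finset.exists_subsuperset_card_eq (n := 3)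
      (Finset.singleton_subset_iff.2 hu) (by simp) (by omega)
    have huU : u ∈ U := hU1 (by simp)
    have hl := hNsq U hU2 (by omega)
    have hb1' := hb1.trans (Nat.mul_le_mul_left Q (sum_sub_le T u humax))
    rw [hs] at hb1' kA kB
    have hX : Q * (p u * (r + 1) ^ 2) ≤ Q * ∏ i ∈ U, p i := by
      apply Nat.mul_le_mul_left
      rw [← Finset.mul_prod_erase U _ huU]
      apply Nat.mul_le_mul_left
      have : (U.erase u).card = 2 := by rw [Finset.card_erase_of_mem huU]; omega
      rw [← this]
      exact Finset.pow_card_le_prod _ _ _ (fun i _ => hp i)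
    rcases sq_split hl with hh | hh
    · exact case3 hr (hp u) hQ0 kA hb1' hX hh
    · exact case3 hr (hp u) hQ0 kB hb1' hX hh
  · exfalso
    obtain ⟨U, hU2, hU3⟩ := Finset.exists_subset_card_eq (s := T) (n := s) (by omega)
    have hl := hNsq U hU2 (by omega)
    rcases sq_split hl with h1 | h1
    · exact case4 hr hp T U hU2 (by omega) (by omega) A.card (entropy A T c hp2 hA0 hcA) h1
    · exact case4 hr hp T U hU2 (by omega) (by omega) B.card (entropy B T c hp2 hB0 hcB) h1

theorem exists_big (r : ℕ) (hrn : r ≤ n) (hp2 : ∀ i, 2 ≤ p i) :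
    ∃ A : Finset (∀ i, Fin (p i)), CrossInt r A A ∧
      A.card = ∏ i ∈ univ.filter (fun i : Fin n => r ≤ (i : ℕ)), p i := by
  let c : ∀ i, Fin (p i) := fun i => ⟨0, by have := hp2 i; omega⟩
  let F : Finset (Fin n) := univ.filter (fun i : Fin n => (i : ℕ) < r)
  refine ⟨hBall F c 0, ?_, ?_⟩
  · intro x hx y hy
    have hF : F.card = r := by
      simp only [F]; rw [Fin.card_filter_val_lt]; omega
    rw [← hF]
    apply Finset.card_le_card
    intro i hi
    simp only [hBall, Finset.mem_filter, Finset.mem_univ, true_and, Nat.le_zero,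
      Finset.card_eq_zero, Finset.filter_eq_empty_iff, not_not] at hx hy ⊢
    rw [hx hi, hy hi]
  · rw [card_ball0]
    apply Finset.prod_congr _ (fun _ _ => rfl)
    ext i
    simp [F]

end T7

/-- Theorem 7, part 2: let `1 ≤ r ≤ n`, let `p` be a size vector with
`p_1 ≤ ⋯ ≤ p_n` and `p_1 = r + 1 > 4`, and let `A, B ⊆ S_p` be
`r`-cross-intersecting. Then `|A|·|B| ≤ ∏_{i=r+1}^n p_i²`, and in case of
equality `A = B` and this family is either obtained by fixing `r` coordinates
(a Hamming ball of radius `0` in `r` coordinates) or is a Hamming ball of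
radius `1` in `r + 2` coordinates `i`, all satisfying `p_i = r + 1`. -/
theorem theorem7_part2 {n : ℕ} (r : ℕ) (hr : 1 ≤ r) (hrn : r ≤ n)
    (hn : 0 < n)
    (p : Fin n → ℕ) (hp : ∀ i, 2 ≤ p i)
    (hmono : ∀ i j : Fin n, i ≤ j → p i ≤ p j)
    (hp1 : p ⟨0, hn⟩ = r + 1) (hr4 : 4 < r + 1)
    (A B : Finset (∀ i, Fin (p i))) (hAB : CrossInt r A B) :
    A.card * B.card ≤ (∏ i ∈ univ.filter (fun i : Fin n => r ≤ (i : ℕ)), p i) ^ 2 ∧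
    (A.card * B.card = (∏ i ∈ univ.filter (fun i : Fin n => r ≤ (i : ℕ)), p i) ^ 2 →
      A = B ∧
      ((∃ (T : Finset (Fin n)) (x₀ : ∀ i, Fin (p i)),
          T.card = r ∧ A = hBall T x₀ 0) ∨
        (∃ (T : Finset (Fin n)) (x₀ : ∀ i, Fin (p i)),
          T.card = r + 2 ∧ (∀ i ∈ T, p i = r + 1) ∧ A = hBall T x₀ 1))) := by
  classical
  have hpr : ∀ i, r + 1 ≤ p i := by
    intro i
    rw [← hp1]
    exact hmono _ _ (Fin.le_def.2 (Nat.zero_le _))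
  have hN0 : 0 < ∏ i ∈ univ.filter (fun i : Fin n => r ≤ (i : ℕ)), p i :=
    Finset.prod_pos (fun i _ => by have := hp i; omega)
  obtain ⟨C, hC, hCc⟩ := T7.exists_big (p := p) r hrn hp
  -- the bound
  have hbound : ∀ A B : Finset (∀ i, Fin (p i)), CrossInt r A B → A.card * B.card ≤
      (∏ i ∈ univ.filter (fun i : Fin n => r ≤ (i : ℕ)), p i) ^ 2 := by
    obtain ⟨⟨A', B'⟩, hm, hmax⟩ := Finset.exists_max_image
      (univ.filter (fun z : Finset (∀ i, Fin (p i)) × Finset (∀ i, Fin (p i)) =>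
        CrossInt r z.1 z.2)) (fun z => z.1.card * z.2.card) ⟨(C, C), by simpa using hC⟩
    simp only [Finset.mem_filter, Finset.mem_univ, true_and, Prod.forall] at hm hmax
    have hlow := hmax C C hC
    rw [hCc, ← sq] at hlow
    have hpos : 0 < A'.card * B'.card := lt_of_lt_of_le (by positivity) hlow
    have hM : T7.MaxPair r A' B' := ⟨hm, hmax, Nat.pos_of_mul_pos_right hpos,
      Nat.pos_of_mul_pos_left hpos⟩
    have := T7.main_struct r (by omega) hrn hpr hmono A' B' hM hlow
    intro A B hAB
    exact (hmax A B hAB).trans this.1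
  refine ⟨hbound A B hAB, ?_⟩
  intro heq
  have hpos : 0 < A.card * B.card := by rw [heq]; positivity
  have hM : T7.MaxPair r A B := ⟨hAB, fun A' B' h' => by rw [heq]; exact hbound A' B' h',
    Nat.pos_of_mul_pos_right hpos, Nat.pos_of_mul_pos_left hpos⟩
  exact (T7.main_struct r (by omega) hrn hpr hmono A B hM heq.ge).2
end
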